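/- Let K : ℕ → ℕ satisfy 1 ≤ K(n) and K(n) = O(log n). Then there exists an online algorithm for the K-choice process such that, with high probability, within the first ⌈(1 + 250/log log n)·(1 + (log n)/(2K(n)))·n⌉ rounds the algorithm's graph B_t is Hamiltonian (contains a Hamilton cycle on all n vertices) and has at most (1 + 11/log log n)·n edges. -/

import Mathlib

/-!
The `K`-choice process on vertex set `Fin n`: a uniformly random ordering of the
(non-diagonal) edges of the complete graph on `Fin n` is revealed in consecutive
blocks ("rounds") of `K` edges; in each round an online algorithm (a function of the
edges presented so far) selects at most one of the `K` presented edges and adds it,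
immediately and irrevocably, to its graph.  `selected n K A σ t` is the set of edges
selected by the algorithm `A` after `t` rounds, when the random order is `σ`.
-/

namespace KChoice

/-- The edges of the complete graph on `Fin n`. -/
abbrev EdgeType (n : ℕ) := {e : Sym2 (Fin n) // ¬ e.IsDiag}

/-- The sample space: uniformly random orderings of the edges of `K_n`. -/
abbrev Omega (n : ℕ) := Fin (Fintype.card (EdgeType n)) ≃ EdgeType n

/-- The full ordered list of revealed edges. -/
def revealList {n : ℕ} (σ : Omega n) : List (Sym2 (Fin n)) :=
  List.ofFn fun i => (σ i).1

/-- An online algorithm: given the (ordered) list of all edges presented so far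
(including the current round's block), it outputs at most one edge. -/
def Alg (n : ℕ) := List (Sym2 (Fin n)) → Option (Sym2 (Fin n))

/-- The edges presented during the first `t` rounds, in order. -/
def presented (n K : ℕ) (σ : Omega n) (t : ℕ) : List (Sym2 (Fin n)) :=
  (revealList σ).take (K * t)

/-- The block of (at most `K`) edges presented at round `t`. -/
def block (n K : ℕ) (σ : Omega n) (t : ℕ) : List (Sym2 (Fin n)) :=
  ((revealList σ).take (K * t)).drop (K * (t - 1))

/-- The set of edges selected by the algorithm `A` within the first `t` rounds.
A choice at a given round only counts if it is one of the edges presented at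
that round (so at most one edge is selected per round). -/
def selected (n K : ℕ) (A : Alg n) (σ : Omega n) : ℕ → Finset (Sym2 (Fin n))
  | 0 => ∅
  | t + 1 =>
      selected n K A σ t ∪
        (match A (presented n K σ (t + 1)) with
          | some e => if e ∈ block n K σ (t + 1) then {e} else ∅
          | none => ∅)

/-- The algorithm's graph after `t` rounds. -/
def Bgraph (n K : ℕ) (A : Alg n) (σ : Omega n) (t : ℕ) : SimpleGraph (Fin n) :=
  SimpleGraph.fromEdgeSet (↑(selected n K A σ t) : Set (Sym2 (Fin n)))

/-- The probability, under a uniformly random ordering of the edges, of an event. -/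
noncomputable def pr (n : ℕ) (Good : Omega n → Prop) : ℝ :=
  (Nat.card {σ : Omega n // Good σ} : ℝ) / (Nat.card (Omega n) : ℝ)

end KChoice

set_option linter.unusedSectionVars false

namespace KChoice

open Finset

section Sampling
variable {α : Type*} [DecidableEq α]

/-- `Ex S k g h` is the expectation of `g (h ++ b)`, where `b` is a list of `k` elements drawn
uniformly without replacement from the elements of `S` that do not occur in `h`. -/
noncomputable def Ex (S : Finset α) : ℕ → (List α → ℝ) → List α → ℝ
  | 0, g, h => g h
  | k + 1, g, h => (∑ e ∈ S \ h.toFinset, Ex S k g (h ++ [e])) / (#(S \ h.toFinset) : ℝ)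

/-- `h` is a list of distinct elements of `S`. -/
def Reach (S : Finset α) (h : List α) : Prop := h.Nodup ∧ ∀ e ∈ h, e ∈ S

variable {S : Finset α}

lemma Reach.nil : Reach S ([] : List α) := ⟨List.nodup_nil, by simp⟩

lemma Reach.concat {h : List α} (hh : Reach S h) {e : α} (he : e ∈ S \ h.toFinset) :
    Reach S (h ++ [e]) := by
  simp only [mem_sdiff, List.mem_toFinset] at he
  refine ⟨?_, ?_⟩
  · rw [List.nodup_append]
    refine ⟨hh.1, by simp, ?_⟩
    intro a ha b hb
    simp only [List.mem_singleton] at hb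
    rintro rfl
    exact he.2 (hb ▸ ha)
  · intro a ha
    simp only [List.mem_append, List.mem_singleton] at ha
    rcases ha with ha | rfl
    · exact hh.2 a ha
    · exact he.1

lemma Reach.toFinset_subset {h : List α} (hh : Reach S h) : h.toFinset ⊆ S := by
  intro e he
  exact hh.2 e (by simpa using he)

lemma Reach.card {h : List α} (hh : Reach S h) : #h.toFinset = h.length :=
  List.toFinset_card_of_nodup hh.1

lemma Reach.card_sdiff {h : List α} (hh : Reach S h) : #(S \ h.toFinset) = #S - h.length := by
  rw [card_sdiff_of_subset hh.toFinset_subset, hh.card]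

lemma Ex_mono {g g' : List α → ℝ} : ∀ (k : ℕ) (h : List α), Reach S h →
    (∀ b, b.length = k → Reach S (h ++ b) → g (h ++ b) ≤ g' (h ++ b)) →
    Ex S k g h ≤ Ex S k g' h
  | 0, h, hh, H => by simpa [Ex] using H [] rfl (by simpa using hh)
  | k + 1, h, hh, H => by
    simp only [Ex]
    gcongr with e he
    refine Ex_mono k _ (hh.concat he) ?_
    intro b hb hr
    have := H (e :: b) (by simp [hb])
    simp only [List.append_assoc, List.singleton_append] at hr ⊢
    exact this hr

lemma Ex_add_apply {g g' : List α → ℝ} : ∀ (k : ℕ) (h : List α),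
    Ex S k (fun l => g l + g' l) h = Ex S k g h + Ex S k g' h
  | 0, h => rfl
  | k + 1, h => by
    simp only [Ex, Ex_add_apply k, sum_add_distrib, add_div]

lemma Ex_const_mul (c : ℝ) {g : List α → ℝ} : ∀ (k : ℕ) (h : List α),
    Ex S k (fun l => c * g l) h = c * Ex S k g h
  | 0, h => rfl
  | k + 1, h => by
    simp only [Ex, Ex_const_mul c k, ← mul_sum, mul_div_assoc]

lemma Ex_zero : ∀ (k : ℕ) (h : List α), Ex S k (fun _ => (0 : ℝ)) h = 0
  | 0, h => rfl
  | k + 1, h => by simp [Ex, Ex_zero k]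

lemma Ex_sum {ι : Type*} (s : Finset ι) (g : ι → List α → ℝ) (k : ℕ) (h : List α) :
    Ex S k (fun l => ∑ i ∈ s, g i l) h = ∑ i ∈ s, Ex S k (g i) h := by
  classical
  induction s using Finset.induction_on with
  | empty => simpa using Ex_zero k h
  | insert a s ha ih =>
    simp only [sum_insert ha]
    rw [Ex_add_apply, ih]

lemma Ex_const (c : ℝ) : ∀ (k : ℕ) (h : List α), Reach S h → h.length + k ≤ #S →
    Ex S k (fun _ => c) h = c
  | 0, h, _, _ => rfl
  | k + 1, h, hh, hk => by
    have hpos : (0 : ℝ) < #(S \ h.toFinset) := by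
      rw [hh.card_sdiff]; exact_mod_cast (by omega)
    simp only [Ex]
    rw [div_eq_iff hpos.ne', sum_congr rfl (g := fun _ => c)]
    · simp [mul_comm]
    · intro e he
      exact Ex_const c k _ (hh.concat he) (by simp; omega)

lemma Ex_nonneg {g : List α → ℝ} (hg : ∀ l, 0 ≤ g l) (k : ℕ) (h : List α) (hh : Reach S h) :
    0 ≤ Ex S k g h := by
  rw [← Ex_zero (S := S) k h]
  exact Ex_mono k h hh fun b _ _ => hg _

lemma Ex_Ex (g : List α → ℝ) (b : ℕ) : ∀ (a : ℕ) (h : List α),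
    Ex S (a + b) g h = Ex S a (Ex S b g) h
  | 0, h => by simp [Ex]
  | a + 1, h => by
    rw [Nat.succ_add]
    simp only [Ex, Ex_Ex g b a]

/-- The first element of `U` among `k` draws lies in `Z ⊆ U` with probability at least
`k z / (#S + k u)`, where `z` and `u` are the numbers of elements of `Z` and `U` still present. -/
lemma Ex_find_ge (U Z : Finset α) (hZU : Z ⊆ U) (hUS : U ⊆ S) (z u : ℝ) (hz0 : 0 ≤ z)
    (h₀ : List α) (hz : z ≤ #(Z \ h₀.toFinset)) (hu : (#(U \ h₀.toFinset) : ℝ) ≤ u)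
    (hS : 0 < #S) (hzu : z ≤ u) :
    ∀ (k : ℕ) (b : List α), (∀ e ∈ b, e ∉ U) → Reach S (h₀ ++ b) → (h₀ ++ b).length + k ≤ #S →
    k * z / (#S + k * u) ≤
      Ex S k (fun l => if ∃ e ∈ Z, (l.drop h₀.length).find? (fun e => decide (e ∈ U)) = some e
        then 1 else 0) (h₀ ++ b)
  | 0, b, hb, hr, hl => by
    simp only [Nat.cast_zero, zero_mul, zero_div, Ex]
    split_ifs <;> norm_num
  | k + 1, b, hb, hr, hl => by
    have hNpos : (0 : ℝ) < #S := by exact_mod_cast hS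
    have hu0 : 0 ≤ u := hz0.trans hzu
    set f : List α → ℝ := fun l => if ∃ e ∈ Z, (l.drop h₀.length).find?
      (fun e => decide (e ∈ U)) = some e then 1 else 0 with hf
    set R := S \ (h₀ ++ b).toFinset with hR
    have hRpos : (0 : ℝ) < #R := by
      rw [hR, hr.card_sdiff]
      have := hl
      exact_mod_cast (by omega)
    have hRS : (#R : ℝ) ≤ #S := by exact_mod_cast card_le_card sdiff_subset
    set q : ℝ := k * z / (#S + k * u) with hq
    have hden : (0 : ℝ) < #S + k * u := by positivity
    have hq0 : 0 ≤ q := by positivity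
    have hZb : ∀ e ∈ Z, e ∉ b := fun e he hb' => hb e hb' (hZU he)
    set Z' := Z \ h₀.toFinset with hZ'
    set U' := U \ h₀.toFinset with hU'
    have hZU₁ : Z' ⊆ U' := sdiff_subset_sdiff hZU le_rfl
    have hU'R : U' ⊆ R := by
      intro e he
      simp only [hU', hR, mem_sdiff, List.mem_toFinset, List.mem_append] at he ⊢
      exact ⟨hUS he.1, fun h => h.elim he.2 fun h => hb e h he.1⟩
    have hterm : ∀ e ∈ R, (if e ∈ Z' then 1 else if e ∈ U' then 0 else q) ≤
        Ex S k f (h₀ ++ b ++ [e]) := by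
      intro e he
      have hr' := hr.concat he
      split_ifs with h1 h2
      · rw [← Ex_const (S := S) 1 k _ hr' (by simp at hl ⊢; omega)]
        refine Ex_mono k _ hr' ?_
        intro b' _ _
        have : f (h₀ ++ b ++ [e] ++ b') = 1 := by
          simp only [hf]
          rw [if_pos]
          refine ⟨e, (mem_sdiff.1 h1).1, ?_⟩
          simp only [List.append_assoc, List.drop_left', List.find?_append]
          rw [List.find?_eq_none.2]
          · simp [hZU (mem_sdiff.1 h1).1]
          · intro x hx; simpa using hb x hx
        rw [this]
      · exact Ex_nonneg (fun l => by simp only [hf]; split_ifs <;> norm_num) k _ hr'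
      · have heU : e ∉ U := by
          intro heU
          apply h2
          simp only [hU', mem_sdiff]
          refine ⟨heU, ?_⟩
          simp only [hR, mem_sdiff, List.mem_toFinset, List.mem_append] at he ⊢
          tauto
        rw [List.append_assoc]
        refine Ex_find_ge U Z hZU hUS z u hz0 h₀ hz hu hS hzu k (b ++ [e]) ?_ ?_ ?_
        · intro x hx
          simp only [List.mem_append, List.mem_singleton] at hx
          rcases hx with hx | rfl
          · exact hb x hx
          · exact heU
        · rw [← List.append_assoc]; exact hr'
        · simp at hl ⊢; omega
    have hsum : ∑ e ∈ R, (if e ∈ Z' then (1 : ℝ) else if e ∈ U' then 0 else q)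
        = #Z' + (#R - #U') * q := by
      have h1 : ∀ e ∈ R, (if e ∈ Z' then (1 : ℝ) else if e ∈ U' then 0 else q)
          = (if e ∈ Z' then 1 else 0) + (q - if e ∈ U' then q else 0) := by
        intro e _
        by_cases h1 : e ∈ Z'
        · simp [h1, hZU₁ h1]
        · by_cases h2 : e ∈ U' <;> simp [h1, h2]
      rw [sum_congr rfl h1, sum_add_distrib, sum_sub_distrib, ← sum_filter, ← sum_filter,
        filter_mem_eq_inter, filter_mem_eq_inter, inter_eq_right.2 hU'R,
        inter_eq_right.2 (hZU₁.trans hU'R)]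
      simp; ring
    have hge : (#Z' + (#R - #U') * q) / #R ≤ Ex S (k + 1) f (h₀ ++ b) := by
      simp only [Ex]
      rw [← hsum]
      gcongr with e he
      exact hterm e he
    refine le_trans ?_ hge
    have huq : u * q ≤ z := by
      rw [hq, mul_div_assoc', div_le_iff₀ hden]
      nlinarith [mul_nonneg hz0 hNpos.le]
    have h2 : z - u * q ≤ #Z' - #U' * q := by nlinarith
    have h3 : (z - u * q) / #S + q ≤ (#Z' + (#R - #U') * q) / #R := by
      have : (#Z' + (#R - #U') * q) / (#R : ℝ) = (#Z' - #U' * q) / #R + q := by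
        field_simp; ring
      rw [this]
      refine add_le_add_left ?_ q
      exact (div_le_div_of_nonneg_left (by linarith) hRpos hRS).trans (by gcongr)
    refine le_trans ?_ h3
    have h4 : (z - u * q) / #S + q = (k + 1) * z / (#S + k * u) := by
      rw [hq]; field_simp; ring
    rw [h4]
    push_cast
    apply div_le_div_of_nonneg_left (by positivity) hden
    nlinarith

end Sampling

section Average

/-- The edges of the complete graph on `Fin n`, as a finite set. -/
def edges (n : ℕ) : Finset (Sym2 (Fin n)) := univ.filter fun e => ¬ e.IsDiag

lemma card_edges (n : ℕ) : #(edges n) = Fintype.card (EdgeType n) := by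
  rw [Fintype.card_subtype, edges]

lemma mem_edges {n : ℕ} {e : Sym2 (Fin n)} : e ∈ edges n ↔ ¬ e.IsDiag := by simp [edges]

variable {n : ℕ}

lemma length_revealList (σ : Omega n) : (revealList σ).length = Fintype.card (EdgeType n) := by
  simp [revealList]

lemma mem_take_revealList {σ : Omega n} {m : ℕ} {e : Sym2 (Fin n)} :
    e ∈ (revealList σ).take m ↔ ∃ j : Fin (Fintype.card (EdgeType n)), j.1 < m ∧ (σ j).1 = e := by
  rw [List.mem_take_iff_getElem]
  constructor
  · rintro ⟨i, hi, rfl⟩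
    have hi' : i < Fintype.card (EdgeType n) := by
      rw [length_revealList] at hi; omega
    exact ⟨⟨i, hi'⟩, by simp at hi ⊢; omega, by simp [revealList]⟩
  · rintro ⟨j, hj, rfl⟩
    refine ⟨j.1, ?_, by simp [revealList]⟩
    rw [length_revealList]
    exact lt_min hj j.2

lemma take_succ_revealList (σ : Omega n) {m : ℕ} (hm : m < Fintype.card (EdgeType n)) :
    (revealList σ).take (m + 1) = (revealList σ).take m ++ [(σ ⟨m, hm⟩).1] := by
  rw [List.take_succ_eq_append_getElem (by rwa [length_revealList])]
  simp [revealList]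

lemma take_swap (σ : Omega n) {m : ℕ} (i j : Fin (Fintype.card (EdgeType n))) (hi : m ≤ i.1)
    (hj : m ≤ j.1) :
    (revealList ((Equiv.swap i j).trans σ)).take m = (revealList σ).take m := by
  apply List.ext_getElem
  · simp [length_revealList]
  · intro k h1 h2
    have hk : k < m := by simp at h1; omega
    simp only [List.getElem_take, revealList, List.getElem_ofFn, Equiv.trans_apply]
    rw [Equiv.swap_apply_of_ne_of_ne]
    · intro h; have := congrArg Fin.val h; simp only at this; omega
    · intro h; have := congrArg Fin.val h; simp only at this; omega

lemma sum_take_eq (m : ℕ) (hm : m ≤ Fintype.card (EdgeType n)) :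
    ∀ (g : List (Sym2 (Fin n)) → ℝ), ∑ σ : Omega n, g ((revealList σ).take m) =
      Fintype.card (Omega n) * Ex (edges n) m g [] := by
  induction m with
  | zero => intro g; simp [Ex]
  | succ m ih =>
    intro g
    have hm' : m < Fintype.card (EdgeType n) := hm
    rw [Ex_Ex, ← ih hm'.le]
    set N := Fintype.card (EdgeType n) with hN
    set J : Finset (Fin N) := univ.filter fun j => m ≤ j.1 with hJ
    have hmap : ∀ σ : Omega n, edges n \ ((revealList σ).take m).toFinset
        = J.image fun j => (σ j).1 := by
      intro σ
      ext e
      simp only [Finset.mem_sdiff, List.mem_toFinset, mem_take_revealList, mem_image, hJ,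
        mem_filter, mem_univ, true_and, mem_edges]
      constructor
      · rintro ⟨h1, h2⟩
        refine ⟨σ.symm ⟨e, h1⟩, ?_, by simp⟩
        by_contra h
        exact h2 ⟨σ.symm ⟨e, h1⟩, by omega, by simp⟩
      · rintro ⟨j, hj, rfl⟩
        refine ⟨(σ j).2, ?_⟩
        rintro ⟨i, hi, h⟩
        have := σ.injective (Subtype.val_injective h)
        subst this; omega
    have hinj : ∀ σ : Omega n, Set.InjOn (fun j => (σ j).1) (J : Set (Fin N)) :=
      fun σ => (Subtype.val_injective.comp σ.injective).injOn
    have hJpos : (0 : ℝ) < #J := by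
      exact_mod_cast card_pos.2 (⟨(⟨m, hm'⟩ : Fin N), by simp [hJ]⟩ : J.Nonempty)
    have h1 : ∀ σ : Omega n, Ex (edges n) 1 g ((revealList σ).take m) =
        (∑ j ∈ J, g ((revealList σ).take m ++ [(σ j).1])) / #J := by
      intro σ
      simp only [Ex]
      rw [hmap σ, sum_image (hinj σ), card_image_of_injOn (hinj σ)]
    rw [sum_congr rfl fun σ _ => h1 σ, ← sum_div, sum_comm, eq_div_iff hJpos.ne']
    have h2 : ∀ j ∈ J, ∑ σ : Omega n, g ((revealList σ).take m ++ [(σ j).1]) =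
        ∑ σ : Omega n, g ((revealList σ).take (m + 1)) := by
      intro j hj
      have hj' : m ≤ j.1 := by simpa [hJ] using hj
      let s : Omega n ≃ Omega n :=
        ⟨fun σ => (Equiv.swap ⟨m, hm'⟩ j).trans σ, fun σ => (Equiv.swap ⟨m, hm'⟩ j).trans σ,
          fun σ => by ext; simp, fun σ => by ext; simp⟩
      rw [← Equiv.sum_comp s]
      refine sum_congr rfl fun σ _ => ?_
      rw [take_succ_revealList σ hm']
      simp only [s, Equiv.coe_fn_mk]
      rw [take_swap (m := m) σ ⟨m, hm'⟩ j le_rfl hj']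
      simp
    rw [sum_congr rfl h2, sum_const, nsmul_eq_mul, mul_comm]

/-- If failure of `Good` forces the event `Bad` on the first `m` edges, the probability of `Good`
is bounded below in terms of the expectation of the indicator of `Bad`. -/
lemma one_sub_le_pr {m : ℕ} (hm : m ≤ Fintype.card (EdgeType n))
    (Good : Omega n → Prop) (g : List (Sym2 (Fin n)) → ℝ) (hg : ∀ l, 0 ≤ g l)
    (H : ∀ σ, ¬ Good σ → 1 ≤ g ((revealList σ).take m)) :
    1 - Ex (edges n) m g [] ≤ pr n Good := by
  classical
  have hpos : (0 : ℝ) < Fintype.card (Omega n) := by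
    have : Nonempty (Omega n) := ⟨(Fintype.equivFin (EdgeType n)).symm⟩
    exact_mod_cast Fintype.card_pos
  rw [pr, Nat.card_eq_fintype_card, Nat.card_eq_fintype_card, Fintype.card_subtype,
    le_div_iff₀ hpos, sub_mul, mul_comm (Ex _ _ _ _), ← sum_take_eq m hm]
  have h1 : (Fintype.card (Omega n) : ℝ) = ∑ σ : Omega n, 1 := by simp
  rw [one_mul, h1, ← sum_sub_distrib, card_filter]
  push_cast
  gcongr with σ
  split_ifs with h
  · linarith [hg ((revealList σ).take m)]
  · linarith [H σ h]

lemma pr_le_one (Good : Omega n → Prop) : pr n Good ≤ 1 := by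
  classical
  rw [pr, Nat.card_eq_fintype_card, Nat.card_eq_fintype_card]
  apply div_le_one_of_le₀ _ (by positivity)
  exact_mod_cast Fintype.card_subtype_le _

end Average

section Policy

variable {α : Type*} [DecidableEq α]

/-- The log of the first `t` rounds for the policy which, in each round, accepts the first
presented element lying in the set `U L`, where `L` is the log so far. -/
def runLog (K : ℕ) (U : List (Option α) → Finset α) : ℕ → List α → List (Option α)
  | 0, _ => []
  | t + 1, h => runLog K U t h ++
      [((h.drop (K * t)).take K).find? fun e => decide (e ∈ U (runLog K U t h))]

/-- The log after all complete rounds of the history `h`. -/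
def logOf (K : ℕ) (U : List (Option α) → Finset α) (h : List α) : List (Option α) :=
  runLog K U (h.length / K) h

variable {K : ℕ} {U : List (Option α) → Finset α}

lemma length_runLog (t : ℕ) (h : List α) : (runLog K U t h).length = t := by
  induction t with
  | zero => rfl
  | succ t ih => simp [runLog, ih]

lemma runLog_append (t : ℕ) (h b : List α) (ht : K * t ≤ h.length) :
    runLog K U t (h ++ b) = runLog K U t h := by
  induction t with
  | zero => rfl
  | succ t ih =>
    rw [Nat.mul_succ] at ht
    simp only [runLog]
    rw [ih (by omega), List.drop_append_of_le_length (by omega), List.take_append_of_le_length]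
    simp; omega

lemma runLog_take (s t : ℕ) (h : List α) (hst : s ≤ t) :
    (runLog K U t h).take s = runLog K U s h := by
  induction t, hst using Nat.le_induction with
  | base => rw [List.take_of_length_le]; rw [length_runLog]
  | succ t hst ih =>
    simp only [runLog]
    rw [List.take_append_of_le_length (by rw [length_runLog]; exact hst), ih]

lemma logOf_eq (hK : 0 < K) {h : List α} {s : ℕ} (hl : h.length = K * s) :
    logOf K U h = runLog K U s h := by
  rw [logOf, hl, Nat.mul_div_cancel_left _ hK]

lemma length_logOf (hK : 0 < K) {h : List α} {s : ℕ} (hl : h.length = K * s) :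
    (logOf K U h).length = s := by
  rw [logOf_eq hK hl, length_runLog]

lemma logOf_append (hK : 0 < K) {h b : List α} {s : ℕ} (hl : h.length = K * s)
    (hb : b.length = K) :
    logOf K U (h ++ b) = logOf K U h ++ [b.find? fun e => decide (e ∈ U (logOf K U h))] := by
  have h2 : (h ++ b).length = K * (s + 1) := by simp [hl, hb, Nat.mul_succ]
  rw [logOf_eq hK h2, logOf_eq hK hl, runLog, runLog_append _ _ _ hl.ge,
    List.drop_append_of_le_length hl.ge, List.drop_of_length_le hl.le, List.nil_append,
    List.take_of_length_le hb.le]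

lemma logOf_append_take (hK : 0 < K) {h b : List α} {s t : ℕ} (hl : h.length = K * s)
    (hb : b.length = K * t) : (logOf K U (h ++ b)).take s = logOf K U h := by
  have h2 : (h ++ b).length = K * (s + t) := by simp [hl, hb, Nat.mul_add]
  rw [logOf_eq hK h2, logOf_eq hK hl, runLog_take _ _ _ (by omega), runLog_append _ _ _ hl.ge]

/-- A log is valid for `U` if each accepted element was acceptable at the time. -/
inductive ValidLog (U : List (Option α) → Finset α) : List (Option α) → Prop
  | nil : ValidLog U []
  | skip {L} : ValidLog U L → ValidLog U (L ++ [none])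
  | accept {L e} : ValidLog U L → e ∈ U L → ValidLog U (L ++ [some e])

lemma validLog_runLog (t : ℕ) (h : List α) : ValidLog U (runLog K U t h) := by
  induction t with
  | zero => exact .nil
  | succ t ih =>
    rw [runLog]
    rcases hf : ((h.drop (K * t)).take K).find? fun e => decide (e ∈ U (runLog K U t h))
      with _ | e
    · exact .skip ih
    · exact .accept ih (by simpa using List.find?_some hf)

lemma validLog_logOf (h : List α) : ValidLog U (logOf K U h) := validLog_runLog _ _

/-- The elements accepted in a log. -/
def accepted (L : List (Option α)) : Finset α := L.reduceOption.toFinset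

@[simp] lemma accepted_nil : accepted ([] : List (Option α)) = ∅ := rfl

@[simp] lemma accepted_append (L L' : List (Option α)) :
    accepted (L ++ L') = accepted L ∪ accepted L' := by
  simp [accepted, List.reduceOption_append]

@[simp] lemma accepted_some (e : α) : accepted [some e] = {e} := by
  simp [accepted, List.reduceOption]

@[simp] lemma accepted_none : accepted [(none : Option α)] = ∅ := by
  simp [accepted, List.reduceOption]

lemma accepted_runLog_subset (t : ℕ) (h : List α) : accepted (runLog K U t h) ⊆ h.toFinset := by
  induction t with
  | zero => simp [runLog]
  | succ t ih =>
    rw [runLog, accepted_append]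
    refine union_subset ih ?_
    rcases hf : ((h.drop (K * t)).take K).find? fun e => decide (e ∈ U (runLog K U t h))
      with _ | e
    · simp
    · simp only [accepted_some, singleton_subset_iff, List.mem_toFinset]
      exact List.mem_of_mem_drop (List.mem_of_mem_take (List.mem_of_find?_eq_some hf))

variable {S : Finset α}

/-- One round of the process: if the acceptable set contains many unseen elements of `Z`, the
expectation of `Φ` after the round is controlled by its values on hitting and missing `Z`. -/
lemma Ex_round_le (hK : 0 < K) {h : List α} (hh : Reach S h) {s : ℕ} (hl : h.length = K * s)
    (hN : K * (s + 1) ≤ #S) {Z : Finset α} (hZ : Z ⊆ U (logOf K U h))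
    (hU : U (logOf K U h) ⊆ S) {z u : ℝ} (hz0 : 0 ≤ z) (hz : z ≤ #(Z \ h.toFinset))
    (hu : (#(U (logOf K U h) \ h.toFinset) : ℝ) ≤ u) {Φ : List α → ℝ} {a b : ℝ} (hab : b ≤ a)
    (hmiss : ∀ l, l.length = K → Reach S (h ++ l) → Φ (h ++ l) ≤ a)
    (hhit : ∀ l, l.length = K → Reach S (h ++ l) → ∀ e ∈ Z,
      logOf K U (h ++ l) = logOf K U h ++ [some e] → Φ (h ++ l) ≤ b) :
    Ex S K Φ h ≤ a - (a - b) * (K * z / (#S + K * u)) := by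
  classical
  set V := U (logOf K U h) with hV
  set I : List α → ℝ := fun l => if ∃ e ∈ Z, (l.drop h.length).find? (fun e => decide (e ∈ V))
    = some e then 1 else 0 with hI
  have hS : 0 < #S := lt_of_lt_of_le (Nat.mul_pos hK (Nat.succ_pos s)) hN
  have hzu : z ≤ u := hz.trans <| (Nat.cast_le.2 <| card_le_card <|
    sdiff_subset_sdiff hZ (Subset.refl _)).trans hu
  have hlen : h.length + K ≤ #S := by rw [hl, ← Nat.mul_succ]; exact hN
  have h1 : K * z / (#S + K * u) ≤ Ex S K I h := by
    simpa using Ex_find_ge V Z hZ hU z u hz0 h hz hu hS hzu K [] (by simp) (by simpa using hh)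
      (by simpa using hlen)
  have h2 : Ex S K Φ h ≤ Ex S K (fun l => a + (-(a - b)) * I l) h := by
    refine Ex_mono K h hh fun l hlK hr => ?_
    simp only [hI, List.drop_left]
    split_ifs with hc
    · obtain ⟨e, he, hf⟩ := hc
      have := hhit l hlK hr e he (by rw [logOf_append hK hl hlK, ← hV, hf])
      linarith
    · have := hmiss l hlK hr
      linarith
  rw [Ex_add_apply, Ex_const_mul, Ex_const a K h hh hlen] at h2
  nlinarith

lemma one_sub_exp_mul_nonneg {N : ℕ} {θ ζ u : ℝ} (hθ : 0 ≤ θ) (hζ : 0 ≤ ζ) (hζu : ζ ≤ u) :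
    0 ≤ 1 - (1 - Real.exp (-θ)) * (K * ζ / (N + K * u)) := by
  have e1 : Real.exp (-θ) ≤ 1 := Real.exp_le_one_iff.2 (by linarith)
  have e2 := Real.exp_pos (-θ)
  have hu := hζ.trans hζu
  have e3 : K * ζ / (N + K * u) ≤ 1 := by
    apply div_le_one_of_le₀ _ (by positivity)
    have : (K : ℝ) * ζ ≤ K * u := by gcongr
    have : (0 : ℝ) ≤ N := by positivity
    linarith
  have e4 : 0 ≤ K * ζ / (N + K * u) := by positivity
  nlinarith

open Classical in
/-- Concentration for a counter which increases whenever an element of a large set is accepted: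
it is unlikely to stay below `cap` for `T` rounds. -/
lemma Ex_collect_le (hK : 0 < K) {P : List α → Prop} {c : List (Option α) → ℝ}
    {cap θ ζ u : ℝ} (hθ : 0 ≤ θ) (hζ : 0 ≤ ζ) (hζu : ζ ≤ u) {t₁ : ℕ} (hN : K * t₁ ≤ #S)
    (hP : ∀ h b, Reach S (h ++ b) → P (h ++ b) → K ∣ h.length → P h)
    {t₀ : ℕ}
    (hstep : ∀ h s, Reach S h → h.length = K * s → t₀ ≤ s → s < t₁ → P h →
      ∃ Z ⊆ U (logOf K U h), U (logOf K U h) ⊆ S ∧ ζ ≤ #(Z \ h.toFinset) ∧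
        (#(U (logOf K U h) \ h.toFinset) : ℝ) ≤ u ∧
        (∀ e ∈ Z, c (logOf K U h) + 1 ≤ c (logOf K U h ++ [some e])) ∧
        (∀ e ∈ U (logOf K U h), c (logOf K U h) ≤ c (logOf K U h ++ [some e])) ∧
        c (logOf K U h) ≤ c (logOf K U h ++ [none]))
    (hcap : ∀ h, Reach S h → h.length = K * t₁ → P h → c (logOf K U h) ≤ cap) :
    ∀ (T : ℕ) (h : List α) (s : ℕ), Reach S h → h.length = K * s → t₀ ≤ s → s + T = t₁ →
      Ex S (K * T) (fun l => if P l then 1 else 0) h ≤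
        Real.exp (θ * (cap - c (logOf K U h))) *
          (1 - (1 - Real.exp (-θ)) * (K * ζ / (#S + K * u))) ^ T
  | 0, h, s, hh, hl, hs, hT => by
    simp only [Nat.mul_zero, Ex, pow_zero, mul_one]
    split_ifs with hp
    · rw [Real.one_le_exp_iff]
      exact mul_nonneg hθ (sub_nonneg.2 (hcap h hh (by rw [hl]; congr 1) hp))
    · positivity
  | T + 1, h, s, hh, hl, hs, hT => by
    by_cases hp : P h
    · obtain ⟨Z, hZ, hU, hz, hu, h1, h2, h3⟩ := hstep h s hh hl hs (by omega) hp
      rw [Nat.mul_succ, Nat.add_comm, Ex_Ex]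
      have hρ0 := one_sub_exp_mul_nonneg (K := K) (N := #S) hθ hζ hζu
      set ρ := 1 - (1 - Real.exp (-θ)) * (K * ζ / (#S + K * u)) with hρ
      have ih := Ex_collect_le hK hθ hζ hζu hN hP hstep hcap T
      have hlen : ∀ l : List α, l.length = K → (h ++ l).length = K * (s + 1) := by
        intro l hl'; simp [hl, hl', Nat.mul_succ]
      set a := Real.exp (θ * (cap - c (logOf K U h))) * ρ ^ T with ha
      have key := Ex_round_le (Φ := Ex S (K * T) (fun l => if P l then 1 else 0))
        (a := a) (b := a * Real.exp (-θ)) hK hh hl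
        (le_trans (Nat.mul_le_mul_left K (by omega : s + 1 ≤ t₁)) hN) hZ hU hζ hz hu
        (mul_le_of_le_one_right (by positivity) (Real.exp_le_one_iff.2 (by linarith)))
        (fun l hlK hr => by
          refine (ih (h ++ l) (s + 1) hr (hlen l hlK) (by omega) (by omega)).trans ?_
          have : c (logOf K U h) ≤ c (logOf K U (h ++ l)) := by
            rw [logOf_append hK hl hlK]
            rcases hf : l.find? fun e => decide (e ∈ U (logOf K U h)) with _ | e
            · exact h3
            · exact h2 e (by simpa using List.find?_some hf)
          rw [ha]
          gcongr)
        (fun l hlK hr e he hlog => by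
          refine (ih (h ++ l) (s + 1) hr (hlen l hlK) (by omega) (by omega)).trans ?_
          rw [ha, mul_right_comm, ← Real.exp_add, hlog]
          gcongr
          nlinarith [h1 e he])
      refine key.trans (le_of_eq ?_)
      rw [pow_succ, ← mul_assoc, ← ha, hρ]
      ring
    · have : Ex S (K * (T + 1)) (fun l => if P l then (1 : ℝ) else 0) h ≤
          Ex S (K * (T + 1)) (fun _ => 0) h := by
        refine Ex_mono _ _ hh fun b _ hr => ?_
        rw [if_neg fun hc => hp (hP h b hr hc ⟨s, hl⟩)]
      rw [Ex_zero] at this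
      refine this.trans ?_
      have := one_sub_exp_mul_nonneg (K := K) (N := #S) hθ hζ hζu
      positivity

/-- The number of elements accepted after the first `t₀` rounds. -/
def acceptedSince (t₀ : ℕ) (L : List (Option α)) : ℕ := (L.drop t₀).reduceOption.length

lemma acceptedSince_le (t₀ : ℕ) (L : List (Option α)) :
    acceptedSince t₀ L + t₀ ≤ max L.length t₀ := by
  have := List.reduceOption_length_le (L.drop t₀)
  rw [List.length_drop] at this
  rw [acceptedSince]
  omega

lemma acceptedSince_some {t₀ : ℕ} {L : List (Option α)} (h : t₀ ≤ L.length) (e : α) :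
    acceptedSince t₀ (L ++ [some e]) = acceptedSince t₀ L + 1 := by
  rw [acceptedSince, acceptedSince, List.drop_append_of_le_length h, List.reduceOption_append]
  simp [List.reduceOption]

lemma acceptedSince_none {t₀ : ℕ} {L : List (Option α)} (h : t₀ ≤ L.length) :
    acceptedSince t₀ (L ++ [none]) = acceptedSince t₀ L := by
  rw [acceptedSince, acceptedSince, List.drop_append_of_le_length h, List.reduceOption_append]
  simp [List.reduceOption]

open Classical in
/-- If at most `J` acceptances are possible and, after `i` of them, at least `z i` unseen elements
are acceptable, then the process is unlikely to remain unfinished for many rounds. -/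
lemma Ex_progress_le (hK : 0 < K) {P : List α → Prop} {J : ℕ} {z : ℕ → ℝ}
    {t₀ t₁ : ℕ} (hJ : t₀ + J < t₁) (hN : K * t₁ ≤ #S)
    (hP : ∀ h b, Reach S (h ++ b) → P (h ++ b) → K ∣ h.length → P h)
    (hz : ∀ i < J, 0 < z i)
    (hstep : ∀ h s, Reach S h → h.length = K * s → t₀ ≤ s → s < t₁ → P h →
      acceptedSince t₀ (logOf K U h) < J ∧ U (logOf K U h) ⊆ S ∧
        z (acceptedSince t₀ (logOf K U h)) ≤ #(U (logOf K U h) \ h.toFinset))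
    (hend : ∀ h, Reach S h → h.length = K * t₁ → P h → acceptedSince t₀ (logOf K U h) ≤ J) :
    ∀ (T : ℕ) (h : List α) (s : ℕ), Reach S h → h.length = K * s → t₀ ≤ s → s + T = t₁ →
      Ex S (K * T) (fun l => if P l then 1 else 0) h ≤
        ((s - t₀ - acceptedSince t₀ (logOf K U h) : ℝ) +
          ∑ i ∈ Ico (acceptedSince t₀ (logOf K U h)) J, #S / (K * z i)) / (t₁ - t₀ - J)
  | T, h, s, hh, hl, hs, hT => by
    have hD : (0 : ℝ) < t₁ - t₀ - J := by
      have : ((t₀ + J : ℕ) : ℝ) < t₁ := by exact_mod_cast hJ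
      push_cast at this; linarith
    have hcnt : ∀ (h : List α) (s : ℕ), h.length = K * s → t₀ ≤ s →
        (acceptedSince t₀ (logOf K U h) : ℝ) + t₀ ≤ s := by
      intro h s hl hs
      have := acceptedSince_le t₀ (logOf K U h)
      rw [length_logOf hK hl, max_eq_left hs] at this
      exact_mod_cast this
    have hsum : ∀ a, (0 : ℝ) ≤ ∑ i ∈ Ico a J, #S / (K * z i) := fun a =>
      sum_nonneg fun i hi => by have := hz i (mem_Ico.1 hi).2; positivity
    by_cases hp : P h
    swap
    · have : Ex S (K * T) (fun l => if P l then (1 : ℝ) else 0) h ≤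
          Ex S (K * T) (fun _ => 0) h := by
        refine Ex_mono _ _ hh fun b _ hr => ?_
        rw [if_neg fun hc => hp (hP h b hr hc ⟨s, hl⟩)]
      rw [Ex_zero] at this
      refine this.trans (div_nonneg ?_ hD.le)
      have h1 := hcnt h s hl hs
      have h2 := hsum (acceptedSince t₀ (logOf K U h))
      linarith
    match T, hT with
    | 0, hT =>
      simp only [Nat.mul_zero, Ex]
      rw [if_pos hp, le_div_iff₀ hD]
      have h1 := hend h hh (by rw [hl]; congr 1) hp
      have h1' : (acceptedSince t₀ (logOf K U h) : ℝ) ≤ J := by exact_mod_cast h1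
      have h2 := hsum (acceptedSince t₀ (logOf K U h))
      have h3 : (s : ℝ) = t₁ := by exact_mod_cast (by omega : s = t₁)
      linarith
    | T + 1, hT =>
      obtain ⟨haJ, hU, hzc⟩ := hstep h s hh hl hs (by omega) hp
      rw [Nat.mul_succ, Nat.add_comm, Ex_Ex]
      have ih := Ex_progress_le hK hJ hN hP hz hstep hend T
      have hlen : ∀ l : List α, l.length = K → (h ++ l).length = K * (s + 1) := by
        intro l hl'; simp [hl, hl', Nat.mul_succ]
      have hloglen : t₀ ≤ (logOf K U h).length := by rw [length_logOf hK hl]; exact hs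
      set a := acceptedSince t₀ (logOf K U h) with ha
      have hza := hz a haJ
      set z' : ℝ := (#(U (logOf K U h) \ h.toFinset) : ℝ) with hz'
      set c : ℝ := #S / (K * z a) with hc
      set D : ℝ := t₁ - t₀ - J with hDdef
      have hKr : (0 : ℝ) < K := by exact_mod_cast hK
      have hc0 : 0 ≤ c := by positivity
      have hsplit : ∑ i ∈ Ico a J, (#S : ℝ) / (K * z i) =
          c + ∑ i ∈ Ico (a + 1) J, (#S : ℝ) / (K * z i) := by
        rw [sum_eq_sum_Ico_succ_bot haJ]
      have h1 := hcnt h s hl hs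
      rw [← ha] at h1
      have h2 := hsum (a + 1)
      set R' := ∑ i ∈ Ico (a + 1) J, (#S : ℝ) / (K * z i) with hR
      have key := Ex_round_le (Φ := Ex S (K * T) (fun l => if P l then 1 else 0))
        (Z := U (logOf K U h)) (z := z') (u := z')
        (a := ((s + 1 - t₀ - a : ℝ) + (c + R')) / D) (b := ((s - t₀ - a : ℝ) + R') / D) hK hh hl
        (le_trans (Nat.mul_le_mul_left K (by omega : s + 1 ≤ t₁)) hN) (Subset.refl _) hU
        (by positivity) le_rfl le_rfl (by gcongr ?_ / _; linarith)
        (fun l hlK hr => by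
          refine (ih (h ++ l) (s + 1) hr (hlen l hlK) (by omega) (by omega)).trans ?_
          rw [logOf_append hK hl hlK]
          rcases hf : l.find? fun e => decide (e ∈ U (logOf K U h)) with _ | e
          · rw [acceptedSince_none hloglen, ← ha, hsplit]
            push_cast
            exact le_rfl
          · rw [acceptedSince_some hloglen, ← ha]
            push_cast
            gcongr ?_ / _
            linarith)
        (fun l hlK hr e he hlog => by
          refine (ih (h ++ l) (s + 1) hr (hlen l hlK) (by omega) (by omega)).trans ?_
          rw [hlog, acceptedSince_some hloglen, ← ha]
          push_cast
          gcongr ?_ / _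
          linarith)
      refine key.trans ?_
      rw [hsplit]
      have hS : (0 : ℝ) ≤ #S := by positivity
      have hz'0 : 0 < z' := hza.trans_le hzc
      have hprob : 1 ≤ (1 + c) * (K * z' / (#S + K * z')) := by
        rw [hc, ← mul_div_assoc, le_div_iff₀ (by positivity), one_mul, add_mul, one_mul,
          add_comm]
        gcongr
        rw [div_mul_eq_mul_div, le_div_iff₀ (by positivity)]
        gcongr
      have e1 : ((s + 1 - t₀ - a : ℝ) + (c + R')) / D - ((s - t₀ - a : ℝ) + R') / D
          = (1 + c) / D := by ring
      have e2 : ((s + 1 - t₀ - a : ℝ) + (c + R')) / D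
          = ((s - t₀ - a : ℝ) + (c + R')) / D + 1 / D := by ring
      rw [e1, e2, div_mul_eq_mul_div]
      have : 1 / D ≤ (1 + c) * (K * z' / (#S + K * z')) / D := by gcongr
      linarith

end Policy

section Assembly

variable {α : Type*} [DecidableEq α] {S : Finset α}

lemma Ex_le_of_forall_prefix {f : List α → ℝ} {ε : ℝ} (a b : ℕ) (ha : a ≤ #S)
    (H : ∀ h, Reach S h → h.length = a → Ex S b f h ≤ ε) : Ex S (a + b) f [] ≤ ε := by
  rw [Ex_Ex, ← Ex_const (S := S) ε a [] Reach.nil (by simpa using ha)]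
  exact Ex_mono a [] Reach.nil fun l hl hr => H _ hr (by simpa using hl)

lemma Ex_take_le {f : List α → ℝ} (a b : ℕ) (hab : a + b ≤ #S) :
    Ex S (a + b) (fun l => f (l.take a)) [] ≤ Ex S a f [] := by
  rw [Ex_Ex]
  refine Ex_mono a [] Reach.nil fun l hl hr => ?_
  simp only [List.nil_append] at hr ⊢
  rw [← Ex_const (S := S) (f l) b l hr (by omega)]
  refine Ex_mono b l hr fun l' _ _ => ?_
  rw [List.take_append_of_le_length hl.ge, List.take_of_length_le hl.le]

/-- Exponential moment of the number of elements of `Q` among the draws. -/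
lemma Ex_pow_card_inter_le {Q : Finset α} (hQ : Q ⊆ S) {lam : ℝ} (hlam : 1 ≤ lam) {M : ℕ}
    (hM : M < #S) : ∀ (k : ℕ) (h : List α), Reach S h → h.length + k ≤ M →
    Ex S k (fun l => lam ^ #(Q ∩ l.toFinset)) h ≤
      lam ^ #(Q ∩ h.toFinset) * (1 + (lam - 1) * #Q / (#S - M)) ^ k
  | 0, h, hh, hk => by simp [Ex]
  | k + 1, h, hh, hk => by
    have hS : (0 : ℝ) < #S - M := by
      have : (M : ℝ) < #S := by exact_mod_cast hM
      linarith
    set ρ := 1 + (lam - 1) * #Q / (#S - M) with hρ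
    have hρ0 : 0 ≤ (lam - 1) * #Q / (#S - M) :=
      div_nonneg (mul_nonneg (by linarith) (by positivity)) hS.le
    have hcard : (#S - M : ℝ) ≤ #(S \ h.toFinset) := by
      rw [hh.card_sdiff, Nat.cast_sub (by omega)]
      have : (h.length : ℝ) ≤ M := by exact_mod_cast (by omega : h.length ≤ M)
      linarith
    have hpos := hS.trans_le hcard
    simp only [Ex]
    rw [div_le_iff₀ hpos]
    have h1 : ∀ e ∈ S \ h.toFinset, Ex S k (fun l => lam ^ #(Q ∩ l.toFinset)) (h ++ [e]) ≤
        lam ^ #(Q ∩ h.toFinset) * ρ ^ k * (1 + (lam - 1) * if e ∈ Q then 1 else 0) := by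
      intro e he
      refine (Ex_pow_card_inter_le hQ hlam hM k (h ++ [e]) (hh.concat he)
        (by simp; omega)).trans ?_
      rw [mul_right_comm]
      refine mul_le_mul_of_nonneg_right ?_ (by positivity)
      have hle : #(Q ∩ (h ++ [e]).toFinset) ≤
          #(Q ∩ h.toFinset) + if e ∈ Q then 1 else 0 := by
        rw [List.toFinset_append, inter_union_distrib_left]
        refine (card_union_le _ _).trans (Nat.add_le_add_left ?_ _)
        split_ifs with hq
        · exact (card_le_card inter_subset_right).trans (by simp)
        · rw [Nat.le_zero, card_eq_zero]
          ext x
          simp only [mem_inter, List.toFinset_cons, List.toFinset_nil, mem_insert,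
            notMem_empty, or_false, iff_false, not_and]
          rintro hx rfl
          exact hq hx
      refine (pow_le_pow_right₀ hlam hle).trans ?_
      rw [pow_add]
      gcongr
      split_ifs <;> simp
    refine (sum_le_sum h1).trans ?_
    rw [← mul_sum, pow_succ, ← mul_assoc, mul_assoc (_ * _)]
    refine mul_le_mul_of_nonneg_left ?_ (by positivity)
    rw [sum_add_distrib, ← mul_sum, sum_const, nsmul_eq_mul, mul_one, hρ, add_mul, one_mul]
    refine add_le_add le_rfl ?_
    have h2 : (∑ e ∈ S \ h.toFinset, if e ∈ Q then (1 : ℝ) else 0) ≤ #Q := by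
      rw [sum_ite, sum_const_zero, add_zero, sum_const, nsmul_eq_mul, mul_one]
      exact_mod_cast card_le_card fun x hx => (mem_filter.1 hx).2
    calc (lam - 1) * (∑ e ∈ S \ h.toFinset, if e ∈ Q then (1 : ℝ) else 0)
        ≤ (lam - 1) * #Q := mul_le_mul_of_nonneg_left h2 (by linarith)
      _ = (lam - 1) * #Q / (#S - M) * (#S - M) := by field_simp
      _ ≤ _ := by gcongr

open Classical in
/-- Tail bound for the number of elements of `Q` among the draws. -/
lemma Ex_card_inter_tail {Q : Finset α} (hQ : Q ⊆ S) {lam : ℝ} (hlam : 1 ≤ lam) {M : ℕ}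
    (hM : M < #S) {q : ℝ} (hq : #Q ≤ q) (k : ℕ) :
    Ex S M (fun l => if k ≤ #(Q ∩ l.toFinset) then 1 else 0) [] ≤
      (lam ^ k)⁻¹ * Real.exp ((lam - 1) * q * M / (#S - M)) := by
  have hS : (0 : ℝ) < #S - M := by
    have : (M : ℝ) < #S := by exact_mod_cast hM
    linarith
  have h1 : Ex S M (fun l => if k ≤ #(Q ∩ l.toFinset) then 1 else 0) [] ≤
      Ex S M (fun l => (lam ^ k)⁻¹ * lam ^ #(Q ∩ l.toFinset)) [] := by
    refine Ex_mono M [] Reach.nil fun l _ _ => ?_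
    split_ifs with hc
    · rw [← div_eq_inv_mul, le_div_iff₀ (by positivity), one_mul]
      exact pow_le_pow_right₀ hlam hc
    · positivity
  refine h1.trans ?_
  rw [Ex_const_mul]
  refine mul_le_mul_of_nonneg_left ?_ (by positivity)
  refine (Ex_pow_card_inter_le hQ hlam hM M [] Reach.nil (by simp)).trans ?_
  simp only [List.toFinset_nil, inter_empty, card_empty, pow_zero, one_mul]
  have hl1 : 0 ≤ lam - 1 := by linarith
  have hle : (lam - 1) * #Q / (#S - M) ≤ (lam - 1) * q / (#S - M) := by gcongr
  calc (1 + (lam - 1) * #Q / (#S - M)) ^ M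
      ≤ (Real.exp ((lam - 1) * q / (#S - M))) ^ M := by
        gcongr
        rw [add_comm]
        exact (add_le_add_left hle 1).trans (Real.add_one_le_exp _)
    _ = _ := by rw [← Real.exp_nat_mul]; congr 1; ring

end Assembly

section Sparse

variable {n : ℕ}

/-- All degrees are at most `Δ`, and sets `Y` of at most `m` vertices span at most `κ |Y|` edges. -/
structure Sparse (Δ m κ : ℕ) (H : Finset (Sym2 (Fin n))) : Prop where
  degree_le : ∀ v, #(H.filter (v ∈ ·)) ≤ Δ
  span_le : ∀ Y : Finset (Fin n), #Y ≤ m → #(H.filter fun e => ∀ v ∈ e, v ∈ Y) ≤ κ * #Y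

lemma Sparse.mono {Δ m κ : ℕ} {H H' : Finset (Sym2 (Fin n))} (hH : H ⊆ H')
    (h : Sparse Δ m κ H') : Sparse Δ m κ H :=
  ⟨fun v => (card_le_card (filter_subset_filter _ hH)).trans (h.1 v),
    fun Y hY => (card_le_card (filter_subset_filter _ hH)).trans (h.2 Y hY)⟩

lemma card_filter_mem_le (H : Finset (Sym2 (Fin n))) (v : Fin n) : #(H.filter (v ∈ ·)) ≤ n := by
  calc #(H.filter (v ∈ ·)) ≤ #(univ.image fun u : Fin n => s(v, u)) := by
        refine card_le_card fun e he => ?_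
        obtain ⟨u, rfl⟩ := (mem_filter.1 he).2
        exact mem_image_of_mem _ (mem_univ u)
    _ ≤ n := card_image_le.trans (by simp)

lemma card_filter_within_le (H : Finset (Sym2 (Fin n))) (Y : Finset (Fin n)) :
    #(H.filter fun e => ∀ v ∈ e, v ∈ Y) ≤ #Y ^ 2 := by
  calc #(H.filter fun e => ∀ v ∈ e, v ∈ Y)
      ≤ #((Y ×ˢ Y).image fun p : Fin n × Fin n => s(p.1, p.2)) := by
        refine card_le_card fun e he => ?_
        induction e with
        | _ a b =>
          have := (mem_filter.1 he).2
          exact mem_image.2 ⟨(a, b), by simp [this], rfl⟩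
    _ ≤ _ := card_image_le.trans (by simp [sq])

open Classical in
/-- The first `M` edges of the random ordering are unlikely not to be sparse. -/
lemma Ex_not_sparse_le {Δ m κ M : ℕ} (hM : M < #(edges n)) (lam : ℕ → ℝ)
    (hlam : ∀ y, 1 ≤ y → y ≤ m → 1 ≤ lam y) :
    Ex (edges n) M (fun l => if Sparse Δ m κ l.toFinset then 0 else 1) [] ≤
      n * (((2 : ℝ) ^ Δ)⁻¹ * Real.exp (n * M / (#(edges n) - M))) +
      ∑ y ∈ Icc 1 m, n.choose y * ((lam y ^ (κ * y))⁻¹ *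
        Real.exp ((lam y - 1) * y ^ 2 * M / (#(edges n) - M))) := by
  set St : Fin n → Finset (Sym2 (Fin n)) := fun v => (edges n).filter (v ∈ ·) with hSt
  set Wi : Finset (Fin n) → Finset (Sym2 (Fin n)) := fun Y =>
    (edges n).filter fun e => ∀ v ∈ e, v ∈ Y with hWi
  have h1 : Ex (edges n) M (fun l => if Sparse Δ m κ l.toFinset then 0 else 1) [] ≤
      Ex (edges n) M (fun l => (∑ v : Fin n, if Δ ≤ #(St v ∩ l.toFinset) then (1 : ℝ) else 0) +
        ∑ y ∈ Icc 1 m, ∑ Y ∈ powersetCard y (univ : Finset (Fin n)),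
          if κ * y ≤ #(Wi Y ∩ l.toFinset) then (1 : ℝ) else 0) [] := by
    refine Ex_mono M [] Reach.nil fun l _ hr => ?_
    simp only [List.nil_append] at hr ⊢
    have hA : (0 : ℝ) ≤ ∑ v : Fin n, if Δ ≤ #(St v ∩ l.toFinset) then (1 : ℝ) else 0 :=
      sum_nonneg fun _ _ => by split_ifs <;> norm_num
    have hB' : ∀ y : ℕ, (0 : ℝ) ≤ ∑ Y ∈ powersetCard y (univ : Finset (Fin n)),
          if κ * y ≤ #(Wi Y ∩ l.toFinset) then (1 : ℝ) else 0 :=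
      fun y => sum_nonneg fun _ _ => by split_ifs <;> norm_num
    have hB : (0 : ℝ) ≤ ∑ y ∈ Icc 1 m, ∑ Y ∈ powersetCard y (univ : Finset (Fin n)),
          if κ * y ≤ #(Wi Y ∩ l.toFinset) then (1 : ℝ) else 0 := sum_nonneg fun y _ => hB' y
    have hinter : ∀ (p : Sym2 (Fin n) → Prop) [DecidablePred p], (edges n).filter p ∩ l.toFinset =
        l.toFinset.filter p := by
      intro p _
      ext e
      simp only [mem_inter, mem_filter]
      exact ⟨fun h => ⟨h.2, h.1.2⟩, fun h => ⟨⟨hr.toFinset_subset h.1, h.2⟩, h.1⟩⟩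
    split_ifs with hs
    · positivity
    by_contra hlt
    push Not at hlt
    apply hs
    refine ⟨fun v => ?_, fun Y hY => ?_⟩
    · by_contra hc
      have : (1 : ℝ) ≤ ∑ v : Fin n, if Δ ≤ #(St v ∩ l.toFinset) then (1 : ℝ) else 0 := by
        refine le_trans ?_ (single_le_sum (f := fun v => if Δ ≤ #(St v ∩ l.toFinset) then
          (1 : ℝ) else 0) (fun _ _ => by split_ifs <;> norm_num) (mem_univ v))
        simp only [hSt]
        rw [hinter, if_pos (by omega)]
      linarith
    · rcases Nat.eq_zero_or_pos #Y with h0 | h0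
      · rw [card_eq_zero] at h0
        subst h0
        simp only [card_empty, mul_zero, nonpos_iff_eq_zero, card_eq_zero]
        refine filter_eq_empty_iff.2 fun e _ he => ?_
        induction e with
        | _ a b => simpa using he a (by simp)
      · by_contra hc
        have h2 : (1 : ℝ) ≤ ∑ Y' ∈ powersetCard #Y (univ : Finset (Fin n)),
            if κ * #Y ≤ #(Wi Y' ∩ l.toFinset) then (1 : ℝ) else 0 := by
          refine le_trans ?_ (single_le_sum (f := fun Y' => if κ * #Y ≤ #(Wi Y' ∩ l.toFinset) then
            (1 : ℝ) else 0) (fun _ _ => by split_ifs <;> norm_num)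
            (mem_powersetCard.2 ⟨subset_univ Y, rfl⟩))
          simp only [hWi]
          rw [hinter, if_pos (by omega)]
        have h3 := single_le_sum (f := fun y => ∑ Y ∈ powersetCard y (univ : Finset (Fin n)),
          if κ * y ≤ #(Wi Y ∩ l.toFinset) then (1 : ℝ) else 0) (fun y _ => hB' y)
          (mem_Icc.2 ⟨h0, hY⟩)
        linarith
  refine h1.trans ?_
  rw [Ex_add_apply, Ex_sum, Ex_sum]
  refine add_le_add ?_ ?_
  · refine (sum_le_card_nsmul _ _ _ fun v _ => Ex_card_inter_tail (lam := 2) (q := n)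
      (filter_subset _ _) (by norm_num) hM (by exact_mod_cast card_filter_mem_le _ v) Δ).trans ?_
    rw [card_univ, Fintype.card_fin, nsmul_eq_mul]
    norm_num
  · refine sum_le_sum fun y hy => ?_
    rw [mem_Icc] at hy
    rw [Ex_sum]
    refine (sum_le_card_nsmul _ _ _ fun Y hY => Ex_card_inter_tail (q := (y : ℝ) ^ 2)
      (filter_subset _ _) (hlam y hy.1 hy.2) hM ?_ (κ * y)).trans ?_
    · rw [← (mem_powersetCard.1 hY).2]
      exact_mod_cast card_filter_within_le _ Y
    · rw [card_powersetCard, card_univ, Fintype.card_fin, nsmul_eq_mul]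

end Sparse

section Pairs

variable {V : Type*} [DecidableEq V]

/-- The pairs of consecutive elements of a list. -/
def pairSet : List V → Finset (Sym2 V)
  | a :: b :: l => insert s(a, b) (pairSet (b :: l))
  | _ => ∅

@[simp] lemma pairSet_nil : pairSet ([] : List V) = ∅ := rfl

@[simp] lemma pairSet_singleton (a : V) : pairSet [a] = ∅ := rfl

@[simp] lemma pairSet_cons_cons (a b : V) (l : List V) :
    pairSet (a :: b :: l) = insert s(a, b) (pairSet (b :: l)) := rfl

lemma mem_of_mem_pairSet {l : List V} {e : Sym2 V} (he : e ∈ pairSet l) {v : V} (hv : v ∈ e) :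
    v ∈ l := by
  induction l with
  | nil => simp at he
  | cons a l ih =>
    cases l with
    | nil => simp at he
    | cons b l =>
      rw [pairSet_cons_cons, mem_insert] at he
      rcases he with rfl | he
      · rw [Sym2.mem_iff] at hv
        rcases hv with rfl | rfl <;> simp
      · exact List.mem_cons_of_mem _ (ih he)

lemma pairSet_append_cons (l l' : List V) (a : V) :
    pairSet (l ++ a :: l') = pairSet (l ++ [a]) ∪ pairSet (a :: l') := by
  induction l with
  | nil => simp
  | cons b l ih =>
    cases l with
    | nil => simp
    | cons c l => simp only [List.cons_append, pairSet_cons_cons, insert_union] at ih ⊢; rw [ih]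

lemma pairSet_bridge (l l' : List V) (a b : V) :
    pairSet (l ++ a :: b :: l') =
      insert s(a, b) (pairSet (l ++ [a]) ∪ pairSet (b :: l')) := by
  rw [pairSet_append_cons, pairSet_cons_cons, union_insert]

lemma pairSet_reverse (l : List V) : pairSet l.reverse = pairSet l := by
  induction l with
  | nil => rfl
  | cons a l ih =>
    cases l with
    | nil => rfl
    | cons b l =>
      rw [pairSet_cons_cons, ← ih, List.reverse_cons, List.reverse_cons, List.append_assoc,
        List.singleton_append, pairSet_bridge]
      simp [Sym2.eq_swap]

lemma pairSet_subset_append_left (l l' : List V) : pairSet l ⊆ pairSet (l ++ l') := by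
  rcases List.eq_nil_or_concat l with rfl | ⟨l, a, rfl⟩
  · simp
  · rw [List.concat_eq_append, List.append_assoc, List.singleton_append, pairSet_append_cons l l' a]
    exact subset_union_left

lemma pairSet_subset_append_right (l l' : List V) : pairSet l' ⊆ pairSet (l ++ l') := by
  cases l' with
  | nil => simp
  | cons a l' =>
    rw [pairSet_append_cons]
    exact subset_union_right

lemma card_pairSet {l : List V} (hl : l.Nodup) : #(pairSet l) = l.length - 1 := by
  induction l with
  | nil => rfl
  | cons a l ih =>
    cases l with
    | nil => rfl
    | cons b l =>
      rw [pairSet_cons_cons, card_insert_of_notMem, ih hl.of_cons]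
      · simp
      · intro h
        exact (List.nodup_cons.1 hl).1 (mem_of_mem_pairSet h (Sym2.mem_mk_left a b))

lemma not_isDiag_of_mem_pairSet {l : List V} (hl : l.Nodup) {e : Sym2 V} (he : e ∈ pairSet l) :
    ¬ e.IsDiag := by
  induction l with
  | nil => simp at he
  | cons a l ih =>
    cases l with
    | nil => simp at he
    | cons b l =>
      rw [pairSet_cons_cons, mem_insert] at he
      rcases he with rfl | he
      · rintro h
        simp only [Sym2.mk_isDiag_iff] at h
        subst h
        simp at hl
      · exact ih hl.of_cons he

/-- The neighbours of an element of a list among consecutive pairs. -/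
lemma mem_pairSet_of_split {l l' : List V} {y u : V} (hl : (l ++ y :: l').Nodup)
    (h : s(y, u) ∈ pairSet (l ++ y :: l')) : l.getLast? = some u ∨ l'.head? = some u := by
  rw [pairSet_append_cons, mem_union] at h
  rw [List.nodup_append] at hl
  rcases h with h | h
  · left
    rcases List.eq_nil_or_concat l with rfl | ⟨l, a, rfl⟩
    · simp at h
    · rw [List.concat_eq_append, List.append_assoc, List.singleton_append, pairSet_bridge] at h
      simp only [pairSet_singleton, union_empty, mem_insert] at h
      rcases h with h | h
      · rw [Sym2.eq_swap, Sym2.eq_iff] at h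
        rcases h with ⟨rfl, -⟩ | ⟨rfl, rfl⟩
        · simp
        · simp
      · exfalso
        have := mem_of_mem_pairSet h (Sym2.mem_mk_left y u)
        exact hl.2.2 y (by simpa using this) y (by simp) rfl
  · right
    cases l' with
    | nil => simp at h
    | cons b l' =>
      rw [pairSet_cons_cons, mem_insert] at h
      rcases h with h | h
      · rw [Sym2.eq_iff] at h
        rcases h with ⟨-, rfl⟩ | ⟨rfl, rfl⟩ <;> simp
      · exfalso
        have := mem_of_mem_pairSet h (Sym2.mem_mk_left y u)
        exact (List.nodup_cons.1 hl.2.1).1 this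

lemma ne_of_mem_pairSet_bridge {l l' : List V} {a b : V} (hl : (l ++ a :: b :: l').Nodup) :
    s(a, b) ∉ pairSet (l ++ [a]) ∪ pairSet (b :: l') := by
  rw [List.nodup_append] at hl
  rw [mem_union, not_or]
  refine ⟨fun h => ?_, fun h => ?_⟩
  · have := mem_of_mem_pairSet h (Sym2.mem_mk_right a b)
    rw [List.mem_append, List.mem_singleton] at this
    rcases this with h1 | rfl
    · exact hl.2.2 b h1 b (by simp) rfl
    · simp at hl
  · have := mem_of_mem_pairSet h (Sym2.mem_mk_left a b)
    exact (List.nodup_cons.1 hl.2.1).1 this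

/-- A list containing every vertex exactly once. -/
def Complete (l : List V) : Prop := l.Nodup ∧ ∀ v, v ∈ l

lemma Complete.perm {l l' : List V} (h : Complete l) (hp : l.Perm l') : Complete l' :=
  ⟨hp.nodup_iff.1 h.1, fun v => hp.mem_iff.1 (h.2 v)⟩

/-- Reverse the part of a list after `y`. -/
lemma rotation_perm (l l' : List V) (y z : V) :
    (l ++ y :: z :: l').Perm (l ++ y :: (z :: l').reverse) :=
  List.Perm.append_left _ ((List.reverse_perm _).symm.cons y)

lemma exists_eq_concat_of_getLast? {l : List V} {x : V} (h : l.getLast? = some x) :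
    ∃ l', l = l' ++ [x] := by
  rcases List.eq_nil_or_concat l with rfl | ⟨l', a, rfl⟩
  · simp at h
  · rw [List.concat_eq_append] at h ⊢
    simp only [List.getLast?_append, List.getLast?_singleton, Option.some_or,
      Option.some.injEq] at h
    exact ⟨l', by rw [h]⟩

lemma pairSet_rotation (l l' : List V) (y z x : V) (hx : (z :: l').getLast? = some x) :
    pairSet (l ++ y :: (z :: l').reverse) =
      insert s(y, x) (pairSet (l ++ [y]) ∪ pairSet (z :: l')) := by
  obtain ⟨k, hk⟩ := exists_eq_concat_of_getLast? hx
  rw [← pairSet_reverse (z :: l'), hk, List.reverse_append, List.reverse_singleton,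
    List.singleton_append, pairSet_bridge]

lemma pairSet_cyclic (l l' : List V) (a b u w : V) (ha : (l ++ [u]).head? = some a)
    (hb : (w :: l').getLast? = some b) :
    pairSet ((w :: l') ++ (l ++ [u])) =
      insert s(b, a) (pairSet (l ++ [u]) ∪ pairSet (w :: l')) := by
  obtain ⟨k, hk⟩ := exists_eq_concat_of_getLast? hb
  obtain ⟨k', hk'⟩ : ∃ k', l ++ [u] = a :: k' := by
    cases h : l ++ [u] with
    | nil => simp at h
    | cons c k' => rw [h] at ha; simp at ha; exact ⟨k', by rw [ha]⟩
  rw [hk, hk', List.append_assoc, List.singleton_append, pairSet_bridge, union_comm]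

/-- The degree of `v` in a set of edges. -/
def deg (F : Finset (Sym2 V)) (v : V) : ℕ := #(F.filter (v ∈ ·))

lemma deg_mono {F F' : Finset (Sym2 V)} (h : F ⊆ F') (v : V) : deg F v ≤ deg F' v :=
  card_le_card (filter_subset_filter _ h)

/-- A vertex of degree at most one in a subset of the consecutive pairs of a complete list can be
moved to the end of the list. -/
lemma exists_complete_getLast {F : Finset (Sym2 V)} {l : List V} (hl : Complete l)
    (hF : F ⊆ pairSet l) {v : V} (hv : deg F v ≤ 1) :
    ∃ l', Complete l' ∧ F ⊆ pairSet l' ∧ l'.getLast? = some v := by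
  have main : ∀ l : List V, Complete l → F ⊆ pairSet l → ∀ l₁ l₂, l = l₁ ++ v :: l₂ →
      (∀ y, l₂.head? = some y → s(v, y) ∉ F) →
      ∃ l', Complete l' ∧ F ⊆ pairSet l' ∧ l'.getLast? = some v := by
    rintro l hl hF l₁ l₂ rfl hy
    cases l₂ with
    | nil => exact ⟨_, hl, hF, by simp⟩
    | cons y l₂ =>
      refine ⟨(y :: l₂) ++ (l₁ ++ [v]), hl.perm ?_, ?_, ?_⟩
      · have : l₁ ++ v :: y :: l₂ = (l₁ ++ [v]) ++ (y :: l₂) := by simp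
        rw [this]
        exact List.perm_append_comm
      · intro e he
        have h1 := hF he
        rw [pairSet_bridge, mem_insert, mem_union] at h1
        rcases h1 with rfl | h1 | h1
        · exact absurd he (hy y (by simp))
        · exact pairSet_subset_append_right _ _ h1
        · exact pairSet_subset_append_left _ _ h1
      · rw [← List.append_assoc, List.getLast?_append]
        rfl
  obtain ⟨l₁, l₂, rfl⟩ := List.append_of_mem (hl.2 v)
  by_cases h : ∀ y, l₂.head? = some y → s(v, y) ∉ F
  · exact main _ hl hF l₁ l₂ rfl h
  · push Not at h
    obtain ⟨y, hy, hyF⟩ := h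
    have hrev : (l₁ ++ v :: l₂).reverse = l₂.reverse ++ v :: l₁.reverse := by simp
    refine main _ (hl.perm (List.reverse_perm _).symm) (by rwa [pairSet_reverse]) _ _ hrev ?_
    intro w hw hwF
    rw [List.head?_reverse] at hw
    have hne : s(v, y) ≠ s(v, w) := by
      intro h
      rw [Sym2.congr_right] at h
      subst h
      obtain ⟨k, rfl⟩ := exists_eq_concat_of_getLast? hw
      have hnd := hl.1
      rw [List.nodup_append] at hnd
      refine hnd.2.2 y (by simp) y ?_ rfl
      exact List.mem_cons_of_mem _ (List.mem_of_mem_head? hy)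
    have : 1 < deg F v := one_lt_card.2 ⟨s(v, y), by simp [hyF], s(v, w), by simp [hwF], hne⟩
    omega

/-- Attaching a vertex `v` of degree at most one to a vertex `w` of degree two, at the cost of
one of the edges at `w`. -/
lemma exists_exchange {F : Finset (Sym2 V)} {l : List V} (hl : Complete l)
    (hF : F ⊆ pairSet l) {v w : V} (hv : deg F v ≤ 1) (hw : deg F w = 2) (hvw : s(v, w) ∉ F)
    (hne : v ≠ w) :
    ∃ z l', s(w, z) ∈ F ∧ z ≠ v ∧ Complete l' ∧ insert s(v, w) (F.erase s(w, z)) ⊆ pairSet l' := by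
  obtain ⟨l', hl', hF', hlast⟩ := exists_complete_getLast hl hF hv
  obtain ⟨l₁, l₂, rfl⟩ := List.append_of_mem (hl'.2 w)
  have hl₂ : l₂ ≠ [] := by
    rintro rfl
    simp at hlast
    exact hne hlast.symm
  obtain ⟨z, l₃, rfl⟩ := List.exists_cons_of_ne_nil hl₂
  have hlast' : (z :: l₃).getLast? = some v := by
    rw [List.getLast?_append_of_ne_nil _ (by simp), List.getLast?_cons_cons] at hlast
    exact hlast
  have hz : s(w, z) ∈ F := by
    by_contra hc
    obtain ⟨e, e', hee, hes⟩ := card_eq_two.1 hw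
    have key : ∀ e ∈ F.filter (w ∈ ·), ∃ p, l₁.getLast? = some p ∧ e = s(w, p) := by
      intro e he
      obtain ⟨heF, hwe⟩ := mem_filter.1 he
      obtain ⟨u, rfl⟩ := hwe
      rcases mem_pairSet_of_split hl'.1 (hF' heF) with h | h
      · exact ⟨u, h, rfl⟩
      · simp at h
        subst h
        exact absurd heF hc
    obtain ⟨p, hp, rfl⟩ := key e (by rw [hes]; simp)
    obtain ⟨p', hp', rfl⟩ := key e' (by rw [hes]; simp)
    rw [hp] at hp'
    simp at hp'
    exact hee (by rw [hp'])
  refine ⟨z, _, hz, ?_, hl'.perm (rotation_perm _ _ _ _), ?_⟩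
  · rintro rfl
    exact hvw (by rwa [Sym2.eq_swap])
  · rw [pairSet_rotation _ _ _ _ v hlast']
    rw [pairSet_bridge] at hF'
    rw [Sym2.eq_swap (a := v)]
    apply insert_subset_insert
    intro e he
    have h1 := hF' (mem_of_mem_erase he)
    rw [mem_insert] at h1
    exact h1.resolve_left (ne_of_mem_erase he)

end Pairs

section Rotation

variable {V : Type*} [DecidableEq V]

lemma sum_card_le_two_mul {s : Finset V} {N : V → Finset V} {E : Finset (Sym2 V)}
    (h : ∀ x ∈ s, ∀ y ∈ N x, s(x, y) ∈ E) : ∑ x ∈ s, #(N x) ≤ 2 * #E := by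
  rw [← card_sigma]
  refine (card_le_mul_card_image (f := fun p : (_ : V) × V => s(p.1, p.2)) _ 2 ?_).trans
    (Nat.mul_le_mul_left 2 (card_le_card ?_))
  · intro e _
    induction e with
    | _ a b =>
      refine (card_le_card (t := {⟨a, b⟩, ⟨b, a⟩}) ?_).trans card_le_two
      rintro ⟨x, y⟩ hp
      have := (mem_filter.1 hp).2
      rw [Sym2.eq_iff] at this
      rcases this with ⟨rfl, rfl⟩ | ⟨rfl, rfl⟩ <;> simp
  · intro e he
    obtain ⟨⟨x, y⟩, hp, rfl⟩ := mem_image.1 he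
    rw [mem_sigma] at hp
    exact h x hp.1 y hp.2

/-- The number of consecutive pairs of a list which are not edges of `A`. -/
def virt (A : Finset (Sym2 V)) (l : List V) : ℕ := #(pairSet l \ A)

/-- The least number of missing edges among complete lists which use all edges of `F`. -/
noncomputable def minVirt (F A : Finset (Sym2 V)) : ℕ :=
  sInf {k | ∃ l, Complete l ∧ F ⊆ pairSet l ∧ virt A l = k}

lemma minVirt_le {F A : Finset (Sym2 V)} {l : List V} (hl : Complete l) (hF : F ⊆ pairSet l) :
    minVirt F A ≤ virt A l := Nat.sInf_le ⟨l, hl, hF, rfl⟩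

lemma exists_virt_eq_minVirt {F A : Finset (Sym2 V)} {l : List V} (hl : Complete l)
    (hF : F ⊆ pairSet l) : ∃ l', Complete l' ∧ F ⊆ pairSet l' ∧ virt A l' = minVirt F A :=
  Nat.sInf_mem (s := {k | ∃ l, Complete l ∧ F ⊆ pairSet l ∧ virt A l = k}) ⟨_, l, hl, hF, rfl⟩

/-- There is a cyclic ordering of all vertices whose consecutive pairs are edges of `A`. -/
def HamList (A : Finset (Sym2 V)) : Prop :=
  ∃ l a b, Complete l ∧ pairSet l ⊆ A ∧ l.head? = some a ∧ l.getLast? = some b ∧ s(b, a) ∈ A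

/-- The lists obtained from `l₀` by rotations along edges of `A` with pivot in `R`. -/
inductive Rotates (A : Finset (Sym2 V)) (R : Finset V) (l₀ : List V) : List V → Prop
  | refl : Rotates A R l₀ l₀
  | step {l₁ l₂ y z x} : Rotates A R l₀ (l₁ ++ y :: z :: l₂) → (z :: l₂).getLast? = some x →
      y ∈ R → s(y, x) ∈ A → Rotates A R l₀ (l₁ ++ y :: (z :: l₂).reverse)

variable {A F : Finset (Sym2 V)} {R : Finset V} {l₀ l : List V}

lemma Rotates.complete (h : Rotates A R l₀ l) (hl : Complete l₀) : Complete l := by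
  induction h with
  | refl => exact hl
  | step h hx hy ha ih => exact ih.perm (rotation_perm _ _ _ _)

lemma Rotates.subset_pairSet (h : Rotates A R l₀ l) (hR : ∀ e ∈ F, ∀ v ∈ e, v ∉ R)
    (hF : F ⊆ pairSet l₀) : F ⊆ pairSet l := by
  induction h with
  | refl => exact hF
  | step h hx hy ha ih =>
    rw [pairSet_rotation _ _ _ _ _ hx]
    rw [pairSet_bridge] at ih
    intro e he
    refine mem_insert_of_mem ((mem_insert.1 (ih he)).resolve_left ?_)
    rintro rfl
    exact hR _ he _ (Sym2.mem_mk_left _ _) hy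

lemma Rotates.virt_le (h : Rotates A R l₀ l) : virt A l ≤ virt A l₀ := by
  induction h with
  | refl => exact le_rfl
  | step h hx hy ha ih =>
    refine le_trans (card_le_card ?_) ih
    rw [pairSet_rotation _ _ _ _ _ hx, pairSet_bridge, insert_sdiff_of_mem _ ha]
    exact sdiff_subset_sdiff (subset_insert _ _) (Subset.refl _)

lemma Rotates.head? (h : Rotates A R l₀ l) : l.head? = l₀.head? := by
  induction h with
  | refl => rfl
  | @step l₁ l₂ y z x h hx hy ha ih =>
    rw [← ih]
    cases l₁ <;> simp

lemma getLast?_rotation (l₁ l₂ : List V) (y z : V) :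
    (l₁ ++ y :: (z :: l₂).reverse).getLast? = some z := by
  have : l₁ ++ y :: (z :: l₂).reverse = (l₁ ++ y :: l₂.reverse) ++ [z] := by simp
  rw [this, List.getLast?_append]
  rfl

lemma Rotates.mem_or (h : Rotates A R l₀ l) {e : Sym2 V} (he : e ∈ pairSet l₀) :
    e ∈ pairSet l ∨ ∃ v ∈ e, ∃ l', Rotates A R l₀ l' ∧ l'.getLast? = some v := by
  induction h with
  | refl => exact Or.inl he
  | @step l₁ l₂ y z x h hx hy ha ih =>
    rcases ih with ih | ih
    · rw [pairSet_bridge, mem_insert] at ih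
      rcases ih with rfl | ih
      · exact Or.inr ⟨z, by simp, _, h.step hx hy ha, getLast?_rotation _ _ _ _⟩
      · left
        rw [pairSet_rotation _ _ _ _ _ hx]
        exact mem_insert_of_mem ih
    · exact Or.inr ih

/-- A pivot of a rotation is an end of a rotated list, or next to such an end in the original
list. -/
lemma Rotates.pivot (h : Rotates A R l₀ l) (hl₀ : Complete l₀) {x y : V}
    (hx : l.getLast? = some x) (hy : y ∈ R) (hxy : s(y, x) ∈ A) (hne : y ≠ x) :
    ∃ u, (u = y ∨ s(y, u) ∈ pairSet l₀) ∧ ∃ l', Rotates A R l₀ l' ∧ l'.getLast? = some u := by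
  have hl := h.complete hl₀
  obtain ⟨l₁, l₂, rfl⟩ := List.append_of_mem (hl.2 y)
  have hl₂ : l₂ ≠ [] := by
    rintro rfl
    simp at hx
    exact hne hx
  obtain ⟨z, l₃, rfl⟩ := List.exists_cons_of_ne_nil hl₂
  have hx' : (z :: l₃).getLast? = some x := by
    rw [List.getLast?_append_of_ne_nil _ (by simp), List.getLast?_cons_cons] at hx
    exact hx
  have hz : ∃ l', Rotates A R l₀ l' ∧ l'.getLast? = some z :=
    ⟨_, h.step hx' hy hxy, getLast?_rotation _ _ _ _⟩
  by_contra hcon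
  push Not at hcon
  have hnoy : ¬ ∃ l', Rotates A R l₀ l' ∧ l'.getLast? = some y := fun ⟨l', h1, h2⟩ =>
    hcon y (Or.inl rfl) l' h1 h2
  have hkeep : ∀ u, s(y, u) ∈ pairSet l₀ → l₁.getLast? = some u := by
    intro u hu
    rcases h.mem_or hu with h1 | ⟨v, hv, l', h1, h2⟩
    · rcases mem_pairSet_of_split hl.1 h1 with h2 | h2
      · exact h2
      · simp at h2
        subst h2
        obtain ⟨l', h3, h4⟩ := hz
        exact absurd h4 (hcon z (Or.inr hu) l' h3)
    · rw [Sym2.mem_iff] at hv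
      rcases hv with rfl | rfl
      · exact absurd ⟨l', h1, h2⟩ hnoy
      · exact absurd h2 (hcon v (Or.inr hu) l' h1)
  obtain ⟨m₁, m₂, hm⟩ := List.append_of_mem (hl₀.2 y)
  have hm₂ : m₂ ≠ [] := by
    rintro rfl
    exact hnoy ⟨l₀, .refl, by simp [hm]⟩
  obtain ⟨z₀, m₃, rfl⟩ := List.exists_cons_of_ne_nil hm₂
  have h1 : l₁.getLast? = some z₀ := hkeep z₀ (by rw [hm, pairSet_bridge]; simp)
  rcases List.eq_nil_or_concat m₁ with rfl | ⟨m₁, p₀, rfl⟩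
  · have := h.head?
    rw [hm] at this
    cases l₁ with
    | nil => simp at h1
    | cons a l₁ =>
      simp at this
      subst this
      have := hl.1
      simp at this
  · rw [List.concat_eq_append, List.append_assoc, List.singleton_append] at hm
    have h2 : l₁.getLast? = some p₀ :=
      hkeep p₀ (by rw [hm, pairSet_bridge, Sym2.eq_swap]; simp)
    rw [h1] at h2
    simp only [Option.some.injEq] at h2
    subst h2
    have := hl₀.1
    rw [hm] at this
    simp [List.nodup_append] at this

lemma card_neighbors_le_two [Fintype V] (hl : Complete l) (u : V) :
    #(univ.filter fun y => s(y, u) ∈ pairSet l) ≤ 2 := by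
  obtain ⟨l₁, l₂, rfl⟩ := List.append_of_mem (hl.2 u)
  have h1 : ∀ o : Option V, #o.toFinset ≤ 1 := by
    intro o; cases o <;> simp
  calc _ ≤ #(l₁.getLast?.toFinset ∪ l₂.head?.toFinset) := by
        refine card_le_card fun y hy => ?_
        have hy := (mem_filter.1 hy).2
        rw [Sym2.eq_swap] at hy
        rcases mem_pairSet_of_split hl.1 hy with h | h <;> simp [h]
    _ ≤ 1 + 1 := (card_union_le _ _).trans (Nat.add_le_add (h1 _) (h1 _))

lemma deg_pairSet_le_two [Fintype V] (hl : Complete l) (u : V) : deg (pairSet l) u ≤ 2 := by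
  refine le_trans ?_ (card_neighbors_le_two hl u)
  refine (card_le_card (t := (univ.filter fun y => s(y, u) ∈ pairSet l).image fun y => s(y, u))
    fun e he => ?_).trans card_image_le
  obtain ⟨he, y, rfl⟩ := mem_filter.1 he
  exact mem_image.2 ⟨y, by simpa [Sym2.eq_swap] using he, Sym2.eq_swap⟩

lemma deg_le_one_of_getLast? (hl : Complete l) {u : V} (hu : l.getLast? = some u)
    (hF : F ⊆ pairSet l) : deg F u ≤ 1 := by
  refine (deg_mono hF u).trans ?_
  obtain ⟨k, rfl⟩ := exists_eq_concat_of_getLast? hu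
  refine card_le_one.2 fun e he e' he' => ?_
  have key : ∀ e ∈ (pairSet (k ++ [u])).filter (u ∈ ·), ∃ p, k.getLast? = some p ∧ e = s(u, p) := by
    intro e he
    obtain ⟨he, y, rfl⟩ := mem_filter.1 he
    rcases mem_pairSet_of_split hl.1 he with h | h
    · exact ⟨y, h, rfl⟩
    · simp at h
  obtain ⟨p, hp, rfl⟩ := key e he
  obtain ⟨p', hp', rfl⟩ := key e' he'
  rw [hp] at hp'
  simp at hp'
  rw [hp']

/-- Pósa's lemma: in a locally sparse graph the rotations of a list have many ends, provided each
end has many neighbours in the set `R` of pivots. -/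
lemma lt_three_mul_card_ends [Fintype V] {d κ m : ℕ} (hd : 6 * κ < d)
    (hsparse : ∀ Y : Finset V, #Y ≤ m → #(A.filter fun e => ∀ v ∈ e, v ∈ Y) ≤ κ * #Y)
    (hR : ∀ e ∈ F, ∀ v ∈ e, v ∉ R)
    (hgood : ∀ x, deg F x ≤ 1 → d ≤ #(R.filter fun y => s(y, x) ∈ A ∧ y ≠ x))
    (hl₀ : Complete l₀) (hF : F ⊆ pairSet l₀) (hne : l₀ ≠ [])
    (X : Finset V) (hX : ∀ x, x ∈ X ↔ ∃ l', Rotates A R l₀ l' ∧ l'.getLast? = some x) :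
    m < 3 * #X := by
  set T := X ∪ X.biUnion fun u => univ.filter fun y => s(y, u) ∈ pairSet l₀ with hT
  have hTcard : #T ≤ 3 * #X := by
    refine (card_union_le _ _).trans ?_
    have : #(X.biUnion fun u => univ.filter fun y => s(y, u) ∈ pairSet l₀) ≤ #X * 2 :=
      card_biUnion_le_card_mul _ _ _ fun u _ => card_neighbors_le_two hl₀ u
    omega
  by_contra hlt
  have hsp := hsparse T (by omega)
  have hsum : ∑ x ∈ X, #(R.filter fun y => s(y, x) ∈ A ∧ y ≠ x) ≤
      2 * #(A.filter fun e => ∀ v ∈ e, v ∈ T) := by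
    refine sum_card_le_two_mul fun x hx y hy => ?_
    obtain ⟨hyR, hyA, hyx⟩ := mem_filter.1 hy
    obtain ⟨l', h', hlast⟩ := (hX x).1 hx
    obtain ⟨u, hu, hl'⟩ := h'.pivot hl₀ hlast hyR hyA hyx
    have hyT : y ∈ T := by
      rcases hu with rfl | hu
      · exact mem_union_left _ ((hX _).2 hl')
      · exact mem_union_right _ (mem_biUnion.2 ⟨u, (hX _).2 hl', by simpa using hu⟩)
    rw [mem_filter, Sym2.eq_swap]
    refine ⟨hyA, fun v hv => ?_⟩
    rw [Sym2.mem_iff] at hv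
    rcases hv with rfl | rfl
    · exact hyT
    · exact mem_union_left _ hx
  have hlow : #X * d ≤ ∑ x ∈ X, #(R.filter fun y => s(y, x) ∈ A ∧ y ≠ x) := by
    rw [← smul_eq_mul]
    refine card_nsmul_le_sum _ _ _ fun x hx => hgood x ?_
    obtain ⟨l', h', hlast⟩ := (hX x).1 hx
    exact deg_le_one_of_getLast? (h'.complete hl₀) hlast (h'.subset_pairSet hR hF)
  have hpos : 0 < #X := by
    exact card_pos.2 ⟨_, (hX _).2 ⟨l₀, .refl, List.getLast?_eq_some_getLast hne⟩⟩
  have h1 : κ * #T ≤ κ * (3 * #X) := Nat.mul_le_mul_left _ hTcard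
  nlinarith

/-- Adding the edge joining the two ends of an optimal list makes progress. -/
lemma hamList_or_minVirt_lt {A' : Finset (Sym2 V)} (hFA : F ⊆ A) (hAA : A ⊆ A') (hl : Complete l)
    (hF : F ⊆ pairSet l) (hopt : virt A l = minVirt F A) {a b : V} (ha : l.head? = some a)
    (hb : l.getLast? = some b) (hab : s(b, a) ∈ A') :
    HamList A' ∨ minVirt F A' < minVirt F A := by
  by_cases hsub : pairSet l ⊆ A
  · exact Or.inl ⟨l, a, b, hl, hsub.trans hAA, ha, hb, hab⟩
  right
  rw [← hopt]
  obtain ⟨e, he, heA⟩ := not_subset.1 hsub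
  have hsplit : ∀ l : List V, e ∈ pairSet l →
      ∃ l₁ u w l₂, l = l₁ ++ u :: w :: l₂ ∧ e = s(u, w) := by
    intro l
    induction l with
    | nil => simp
    | cons c l ih =>
      cases l with
      | nil => simp
      | cons c' l =>
        intro h
        rw [pairSet_cons_cons, mem_insert] at h
        rcases h with rfl | h
        · exact ⟨[], c, c', l, rfl, rfl⟩
        · obtain ⟨l₁, u, w, l₂, h1, h2⟩ := ih h
          exact ⟨c :: l₁, u, w, l₂, by simp [h1], h2⟩
  obtain ⟨l₁, u, w, l₂, rfl, rfl⟩ := hsplit l he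
  have ha' : (l₁ ++ [u]).head? = some a := by
    cases l₁ <;> simpa using ha
  have hb' : (w :: l₂).getLast? = some b := by
    rw [List.getLast?_append_of_ne_nil _ (by simp), List.getLast?_cons_cons] at hb
    exact hb
  have hc := pairSet_cyclic l₁ l₂ a b u w ha' hb'
  have hnot := ne_of_mem_pairSet_bridge hl.1
  have hcomp : Complete ((w :: l₂) ++ (l₁ ++ [u])) := hl.perm <| by
    have : l₁ ++ u :: w :: l₂ = (l₁ ++ [u]) ++ (w :: l₂) := by simp
    rw [this]
    exact List.perm_append_comm
  rw [pairSet_bridge] at hF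
  refine (minVirt_le hcomp ?_).trans_lt (card_lt_card ?_)
  · rw [hc]
    intro f hf
    refine mem_insert_of_mem ((mem_insert.1 (hF hf)).resolve_left ?_)
    rintro rfl
    exact heA (hFA hf)
  · rw [hc, insert_sdiff_of_mem _ hab, pairSet_bridge, insert_sdiff_of_notMem _ heA]
    exact Finset.ssubset_of_subset_of_ssubset (sdiff_subset_sdiff (Subset.refl _) hAA)
      (ssubset_insert fun h => hnot (sdiff_subset h))

/-- The number of edges whose addition makes progress towards a Hamilton cycle. -/
lemma sq_le_card_boosters [Fintype V] {d κ m : ℕ} (hd : 6 * κ < d)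
    (hsparse : ∀ Y : Finset V, #Y ≤ m → #(A.filter fun e => ∀ v ∈ e, v ∈ Y) ≤ κ * #Y)
    (hR : ∀ e ∈ F, ∀ v ∈ e, v ∉ R) (hFA : F ⊆ A)
    (hgood : ∀ x, deg F x ≤ 1 → d ≤ #(R.filter fun y => s(y, x) ∈ A ∧ y ≠ x))
    (hl₀ : Complete l₀) (hF : F ⊆ pairSet l₀) (hV : 2 ≤ Fintype.card V) (hham : ¬ HamList A)
    (J : Finset (Sym2 V)) (hJ : ∀ e, ¬ e.IsDiag → e ∉ A →
      (HamList (insert e A) ∨ minVirt F (insert e A) < minVirt F A) → e ∈ J) :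
    m ^ 2 ≤ 18 * #J := by
  classical
  have hlen : ∀ l : List V, Complete l → 2 ≤ l.length := by
    intro l hl
    rw [← List.toFinset_card_of_nodup hl.1]
    refine hV.trans (card_le_card fun v _ => by simpa using hl.2 v)
  set opt : V → V → Prop := fun a b => ∃ l, Complete l ∧ F ⊆ pairSet l ∧
    virt A l = minVirt F A ∧ l.head? = some a ∧ l.getLast? = some b with hopt
  have hends : ∀ l, Complete l → F ⊆ pairSet l → virt A l = minVirt F A → ∀ a,
      l.head? = some a → m ≤ 3 * #(univ.filter (opt a)) := by
    intro l hl hF' hvl a ha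
    have hne : l ≠ [] := by rintro rfl; simp at ha
    set X : Finset V := univ.filter fun x => ∃ l', Rotates A R l l' ∧ l'.getLast? = some x with hX
    have h1 := lt_three_mul_card_ends hd hsparse hR hgood hl hF' hne X (by simp [hX])
    refine h1.le.trans (Nat.mul_le_mul_left 3 (card_le_card fun x hx => ?_))
    obtain ⟨l', h', hx⟩ := (mem_filter.1 hx).2
    refine mem_filter.2 ⟨mem_univ _, l', h'.complete hl, h'.subset_pairSet hR hF',
      le_antisymm (h'.virt_le.trans hvl.le)
        (minVirt_le (h'.complete hl) (h'.subset_pairSet hR hF')), ?_, hx⟩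
    rw [h'.head?, ha]
  obtain ⟨l, hl, hF', hvl⟩ := exists_virt_eq_minVirt (A := A) hl₀ hF
  obtain ⟨a, ha⟩ : ∃ a, l.head? = some a := by
    have := hlen l hl
    cases l with
    | nil => simp at this
    | cons a l => exact ⟨a, rfl⟩
  have h1 := hends l hl hF' hvl a ha
  have hsum : ∑ b ∈ univ.filter (opt a), #(univ.filter (opt b)) ≤ 2 * #J := by
    refine sum_card_le_two_mul fun b _ c hc => ?_
    obtain ⟨l', hl', hF'', hv', hb, hc⟩ := (mem_filter.1 hc).2
    have hbc : b ≠ c := by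
      rintro rfl
      have h2 := hlen l' hl'
      obtain ⟨k, rfl⟩ := exists_eq_concat_of_getLast? hc
      cases k with
      | nil => simp at h2
      | cons x k =>
        simp at hb
        subst hb
        have := hl'.1
        simp at this
    have hnotA : s(c, b) ∉ A := by
      intro h
      rcases hamList_or_minVirt_lt hFA (Subset.refl A) hl' hF'' hv' hb hc h with h | h
      · exact hham h
      · exact lt_irrefl _ h
    rw [Sym2.eq_swap]
    exact hJ _ (by simpa using hbc.symm) hnotA
      (hamList_or_minVirt_lt hFA (subset_insert _ _) hl' hF'' hv' hb hc (mem_insert_self _ _))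
  have hlow : m * #(univ.filter (opt a)) ≤
      3 * ∑ b ∈ univ.filter (opt a), #(univ.filter (opt b)) := by
    rw [mul_sum, mul_comm, ← smul_eq_mul]
    refine card_nsmul_le_sum _ _ _ fun b hb => ?_
    obtain ⟨l', hl', hF'', hv', ha', hb'⟩ := (mem_filter.1 hb).2
    refine hends l'.reverse (hl'.perm (List.reverse_perm _).symm) (by rwa [pairSet_reverse])
      (by rw [virt, pairSet_reverse]; exact hv') b (by rw [List.head?_reverse, hb'])
  nlinarith

end Rotation

section Hamiltonian

variable {V : Type*} [DecidableEq V] [Fintype V]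

lemma isChain_fromEdgeSet {A : Finset (Sym2 V)} {l : List V} (hl : l.Nodup)
    (hA : pairSet l ⊆ A) :
    List.IsChain (SimpleGraph.fromEdgeSet (A : Set (Sym2 V))).Adj l := by
  induction l with
  | nil => simp
  | cons a l ih =>
    cases l with
    | nil => simp
    | cons b l =>
      rw [pairSet_cons_cons, insert_subset_iff] at hA
      refine List.isChain_cons_cons.2 ⟨?_, ih hl.of_cons hA.2⟩
      rw [SimpleGraph.fromEdgeSet_adj]
      refine ⟨hA.1, fun h => ?_⟩
      subst h
      simp at hl

lemma HamList.isHamiltonian {A : Finset (Sym2 V)} (h : HamList A) (hV : 3 ≤ Fintype.card V) :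
    (SimpleGraph.fromEdgeSet (A : Set (Sym2 V))).IsHamiltonian := by
  obtain ⟨l, a, b, hl, hA, ha, hb, hab⟩ := h
  intro _
  have hlen : l.length = Fintype.card V := by
    rw [← List.toFinset_card_of_nodup hl.1, ← Finset.card_univ]
    congr 1
    ext v
    simp [hl.2 v]
  have hne : l ≠ [] := by rintro rfl; simp at ha
  obtain rfl : l.head hne = a := by
    have := List.head?_eq_some_head hne
    rw [ha] at this; exact (Option.some.inj this).symm
  obtain rfl : l.getLast hne = b := by
    have := List.getLast?_eq_some_getLast hne
    rw [hb] at this; exact (Option.some.inj this).symm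
  set G := SimpleGraph.fromEdgeSet (A : Set (Sym2 V)) with hG
  have hc : List.IsChain G.Adj l := isChain_fromEdgeSet hl.1 hA
  set p := SimpleGraph.Walk.ofSupport l hne hc with hp
  have hplen : p.length = l.length - 1 := SimpleGraph.Walk.length_ofSupport hne hc
  have hpath : p.IsPath := by
    rw [SimpleGraph.Walk.isPath_def, SimpleGraph.Walk.support_ofSupport]
    exact hl.1
  have hne2 : l.getLast hne ≠ l.head hne := by
    intro h
    rw [List.getLast_eq_getElem, List.head_eq_getElem, hl.1.getElem_inj_iff] at h
    omega
  have hadj : G.Adj (l.getLast hne) (l.head hne) := by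
    rw [hG, SimpleGraph.fromEdgeSet_adj]
    exact ⟨hab, hne2⟩
  refine ⟨_, SimpleGraph.Walk.cons hadj p, ?_⟩
  rw [SimpleGraph.Walk.isHamiltonianCycle_iff_isCycle_and_length_eq,
    SimpleGraph.Walk.cons_isCycle_iff]
  refine ⟨⟨hpath, fun h => ?_⟩, ?_⟩
  · rw [Sym2.eq_swap] at h
    have := hpath.length_eq_one_of_mem_edges h
    omega
  · rw [SimpleGraph.Walk.length_cons]
    omega

end Hamiltonian

section Algorithm

/-- The online algorithm which follows the policy `U`. -/
def policyAlg (n K : ℕ) (U : List (Option (Sym2 (Fin n))) → Finset (Sym2 (Fin n))) : Alg n :=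
  fun p => (logOf K U p).getLast?.join

lemma selected_policyAlg {n K : ℕ} (hK : 0 < K)
    (U : List (Option (Sym2 (Fin n))) → Finset (Sym2 (Fin n))) (σ : Omega n) {t : ℕ}
    (ht : K * t ≤ #(edges n)) :
    selected n K (policyAlg n K U) σ t =
      accepted (logOf K U ((revealList σ).take (K * t))) := by
  induction t with
  | zero => simp [selected, logOf, runLog]
  | succ t ih =>
    have hlen : (revealList σ).length = #(edges n) := by rw [length_revealList, card_edges]
    rw [selected, ih ((Nat.mul_le_mul_left K t.le_succ).trans ht)]
    have h1 : K * (t + 1) = K * t + K := Nat.mul_succ _ _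
    set h := (revealList σ).take (K * t) with hh
    set b := ((revealList σ).drop (K * t)).take K with hb
    have hhb : (revealList σ).take (K * (t + 1)) = h ++ b := by
      rw [h1, List.take_add]
    have hhl : h.length = K * t := by rw [hh, List.length_take]; omega
    have hbl : b.length = K := by rw [hb, List.length_take, List.length_drop]; omega
    have hbb : block n K σ (t + 1) = b := by
      rw [block, hhb, Nat.add_sub_cancel, ← hhl, List.drop_left]
    have hpr : presented n K σ (t + 1) = h ++ b := hhb
    rw [hhb, hbb, hpr, policyAlg, logOf_append hK hhl hbl, accepted_append]
    congr 1
    rcases hf : b.find? fun e => decide (e ∈ U (logOf K U h)) with _ | e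
    · simp
    · have := List.mem_of_find?_eq_some hf
      simp [this]

end Algorithm

section LinForest

variable {V : Type*} [DecidableEq V]

/-- The edges of a family of disjoint paths given by their vertex lists. -/
def forestEdges : List (List V) → Finset (Sym2 V)
  | [] => ∅
  | s :: segs => pairSet s ∪ forestEdges segs

lemma mem_forestEdges {segs : List (List V)} {e : Sym2 V} :
    e ∈ forestEdges segs ↔ ∃ s ∈ segs, e ∈ pairSet s := by
  induction segs with
  | nil => simp [forestEdges]
  | cons s segs ih => simp [forestEdges, ih]

lemma forestEdges_perm {segs segs' : List (List V)} (h : segs.Perm segs') :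
    forestEdges segs = forestEdges segs' := by
  ext e
  simp only [mem_forestEdges, h.mem_iff]

lemma mem_flatten_of_mem_forestEdges {segs : List (List V)} {e : Sym2 V}
    (he : e ∈ forestEdges segs) {v : V} (hv : v ∈ e) : v ∈ segs.flatten := by
  obtain ⟨s, hs, he⟩ := mem_forestEdges.1 he
  exact List.mem_flatten.2 ⟨s, hs, mem_of_mem_pairSet he hv⟩

lemma forestEdges_subset (segs : List (List V)) : forestEdges segs ⊆ pairSet segs.flatten := by
  induction segs with
  | nil => simp [forestEdges]
  | cons s segs ih =>
    exact union_subset (pairSet_subset_append_left _ _) (ih.trans (pairSet_subset_append_right _ _))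

lemma card_forestEdges {segs : List (List V)} (hne : ∀ s ∈ segs, s ≠ [])
    (hnd : segs.flatten.Nodup) :
    #(forestEdges segs) + segs.length = segs.flatten.length := by
  induction segs with
  | nil => simp [forestEdges]
  | cons s segs ih =>
    rw [List.flatten_cons, List.nodup_append'] at hnd
    have h1 := ih (fun t ht => hne t (List.mem_cons_of_mem _ ht)) hnd.2.1
    have h2 : Disjoint (pairSet s) (forestEdges segs) := by
      rw [Finset.disjoint_left]
      intro e he he'
      induction e with
      | _ x y =>
      exact hnd.2.2 (mem_of_mem_pairSet he (Sym2.mem_mk_left x y))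
        (mem_flatten_of_mem_forestEdges he' (Sym2.mem_mk_left x y))
    have h3 : 0 < s.length := List.length_pos_iff.2 (hne s (by simp))
    rw [forestEdges, card_union_of_disjoint h2, card_pairSet hnd.1, List.flatten_cons,
      List.length_append, List.length_cons]
    omega

/-- `F` is the edge set of a family of disjoint paths covering exactly `W`. -/
def LinForest (W : Finset V) (F : Finset (Sym2 V)) : Prop :=
  ∃ segs : List (List V), (∀ s ∈ segs, s ≠ []) ∧ segs.flatten.Nodup ∧
    (∀ v, v ∈ segs.flatten ↔ v ∈ W) ∧ F = forestEdges segs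

variable {W : Finset V} {F : Finset (Sym2 V)}

lemma linForest_empty (W : Finset V) : LinForest W ∅ := by
  have h : (W.toList.map fun v => [v]).flatten = W.toList := by
    generalize W.toList = l
    induction l with
    | nil => rfl
    | cons a l ih => simp_all
  refine ⟨W.toList.map fun v => [v], by simp, ?_, ?_, ?_⟩
  · rw [h]; exact W.nodup_toList
  · simp [h]
  · ext e
    simp [mem_forestEdges]

lemma LinForest.mem (h : LinForest W F) {e : Sym2 V} (he : e ∈ F) {v : V} (hv : v ∈ e) :
    v ∈ W := by
  obtain ⟨segs, -, -, hW, rfl⟩ := h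
  exact (hW v).1 (mem_flatten_of_mem_forestEdges he hv)

lemma LinForest.exists_complete [Fintype V] (h : LinForest W F) :
    ∃ l, Complete l ∧ F ⊆ pairSet l := by
  obtain ⟨segs, -, hnd, hW, rfl⟩ := h
  refine ⟨segs.flatten ++ Wᶜ.toList, ⟨?_, fun v => ?_⟩,
    (forestEdges_subset segs).trans (pairSet_subset_append_left _ _)⟩
  · refine List.Nodup.append hnd (nodup_toList _) fun v hv hv' => ?_
    rw [mem_toList, mem_compl] at hv'
    exact hv' ((hW v).1 hv)
  · rw [List.mem_append, hW, mem_toList, mem_compl]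
    exact em _

/-- Any two of the paths can be joined by an edge. -/
lemma exists_joins {segs : List (List V)} (hne : ∀ s ∈ segs, s ≠ []) (hnd : segs.flatten.Nodup) :
    ∃ J : Finset (Sym2 V), segs.length * (segs.length - 1) ≤ 2 * #J ∧ ∀ e ∈ J,
      ∃ l u w l' rest, segs.Perm ((l ++ [u]) :: (w :: l') :: rest) ∧ e = s(u, w) := by
  induction segs with
  | nil => exact ⟨∅, by simp⟩
  | cons a segs ih =>
    rw [List.flatten_cons, List.nodup_append'] at hnd
    obtain ⟨J, hJ, hJe⟩ := ih (fun t ht => hne t (List.mem_cons_of_mem _ ht)) hnd.2.1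
    rcases List.eq_nil_or_concat a with rfl | ⟨l, u, rfl⟩
    · exact absurd rfl (hne [] (by simp))
    rw [List.concat_eq_append] at *
    have hu : u ∉ segs.flatten := fun h => hnd.2.2 (by simp) h
    set f : List V → Sym2 V := fun b => s(u, b.headD u) with hf
    have hne' : ∀ b ∈ segs, ∃ w l', b = w :: l' := fun b hb =>
      List.exists_cons_of_ne_nil (hne b (List.mem_cons_of_mem _ hb))
    have hnodup : (segs.map f).Nodup := by
      rw [List.Nodup, List.pairwise_map]
      refine List.Pairwise.imp_of_mem ?_ (List.nodup_flatten.1 hnd.2.1).2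
      intro b c hb hc hbc heq
      obtain ⟨w, l₁, rfl⟩ := hne' b hb
      obtain ⟨w', l₂, rfl⟩ := hne' c hc
      simp only [hf, List.headD_cons, Sym2.congr_right] at heq
      subst heq
      exact hbc (List.mem_cons_self ..) (List.mem_cons_self ..)
    have hdisj : Disjoint (segs.map f).toFinset J := by
      rw [Finset.disjoint_left]
      intro e he heJ
      obtain ⟨b, -, rfl⟩ := List.mem_map.1 (List.mem_toFinset.1 he)
      obtain ⟨l₁, u', w, l₂, rest, hp, hee⟩ := hJe _ heJ
      have hu' : u ∈ s(u', w) := by rw [← hee]; exact Sym2.mem_mk_left _ _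
      apply hu
      rw [hp.flatten.mem_iff]
      rcases Sym2.mem_iff.1 hu' with rfl | rfl <;> simp
    refine ⟨(segs.map f).toFinset ∪ J, ?_, fun e he => ?_⟩
    · rw [card_union_of_disjoint hdisj, List.toFinset_card_of_nodup hnodup, List.length_map,
        List.length_cons, Nat.add_sub_cancel]
      rcases hs : segs.length with _ | k
      · simp
      · rw [hs] at hJ
        simp only [Nat.add_sub_cancel] at hJ
        nlinarith
    · rcases mem_union.1 he with he | he
      · obtain ⟨b, hb, rfl⟩ := List.mem_map.1 (List.mem_toFinset.1 he)
        obtain ⟨w, l', rfl⟩ := hne' b hb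
        obtain ⟨rest, hrest⟩ := (List.singleton_sublist.2 hb).exists_perm_append
        exact ⟨l, u, w, l', rest, hrest.cons _, rfl⟩
      · obtain ⟨l₁, u', w, l₂, rest, hp, hee⟩ := hJe e he
        refine ⟨l₁, u', w, l₂, (l ++ [u]) :: rest, ?_, hee⟩
        refine (hp.cons _).trans ?_
        refine (List.Perm.swap _ _ _).trans (List.Perm.cons _ ?_)
        exact List.Perm.swap _ _ _

/-- A linear forest with few edges has many extensions. -/
lemma LinForest.exists_extensions (h : LinForest W F) :
    ∃ J : Finset (Sym2 V), (#W - #F) * (#W - #F - 1) ≤ 2 * #J ∧ ∀ e ∈ J,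
      ¬ e.IsDiag ∧ e ∉ F ∧ (∀ v ∈ e, v ∈ W) ∧ LinForest W (insert e F) := by
  obtain ⟨segs, hne, hnd, hmem, rfl⟩ := h
  have hcard : ∀ {sg : List (List V)}, (∀ s ∈ sg, s ≠ []) → sg.flatten.Nodup →
      (∀ v, v ∈ sg.flatten ↔ v ∈ W) → #(forestEdges sg) + sg.length = #W := by
    intro sg h1 h2 h3
    rw [card_forestEdges h1 h2, ← List.toFinset_card_of_nodup h2]
    congr 1
    ext v
    simp only [List.mem_toFinset, h3]
  have h1 := hcard hne hnd hmem
  obtain ⟨J, hJ, hJe⟩ := exists_joins hne hnd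
  refine ⟨J, by rw [← h1, Nat.add_sub_cancel_left]; exact hJ, fun e he => ?_⟩
  obtain ⟨l, u, w, l', rest, hp, rfl⟩ := hJe e he
  have hfl : ((l ++ u :: w :: l') :: rest).flatten = ((l ++ [u]) :: (w :: l') :: rest).flatten := by
    simp
  have hins : insert s(u, w) (forestEdges segs) = forestEdges ((l ++ u :: w :: l') :: rest) := by
    rw [forestEdges_perm hp]
    simp only [forestEdges, pairSet_bridge, insert_union, union_assoc]
  have hne' : ∀ s ∈ (l ++ u :: w :: l') :: rest, s ≠ [] := by
    intro s hs
    rcases List.mem_cons.1 hs with rfl | hs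
    · simp
    · exact hne s (hp.mem_iff.2 (by simp [hs]))
  have hnd' : ((l ++ u :: w :: l') :: rest).flatten.Nodup := by
    rw [hfl]; exact hp.flatten.nodup_iff.1 hnd
  have hmem' : ∀ v, v ∈ ((l ++ u :: w :: l') :: rest).flatten ↔ v ∈ W := by
    intro v
    rw [hfl, ← hp.flatten.mem_iff, hmem]
  have h2 := hcard hne' hnd' hmem'
  have hlen := hp.length_eq
  simp only [List.length_cons] at hlen h2
  refine ⟨?_, fun hc => ?_, fun v hv => ?_, ⟨_, hne', hnd', hmem', hins⟩⟩
  · rw [Sym2.mk_isDiag_iff]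
    rintro rfl
    have := hp.flatten.nodup_iff.1 hnd
    simp [List.nodup_append] at this
  · rw [insert_eq_of_mem hc] at hins
    rw [← hins] at h2
    omega
  · rw [← hmem, hp.flatten.mem_iff]
    rcases Sym2.mem_iff.1 hv with rfl | rfl <;> simp

lemma LinForest.deg_le_two [Fintype V] (h : LinForest W F) (v : V) : deg F v ≤ 2 := by
  obtain ⟨l, hl, hF⟩ := h.exists_complete
  exact (deg_mono hF v).trans (deg_pairSet_le_two hl v)

end LinForest

section Segments

variable {α : Type*} [DecidableEq α]

/-- The elements accepted in the rounds from `a` to `b` of a log. -/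
def seg (a b : ℕ) (L : List (Option α)) : Finset α := accepted ((L.take b).drop a)

variable {a b c : ℕ} {L L' : List (Option α)}

lemma seg_append_of_le (h : b ≤ L.length) : seg a b (L ++ L') = seg a b L := by
  rw [seg, seg, List.take_append_of_le_length h]

lemma seg_take (h : b ≤ c) : seg a b (L.take c) = seg a b L := by
  rw [seg, seg, List.take_take, min_eq_left h]

lemma seg_eq_empty (h : L.length ≤ a) : seg a b L = ∅ := by
  rw [seg, List.drop_of_length_le]
  · rfl
  · simp; omega

lemma seg_append_singleton (o : Option α) (ha : a ≤ L.length) (hb : L.length < b) :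
    seg a b (L ++ [o]) = seg a b L ∪ accepted [o] := by
  rw [seg, seg, List.take_of_length_le (by simp; omega), List.take_of_length_le hb.le,
    List.drop_append_of_le_length ha, accepted_append]

lemma seg_append_none : seg a b (L ++ [none]) = seg a b L := by
  rcases le_or_gt b L.length with h | h
  · exact seg_append_of_le h
  rcases le_or_gt a L.length with h' | h'
  · rw [seg_append_singleton _ h' h, accepted_none, union_empty]
  · rw [seg_eq_empty (by simp; omega), seg_eq_empty h'.le]

lemma seg_append_some (e : α) (ha : a ≤ L.length) (hb : L.length < b) :
    seg a b (L ++ [some e]) = insert e (seg a b L) := by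
  rw [seg_append_singleton _ ha hb, accepted_some, union_comm, insert_eq]

lemma seg_subset_accepted : seg a b L ⊆ accepted L := by
  intro e he
  simp only [seg, accepted, List.mem_toFinset, List.reduceOption_mem_iff] at he ⊢
  exact List.mem_of_mem_take (List.mem_of_mem_drop he)

lemma accepted_take_subset : accepted (L.take c) ⊆ accepted L := by
  intro e he
  simp only [accepted, List.mem_toFinset, List.reduceOption_mem_iff] at he ⊢
  exact List.mem_of_mem_take he

lemma seg_subset_append : seg a b L ⊆ seg a b (L ++ L') := by
  intro e he
  simp only [seg, accepted, List.mem_toFinset, List.reduceOption_mem_iff] at he ⊢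
  rw [List.take_append, List.drop_append]
  exact List.mem_append_left _ he

lemma accepted_take_union_seg (hab : a ≤ b) :
    accepted (L.take b) = accepted (L.take a) ∪ seg a b L := by
  have : L.take b = L.take a ++ (L.take b).drop a := by
    conv_lhs => rw [← List.take_append_drop a (L.take b)]
    rw [List.take_take, min_eq_left hab]
  conv_lhs => rw [this]
  rw [accepted_append, seg]

lemma seg_zero : seg 0 b L = accepted (L.take b) := rfl

variable {U : List (Option α) → Finset α}

lemma seg_induction {Q : List (Option α) → Finset α → Prop} (h0 : ∀ L₀, Q L₀ ∅)
    (hstep : ∀ L e, ValidLog U L → a ≤ L.length → L.length < b → e ∈ U L →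
      Q (L.take a) (seg a b L) → Q (L.take a) (insert e (seg a b L)))
    (hL : ValidLog U L) : Q (L.take a) (seg a b L) := by
  induction hL with
  | nil => rw [seg_eq_empty (Nat.zero_le _)]; exact h0 _
  | @skip L hL ih =>
    rcases le_or_gt a L.length with h' | h'
    · rw [seg_append_none, List.take_append_of_le_length h']
      exact ih
    · rw [seg_eq_empty (by simp; omega)]; exact h0 _
  | @accept L e hL he ih =>
    rcases le_or_gt a L.length with h' | h'
    · rw [List.take_append_of_le_length h']
      rcases le_or_gt b L.length with h | h
      · rwa [seg_append_of_le h]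
      · rw [seg_append_some _ h' h]
        exact hstep L e hL h' h he ih
    · rw [seg_eq_empty (by simp; omega)]; exact h0 _

end Segments

section Counting

variable {V : Type*} [DecidableEq V] [Fintype V]

/-- The number of edges of `A` joining `v` to other elements of `T`. -/
def cnt (T : Finset V) (A : Finset (Sym2 V)) (v : V) : ℕ :=
  #(T.filter fun y => s(y, v) ∈ A ∧ y ≠ v)

lemma cnt_mono {T T' : Finset V} {A A' : Finset (Sym2 V)} (hT : T ⊆ T') (hA : A ⊆ A') (v : V) :
    cnt T A v ≤ cnt T' A' v :=
  card_le_card fun _ hy => by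
    rw [mem_filter] at hy ⊢
    exact ⟨hT hy.1, hA hy.2.1, hy.2.2⟩

lemma cnt_lt_cnt_insert {T : Finset V} {A : Finset (Sym2 V)} {v y : V} (hy : y ∈ T)
    (he : s(v, y) ∉ A) (hne : y ≠ v) : cnt T A v + 1 ≤ cnt T (insert s(v, y) A) v := by
  rw [Nat.add_one_le_iff]
  refine card_lt_card (Finset.ssubset_iff_subset_ne.2 ⟨fun z hz => ?_, fun h => ?_⟩)
  · rw [mem_filter] at hz ⊢
    exact ⟨hz.1, mem_insert_of_mem hz.2.1, hz.2.2⟩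
  · have : y ∈ T.filter fun z => s(z, v) ∈ insert s(v, y) A ∧ z ≠ v := by
      rw [mem_filter]
      exact ⟨hy, by rw [Sym2.eq_swap]; exact mem_insert_self _ _, hne⟩
    rw [← h, mem_filter, Sym2.eq_swap] at this
    exact he this.2.1

/-- The edges between `Bd` and `T` acceptable to a collector which wants up to `cap` edges
at each vertex of `Bd`, using only ends in `T` satisfying `fr`. -/
noncomputable def coll (Bd T : Finset V) (cap : ℕ) (fr : V → Prop) (A : Finset (Sym2 V)) :
    Finset (Sym2 V) := by
  classical
  exact univ.filter fun e => ∃ v ∈ Bd, ∃ y ∈ T, e = s(v, y) ∧ cnt T A v < cap ∧ fr y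

lemma mem_coll {Bd T : Finset V} {cap : ℕ} {fr : V → Prop} {A : Finset (Sym2 V)} {e : Sym2 V} :
    e ∈ coll Bd T cap fr A ↔ ∃ v ∈ Bd, ∃ y ∈ T, e = s(v, y) ∧ cnt T A v < cap ∧ fr y := by
  simp [coll]

lemma card_coll_le (Bd T : Finset V) (cap : ℕ) (fr : V → Prop) (A : Finset (Sym2 V)) :
    #(coll Bd T cap fr A) ≤ #Bd * #T := by
  rw [← card_product]
  refine (card_le_card fun e he => ?_).trans (card_image_le (f := fun x : V × V => s(x.1, x.2)))
  obtain ⟨v, hv, y, hy, rfl, -⟩ := mem_coll.1 he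
  exact mem_image.2 ⟨(v, y), mem_product.2 ⟨hv, hy⟩, rfl⟩

lemma card_insert_le_sum_min {Bd T : Finset V} {cap : ℕ} {fr : V → Prop} {A : Finset (Sym2 V)}
    {e : Sym2 V} (he : e ∈ coll Bd T cap fr A) (hd : ¬ e.IsDiag) (heA : e ∉ A)
    (hA : #A ≤ ∑ v ∈ Bd, min (cnt T A v) cap) :
    #(insert e A) ≤ ∑ v ∈ Bd, min (cnt T (insert e A) v) cap := by
  rw [card_insert_of_notMem heA]
  refine (Nat.add_le_add_right hA 1).trans ?_
  rw [Nat.add_one_le_iff]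
  obtain ⟨v, hv, y, hy, rfl, hc, -⟩ := mem_coll.1 he
  have hne : y ≠ v := fun h => hd (by rw [h]; exact Sym2.mk_isDiag_iff.2 rfl)
  refine sum_lt_sum (fun u _ => ?_) ⟨v, hv, ?_⟩
  · have := cnt_mono (Subset.refl T) (subset_insert s(v, y) A) u
    omega
  · have := cnt_lt_cnt_insert hy heA hne
    omega

lemma sum_min_le (Bd T : Finset V) (cap : ℕ) (A : Finset (Sym2 V)) :
    ∑ v ∈ Bd, min (cnt T A v) cap ≤ #Bd * cap := by
  rw [← smul_eq_mul]
  exact sum_le_card_nsmul _ _ _ fun _ _ => min_le_right _ _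

/-- A fixed vertex has many unseen edges to a set. -/
lemma card_star_sdiff {H : Finset (Sym2 V)} {Δ : ℕ} {v : V} (hH : #(H.filter (v ∈ ·)) ≤ Δ)
    (T : Finset V) :
    #T ≤ #(((T.erase v).image fun y => s(v, y)) \ H) + 1 + Δ := by
  have h1 : #((T.erase v).image fun y => s(v, y)) = #(T.erase v) :=
    card_image_of_injective _ fun y z h => Sym2.congr_right.1 h
  have h2 : #((T.erase v).image fun y => s(v, y)) ≤
      #(((T.erase v).image fun y => s(v, y)) \ H) + #(H.filter (v ∈ ·)) := by
    rw [← card_sdiff_add_card_inter]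
    refine Nat.add_le_add_left (card_le_card fun e he => ?_) _
    rw [mem_inter, mem_image] at he
    obtain ⟨⟨y, -, rfl⟩, he⟩ := he
    exact mem_filter.2 ⟨he, Sym2.mem_mk_left _ _⟩
  have h3 := pred_card_le_card_erase (s := T) (a := v)
  omega

/-- A set of hubs outside `T` has many unseen edges to `T`. -/
lemma card_bipartite_sdiff {H : Finset (Sym2 V)} {Δ : ℕ} (hH : ∀ v, #(H.filter (v ∈ ·)) ≤ Δ)
    (Z T : Finset V) (hZT : ∀ z ∈ Z, z ∉ T) :
    #Z * #T ≤ #(((Z ×ˢ T).image fun x => s(x.1, x.2)) \ H) + #Z * Δ := by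
  have h1 : #((Z ×ˢ T).image fun x => s(x.1, x.2)) = #(Z ×ˢ T) := by
    refine card_image_of_injOn ?_
    rintro ⟨a, b⟩ hab ⟨c, d⟩ hcd h
    simp only [coe_product, Set.mem_prod, mem_coe] at hab hcd
    rcases Sym2.eq_iff.1 h with ⟨rfl, rfl⟩ | ⟨h1, h2⟩
    · rfl
    · simp only at h1 h2
      exact absurd (h1 ▸ hcd.2) (hZT a hab.1)
  have h2 : #((Z ×ˢ T).image fun x => s(x.1, x.2)) ≤
      #(((Z ×ˢ T).image fun x => s(x.1, x.2)) \ H) + #(Z.biUnion fun z => H.filter (z ∈ ·)) := by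
    rw [← card_sdiff_add_card_inter]
    refine Nat.add_le_add_left (card_le_card fun e he => ?_) _
    rw [mem_inter, mem_image] at he
    obtain ⟨⟨⟨z, y⟩, hzy, rfl⟩, he⟩ := he
    exact mem_biUnion.2 ⟨z, (mem_product.1 hzy).1, mem_filter.2 ⟨he, Sym2.mem_mk_left _ _⟩⟩
  rw [h1, card_product] at h2
  have h3 : #(Z.biUnion fun z => H.filter (z ∈ ·)) ≤ #Z * Δ :=
    card_biUnion_le_card_mul _ _ _ fun z _ => hH z
  omega

end Counting

section Closure

variable {V : Type*} [DecidableEq V] [Fintype V]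

/-- Every vertex of `B` outside `Q` has at least `d` edges of `A` to `R` outside `Q`. -/
def Absorbs (R : Finset V) (d : ℕ) (B : Finset V) (A : Finset (Sym2 V)) (Q : Finset V) : Prop :=
  Q ⊆ B ∧ ∀ v ∈ B \ Q, d ≤ cnt (R \ Q) A v

lemma exists_min_absorbs (R : Finset V) (d : ℕ) (B : Finset V) (A : Finset (Sym2 V)) :
    ∃ Q, Absorbs R d B A Q ∧ ∀ Q', Absorbs R d B A Q' → #Q ≤ #Q' := by
  classical
  obtain ⟨Q, hQ, hmin⟩ := exists_min_image (B.powerset.filter (Absorbs R d B A)) card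
    ⟨B, by simp [Absorbs]⟩
  exact ⟨Q, (mem_filter.1 hQ).2, fun Q' hQ' => hmin Q' (by simp [hQ', hQ'.1])⟩

/-- A smallest set of vertices to be removed from `B` such that all others keep `d` edges. -/
noncomputable def core (R : Finset V) (d : ℕ) (B : Finset V) (A : Finset (Sym2 V)) : Finset V :=
  (exists_min_absorbs R d B A).choose

lemma absorbs_core (R : Finset V) (d : ℕ) (B : Finset V) (A : Finset (Sym2 V)) :
    Absorbs R d B A (core R d B A) := (exists_min_absorbs R d B A).choose_spec.1

lemma card_core_le {R : Finset V} {d : ℕ} {B : Finset V} {A : Finset (Sym2 V)} {Q : Finset V}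
    (hQ : Absorbs R d B A Q) : #(core R d B A) ≤ #Q :=
  (exists_min_absorbs R d B A).choose_spec.2 Q hQ

/-- In a sparse graph, the core is at most twice as large as the set of vertices with few edges. -/
lemma card_core_le_two_mul {R : Finset V} {d κ m : ℕ} {B : Finset V} {A : Finset (Sym2 V)}
    (hd : 2 * κ < d)
    (hA : ∀ Y : Finset V, #Y ≤ m → #(A.filter fun e => ∀ v ∈ e, v ∈ Y) ≤ κ * #Y)
    (hm : 2 * #(B.filter fun v => cnt R A v < 2 * d) ≤ m) :
    #(core R d B A) ≤ 2 * #(B.filter fun v => cnt R A v < 2 * d) := by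
  classical
  set X₀ := B.filter fun v => cnt R A v < 2 * d with hX₀
  set E : Finset V → ℕ := fun Q => #(A.filter fun e => ∀ v ∈ e, v ∈ Q) with hE
  set C := B.powerset.filter fun Q => X₀ ⊆ Q ∧ #Q ≤ 2 * #X₀ ∧ d * (#Q - #X₀) ≤ E Q with hC
  obtain ⟨Q, hQ, hmax⟩ := exists_max_image C card
    ⟨X₀, by simp only [hC, mem_filter, mem_powerset]; exact ⟨filter_subset _ _, by simp; omega⟩⟩
  simp only [hC, mem_filter, mem_powerset] at hQ hmax
  obtain ⟨hQB, hXQ, hcard, hEQ⟩ := hQ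
  suffices h : Absorbs R d B A Q from (card_core_le h).trans hcard
  refine ⟨hQB, fun v hv => ?_⟩
  by_contra! hlt
  rw [mem_sdiff] at hv
  have hvX : v ∉ X₀ := fun h => hv.2 (hXQ h)
  have h2d : 2 * d ≤ cnt R A v := by
    by_contra! h
    exact hvX (mem_filter.2 ⟨hv.1, h⟩)
  have hRQ : d ≤ cnt (R ∩ Q) A v := by
    have : cnt R A v ≤ cnt (R \ Q) A v + cnt (R ∩ Q) A v := by
      simp only [cnt]
      refine (card_le_card fun y hy => ?_).trans (card_union_le _ _)
      simp only [mem_filter, mem_union, mem_sdiff, mem_inter] at hy ⊢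
      tauto
    omega
  have hins : E Q + d ≤ E (insert v Q) := by
    have h1 : Disjoint (A.filter fun e => ∀ u ∈ e, u ∈ Q)
        (((R ∩ Q).filter fun y => s(y, v) ∈ A ∧ y ≠ v).image fun y => s(y, v)) := by
      rw [Finset.disjoint_left]
      intro e he he'
      obtain ⟨y, -, rfl⟩ := mem_image.1 he'
      exact hv.2 ((mem_filter.1 he).2 v (Sym2.mem_mk_right _ _))
    have h2 : #(((R ∩ Q).filter fun y => s(y, v) ∈ A ∧ y ≠ v).image fun y => s(y, v)) =
        cnt (R ∩ Q) A v := card_image_of_injective _ fun y z h => Sym2.congr_left.1 h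
    refine (Nat.add_le_add_left (hRQ.trans h2.ge) _).trans ?_
    rw [← card_union_of_disjoint h1]
    refine card_le_card fun e he => ?_
    rcases mem_union.1 he with he | he
    · rw [mem_filter] at he ⊢
      exact ⟨he.1, fun u hu => mem_insert_of_mem (he.2 u hu)⟩
    · obtain ⟨y, hy, rfl⟩ := mem_image.1 he
      simp only [mem_filter, mem_inter] at hy ⊢
      refine ⟨hy.2.1, fun u hu => ?_⟩
      rcases Sym2.mem_iff.1 hu with rfl | rfl
      · exact mem_insert_of_mem hy.1.2
      · exact mem_insert_self _ _
  have hXQc := card_le_card hXQ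
  have hcv : #(insert v Q) = #Q + 1 := card_insert_of_notMem hv.2
  rcases lt_or_eq_of_le hcard with h | h
  · have := hmax (insert v Q) ⟨insert_subset hv.1 hQB, hXQ.trans (subset_insert _ _), by omega, by
      rw [hcv, Nat.sub_add_comm hXQc, Nat.mul_succ]; omega⟩
    omega
  · have h3 := hA Q (by omega)
    rcases Nat.eq_zero_or_pos #X₀ with h0 | h0
    · have hQ0 : Q = ∅ := card_eq_zero.1 (by omega)
      rw [hQ0, sdiff_empty] at hlt
      omega
    · have h4 : d * #X₀ ≤ κ * #Q := by
        have h5 : #Q - #X₀ = #X₀ := by omega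
        rw [h5] at hEQ
        exact hEQ.trans h3
      rw [h] at h4
      nlinarith

end Closure

section Repair

variable {V : Type*} [DecidableEq V] [Fintype V]

/-- The neighbours of `w`. -/
def nb (F : Finset (Sym2 V)) (w : V) : Finset V := univ.filter fun z => s(w, z) ∈ F

/-- `w` together with its neighbours. -/
def nbc (F : Finset (Sym2 V)) (w : V) : Finset V := insert w (nb F w)

lemma mem_nb {F : Finset (Sym2 V)} {w z : V} : z ∈ nb F w ↔ s(w, z) ∈ F := by simp [nb]

lemma card_nb_le (F : Finset (Sym2 V)) (w : V) : #(nb F w) ≤ deg F w := by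
  rw [deg, ← card_image_of_injective (nb F w) (f := fun z => s(w, z))
    fun y z h => Sym2.congr_right.1 h]
  refine card_le_card fun e he => ?_
  obtain ⟨z, hz, rfl⟩ := mem_image.1 he
  exact mem_filter.2 ⟨mem_nb.1 hz, Sym2.mem_mk_left _ _⟩

lemma mem_nbc_self (F : Finset (Sym2 V)) (w : V) : w ∈ nbc F w := mem_insert_self _ _

lemma mem_nbc_comm {F : Finset (Sym2 V)} {w z : V} : z ∈ nbc F w ↔ w ∈ nbc F z := by
  rw [nbc, nbc, mem_insert, mem_insert, mem_nb, mem_nb, Sym2.eq_swap, eq_comm]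

variable {F A : Finset (Sym2 V)} {X R : Finset V} {g : V → Prop} {Good : V → Finset V}

/-- A step of `exists_repair`. -/
lemma exists_repair_aux
    (hGA : ∀ v ∈ X, ∀ w ∈ Good v, s(v, w) ∈ A)
    (hGdeg : ∀ v ∈ X, ∀ w ∈ Good v, ∀ y ∈ nbc F w, 1 < deg F y)
    (hGg : ∀ v ∈ X, ∀ w ∈ Good v, ∀ z ∈ nb F w, g z)
    (hGdisj : ∀ v ∈ X, ∀ w ∈ Good v, ∀ v' ∈ X, ∀ w' ∈ Good v',
      (∃ y ∈ nbc F w, y ∈ nbc F w') → v = v' ∧ w = w')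
    (hX : ∀ v ∈ X, deg F v ≤ 1) (hR : ∀ e ∈ F, ∀ v ∈ e, v ∉ R) (hXR : ∀ v ∈ X, v ∉ R)
    (k : ℕ) (F₁ : Finset (Sym2 V)) (hk : ∑ v ∈ X, (2 - deg F₁ v) ≤ k) (hFA : F₁ ⊆ A)
    (hl : ∃ l, Complete l ∧ F₁ ⊆ pairSet l) (hR₁ : ∀ e ∈ F₁, ∀ v ∈ e, v ∉ R)
    (hg : ∀ x, deg F₁ x ≤ 1 → x ∈ X ∨ g x)
    (hslot : ∀ v ∈ X, 2 ≤ deg F₁ v +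
      #((Good v).filter fun w => ∀ e, w ∈ e → (e ∈ F₁ ↔ e ∈ F))) :
    ∃ F' ⊆ A, (∃ l, Complete l ∧ F' ⊆ pairSet l) ∧ #F' = #F₁ ∧
      (∀ e ∈ F', ∀ v ∈ e, v ∉ R) ∧ ∀ x, deg F' x ≤ 1 → g x := by
  classical
  induction k generalizing F₁ with
  | zero =>
    refine ⟨F₁, hFA, hl, rfl, hR₁, fun x hx => (hg x hx).resolve_left fun hxX => ?_⟩
    have := (sum_eq_zero_iff.1 (Nat.le_zero.1 hk)) x hxX
    omega
  | succ k ih =>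
    by_cases hdone : ∀ v ∈ X, 1 < deg F₁ v
    · exact ⟨F₁, hFA, hl, rfl, hR₁, fun x hx => (hg x hx).resolve_left fun hxX => by
        have := hdone x hxX; omega⟩
    push Not at hdone
    obtain ⟨v, hv, hv1⟩ := hdone
    have hne : ((Good v).filter fun w => ∀ e, w ∈ e → (e ∈ F₁ ↔ e ∈ F)).Nonempty := by
      rw [← card_pos]
      have := hslot v hv
      omega
    obtain ⟨w, hw⟩ := hne
    obtain ⟨hwG, hwi⟩ := mem_filter.1 hw
    obtain ⟨l, hl, hFl⟩ := hl
    have hwdeg : deg F₁ w = 2 := by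
      have h1 : deg F₁ w ≤ 2 := (deg_mono hFl w).trans (deg_pairSet_le_two hl w)
      have h2 : deg F₁ w = deg F w := by
        simp only [deg]
        congr 1
        ext e
        simp only [mem_filter]
        exact and_congr_left fun he => hwi e he
      have h3 := hGdeg v hv w hwG w (mem_nbc_self _ _)
      omega
    have hvw : v ≠ w := by
      rintro rfl
      omega
    have hvF : s(v, w) ∉ F₁ := by
      rw [hwi _ (Sym2.mem_mk_right _ _)]
      intro h
      have h1 : v ∈ nbc F w := mem_insert_of_mem (mem_nb.2 (by rwa [Sym2.eq_swap]))
      have := hGdeg v hv w hwG v h1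
      have := hX v hv
      omega
    obtain ⟨z, l', hwz, hzv, hl', hsub⟩ := exists_exchange hl hFl hv1 hwdeg hvF hvw
    have hwzF : s(w, z) ∈ F := (hwi _ (Sym2.mem_mk_left _ _)).1 hwz
    have hz : z ∈ nb F w := mem_nb.2 hwzF
    have hwz' : w ≠ z := by
      rintro rfl
      exact not_isDiag_of_mem_pairSet hl.1 (hFl hwz) (Sym2.mk_isDiag_iff.2 rfl)
    set F₂ := insert s(v, w) (F₁.erase s(w, z)) with hF₂
    have hdeg : ∀ u, u ≠ v → u ≠ w → u ≠ z → ∀ e, u ∈ e → (e ∈ F₂ ↔ e ∈ F₁) := by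
      intro u h1 h2 h3 e he
      rw [hF₂, mem_insert, mem_erase]
      constructor
      · rintro (rfl | h)
        · simp [h1, h2] at he
        · exact h.2
      · intro h
        refine Or.inr ⟨?_, h⟩
        rintro rfl
        simp [h2, h3] at he
    have hdeg' : ∀ u, u ≠ v → u ≠ w → u ≠ z → deg F₂ u = deg F₁ u := by
      intro u h1 h2 h3
      simp only [deg]
      congr 1
      ext e
      simp only [mem_filter]
      exact and_congr_left fun he => hdeg u h1 h2 h3 e he
    have hfilt : ∀ u, u ∈ s(v, w) → deg F₂ u = #((F₁.erase s(w, z)).filter (u ∈ ·)) + 1 := by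
      intro u hu
      rw [deg, hF₂, filter_insert, if_pos hu, card_insert_of_notMem]
      simp [hvF]
    have hdegv : deg F₂ v = deg F₁ v + 1 := by
      rw [hfilt v (Sym2.mem_mk_left _ _), filter_erase, erase_eq_of_notMem, deg]
      simp [hvw, hzv.symm]
    have hdegw : deg F₂ w = 2 := by
      have hm : s(w, z) ∈ F₁.filter (w ∈ ·) := mem_filter.2 ⟨hwz, Sym2.mem_mk_left _ _⟩
      rw [hfilt w (Sym2.mem_mk_right _ _), filter_erase, card_erase_of_mem hm]
      have : #(F₁.filter (w ∈ ·)) = 2 := hwdeg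
      omega
    have hwX : w ∉ X := fun h => by
      have h1 := hGdeg v hv w hwG w (mem_nbc_self _ _)
      have h2 := hX w h
      omega
    have hzX : z ∉ X := fun h => by
      have h1 := hGdeg v hv w hwG z (mem_insert_of_mem hz)
      have h2 := hX z h
      omega
    have hwR : w ∉ R := hR _ hwzF w (Sym2.mem_mk_left _ _)
    have hcard : #F₂ = #F₁ := by
      rw [hF₂, card_insert_of_notMem (by simp [hvF]), card_erase_of_mem hwz]
      have := card_pos.2 ⟨_, hwz⟩
      omega
    rw [← hcard]
    refine ih F₂ ?_ ?_ ⟨l', hl', hsub⟩ ?_ ?_ ?_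
    · have : ∑ u ∈ X, (2 - deg F₂ u) < ∑ u ∈ X, (2 - deg F₁ u) := by
        refine sum_lt_sum (fun u hu => ?_) ⟨v, hv, by omega⟩
        by_cases huv : u = v
        · subst huv; omega
        · rw [hdeg' u huv (fun h => hwX (h ▸ hu)) (fun h => hzX (h ▸ hu))]
      omega
    · exact insert_subset (hGA v hv w hwG) ((erase_subset _ _).trans hFA)
    · intro e he u hu
      rcases mem_insert.1 he with rfl | he
      · rcases Sym2.mem_iff.1 hu with rfl | rfl
        · exact hXR u hv
        · exact hwR
      · exact hR₁ e (mem_of_mem_erase he) u hu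
    · intro x hx
      by_cases hxv : x = v
      · exact Or.inl (hxv ▸ hv)
      by_cases hxw : x = w
      · subst hxw; omega
      by_cases hxz : x = z
      · subst hxz; exact Or.inr (hGg v hv w hwG x hz)
      · rw [hdeg' x hxv hxw hxz] at hx
        exact hg x hx
    · intro u hu
      have key : ∀ w' ∈ Good u, w' ≠ w → (∀ e, w' ∈ e → (e ∈ F₁ ↔ e ∈ F)) →
          ∀ e, w' ∈ e → (e ∈ F₂ ↔ e ∈ F) := by
        intro w' hw' hne hi e he
        rw [← hi e he]
        refine hdeg w' ?_ hne ?_ e he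
        · rintro rfl
          have h1 := hGdeg u hu w' hw' w' (mem_nbc_self _ _)
          have h2 := hX w' hv
          omega
        · rintro rfl
          exact hne (hGdisj u hu w' hw' v hv w hwG
            ⟨w', mem_nbc_self _ _, mem_insert_of_mem hz⟩).2
      have hsub' : ((Good u).filter fun w => ∀ e, w ∈ e → (e ∈ F₁ ↔ e ∈ F)).erase w ⊆
          (Good u).filter fun w => ∀ e, w ∈ e → (e ∈ F₂ ↔ e ∈ F) := by
        intro w' hw'
        rw [mem_erase, mem_filter] at hw'
        exact mem_filter.2 ⟨hw'.2.1, key w' hw'.2.1 hw'.1 hw'.2.2⟩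
      have hc := card_le_card hsub'
      have hs := hslot u hu
      by_cases huv : u = v
      · subst huv
        rw [card_erase_of_mem hw] at hc
        omega
      · rw [hdeg' u huv (fun h => hwX (h ▸ hu)) (fun h => hzX (h ▸ hu))]
        by_cases hwu : w ∈ Good u
        · exact absurd (hGdisj u hu w hwu v hv w hwG ⟨w, mem_nbc_self _ _, mem_nbc_self _ _⟩).1 huv
        · rw [erase_eq_of_notMem fun h => hwu (mem_filter.1 h).1] at hc
          omega

/-- Replace edges of `F` so that all vertices of degree at most one satisfy `g`, given for each bad
vertex two good vertices to be joined to it. -/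
lemma exists_repair
    (hGA : ∀ v ∈ X, ∀ w ∈ Good v, s(v, w) ∈ A)
    (hGdeg : ∀ v ∈ X, ∀ w ∈ Good v, ∀ y ∈ nbc F w, 1 < deg F y)
    (hGg : ∀ v ∈ X, ∀ w ∈ Good v, ∀ z ∈ nb F w, g z)
    (hGdisj : ∀ v ∈ X, ∀ w ∈ Good v, ∀ v' ∈ X, ∀ w' ∈ Good v',
      (∃ y ∈ nbc F w, y ∈ nbc F w') → v = v' ∧ w = w')
    (hX : ∀ v ∈ X, deg F v ≤ 1) (hR : ∀ e ∈ F, ∀ v ∈ e, v ∉ R) (hXR : ∀ v ∈ X, v ∉ R)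
    (hFA : F ⊆ A) (hl : ∃ l, Complete l ∧ F ⊆ pairSet l)
    (hg : ∀ x, deg F x ≤ 1 → x ∈ X ∨ g x) (hGood : ∀ v ∈ X, 2 ≤ #(Good v)) :
    ∃ F' ⊆ A, (∃ l, Complete l ∧ F' ⊆ pairSet l) ∧ #F' = #F ∧
      (∀ e ∈ F', ∀ v ∈ e, v ∉ R) ∧ ∀ x, deg F' x ≤ 1 → g x :=
  exists_repair_aux hGA hGdeg hGg hGdisj hX hR hXR _ F le_rfl hFA hl hR hg fun v hv => by
    have : (Good v).filter (fun w => ∀ e, w ∈ e → (e ∈ F ↔ e ∈ F)) = Good v :=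
      filter_true_of_mem fun _ _ _ _ => Iff.rfl
    have h2 := hGood v hv
    rw [← this] at h2
    refine h2.trans ?_
    simp

end Repair

/-- The parameters of the strategy: a reserved set `R`, the target number `q` of path edges, the
target degrees `d` and `D`, and the rounds at which the phases end. -/
structure Params (V : Type*) where
  R : Finset V
  q : ℕ
  d : ℕ
  D : ℕ
  s₁ : ℕ
  s₂ : ℕ
  s₃ : ℕ
  s₄ : ℕ
  h₁₂ : s₁ ≤ s₂
  h₂₃ : s₂ ≤ s₃
  h₃₄ : s₃ ≤ s₄

section Policy

variable {V : Type*} [DecidableEq V] [Fintype V]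

/-- The vertices of degree at most one. -/
def low (F : Finset (Sym2 V)) : Finset V := univ.filter fun v => deg F v ≤ 1

lemma mem_low {F : Finset (Sym2 V)} {v : V} : v ∈ low F ↔ deg F v ≤ 1 := by simp [low]

/-- The vertex `w` and its neighbours have degree two and are not close to ends of edges of `A`. -/
def Fresh (F A : Finset (Sym2 V)) (w : V) : Prop :=
  ∀ y ∈ nbc F w, 1 < deg F y ∧ ∀ e ∈ A, ∀ w' ∈ e, 1 < deg F w' → y ∉ nbc F w'

/-- The neighbours of the ends of degree two of the edges of `A`. -/
def hub (F A : Finset (Sym2 V)) : Finset V :=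
  univ.filter fun z => ∃ e ∈ A, ∃ w ∈ e, 1 < deg F w ∧ z ∈ nb F w

lemma mem_hub {F A : Finset (Sym2 V)} {z : V} :
    z ∈ hub F A ↔ ∃ e ∈ A, ∃ w ∈ e, 1 < deg F w ∧ z ∈ nb F w := by simp [hub]

/-- The set `F'` consists of `q` edges of `A` on disjoint paths avoiding `R'`, and all vertices of
degree at most one have `d` edges of `A` to `R'`. -/
def Ready (q d : ℕ) (A F' : Finset (Sym2 V)) (R' : Finset V) : Prop :=
  F' ⊆ A ∧ (∃ l, Complete l ∧ F' ⊆ pairSet l) ∧ #F' = q ∧ (∀ e ∈ F', ∀ v ∈ e, v ∉ R') ∧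
    ∀ x, deg F' x ≤ 1 → d ≤ cnt R' A x

open Classical in
/-- A choice of the path edges for the last phase. -/
noncomputable def repaired (q d : ℕ) (A : Finset (Sym2 V)) : Finset (Sym2 V) :=
  if h : ∃ F' R', Ready q d A F' R' then h.choose else ∅

lemma exists_ready_repaired {q d : ℕ} {A : Finset (Sym2 V)} (h : ∃ F' R', Ready q d A F' R') :
    ∃ R', Ready q d A (repaired q d A) R' := by
  rw [repaired, dif_pos h]
  exact h.choose_spec

namespace Params

variable (p : Params V) (L : List (Option (Sym2 V)))

/-- The edges of the first phase. -/
def F : Finset (Sym2 V) := seg 0 p.s₁ L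

/-- The edges of the second phase. -/
def A₂ : Finset (Sym2 V) := seg p.s₁ p.s₂ L

/-- The edges of the third phase. -/
def A₃ : Finset (Sym2 V) := seg p.s₂ p.s₃ L

/-- The edges of the fourth phase. -/
def A₄ : Finset (Sym2 V) := seg p.s₃ p.s₄ L

/-- The exceptional vertices. -/
noncomputable def X : Finset V := core p.R p.d (low (p.F L)) (p.A₂ L)

/-- The path edges used in the last phase. -/
noncomputable def F' : Finset (Sym2 V) := repaired p.q p.d (accepted (L.take p.s₄))

open Classical in
/-- The edges which are useful at the current stage. -/
noncomputable def useful : Finset (Sym2 V) :=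
  if L.length < p.s₁ then
    if #(p.F L) < p.q then univ.filter fun e => LinForest p.Rᶜ (insert e (p.F L)) else ∅
  else if L.length < p.s₂ then coll (low (p.F L)) p.R (2 * p.d) (fun _ => True) (p.A₂ L)
  else if L.length < p.s₃ then coll (p.X L) univ (p.D + 1) (Fresh (p.F L) (p.A₃ L)) (p.A₃ L)
  else if L.length < p.s₄ then
    coll (hub (p.F L) (p.A₃ L)) (p.R \ p.X L) p.d (fun _ => True) (p.A₄ L)
  else if HamList (accepted L) then ∅
  else univ.filter fun e => HamList (insert e (accepted L)) ∨
    minVirt (p.F' L) (insert e (accepted L)) < minVirt (p.F' L) (accepted L)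

open Classical in
/-- The strategy: accept the first useful edge. -/
noncomputable def policy : Finset (Sym2 V) :=
  (p.useful L).filter fun e => ¬ e.IsDiag ∧ e ∉ accepted L

variable {p L}

lemma mem_policy {e : Sym2 V} :
    e ∈ p.policy L ↔ e ∈ p.useful L ∧ ¬ e.IsDiag ∧ e ∉ accepted L := by simp [policy]

lemma useful_eq_one (h : L.length < p.s₁) (hq : #(p.F L) < p.q) {e : Sym2 V} :
    e ∈ p.useful L ↔ LinForest p.Rᶜ (insert e (p.F L)) := by
  rw [useful, if_pos h, if_pos hq]; simp

lemma useful_eq_empty (h : L.length < p.s₁) (hq : ¬ #(p.F L) < p.q) : p.useful L = ∅ := by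
  rw [useful, if_pos h, if_neg hq]

lemma useful_eq_two (h : p.s₁ ≤ L.length) (h' : L.length < p.s₂) :
    p.useful L = coll (low (p.F L)) p.R (2 * p.d) (fun _ => True) (p.A₂ L) := by
  rw [useful, if_neg (by omega), if_pos h']

lemma useful_eq_three (h : p.s₂ ≤ L.length) (h' : L.length < p.s₃) :
    p.useful L = coll (p.X L) univ (p.D + 1) (Fresh (p.F L) (p.A₃ L)) (p.A₃ L) := by
  have := p.h₁₂
  rw [useful, if_neg (by omega), if_neg (by omega), if_pos h']

lemma useful_eq_four (h : p.s₃ ≤ L.length) (h' : L.length < p.s₄) :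
    p.useful L = coll (hub (p.F L) (p.A₃ L)) (p.R \ p.X L) p.d (fun _ => True) (p.A₄ L) := by
  have := p.h₁₂
  have := p.h₂₃
  rw [useful, if_neg (by omega), if_neg (by omega), if_neg (by omega), if_pos h']

lemma useful_eq_empty_of_hamList (h : p.s₄ ≤ L.length) (hH : HamList (accepted L)) :
    p.useful L = ∅ := by
  have := p.h₁₂
  have := p.h₂₃
  have := p.h₃₄
  rw [useful, if_neg (by omega), if_neg (by omega), if_neg (by omega), if_neg (by omega),
    if_pos hH]

lemma useful_eq_five (h : p.s₄ ≤ L.length) (hH : ¬ HamList (accepted L)) {e : Sym2 V} :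
    e ∈ p.useful L ↔ HamList (insert e (accepted L)) ∨
      minVirt (p.F' L) (insert e (accepted L)) < minVirt (p.F' L) (accepted L) := by
  have := p.h₁₂
  have := p.h₂₃
  have := p.h₃₄
  rw [useful, if_neg (by omega), if_neg (by omega), if_neg (by omega), if_neg (by omega),
    if_neg hH]
  simp

lemma F_take {c : ℕ} (h : p.s₁ ≤ c) : p.F (L.take c) = p.F L := seg_take h
lemma A₂_take {c : ℕ} (h : p.s₂ ≤ c) : p.A₂ (L.take c) = p.A₂ L := seg_take h
lemma A₃_take {c : ℕ} (h : p.s₃ ≤ c) : p.A₃ (L.take c) = p.A₃ L := seg_take h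
lemma A₄_take {c : ℕ} (h : p.s₄ ≤ c) : p.A₄ (L.take c) = p.A₄ L := seg_take h

lemma X_take {c : ℕ} (h : p.s₂ ≤ c) : p.X (L.take c) = p.X L := by
  rw [X, X, F_take (p.h₁₂.trans h), A₂_take h]

lemma linForest_F (hL : ValidLog p.policy L) : LinForest p.Rᶜ (p.F L) ∧ #(p.F L) ≤ p.q := by
  refine seg_induction (a := 0) (b := p.s₁) (U := p.policy)
    (Q := fun _ A => LinForest p.Rᶜ A ∧ #A ≤ p.q)
    (fun _ => ⟨linForest_empty _, by simp⟩) ?_ hL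
  intro L e _ _ hb he ih
  rw [mem_policy] at he
  have hF : p.F L = seg 0 p.s₁ L := rfl
  by_cases hq : #(p.F L) < p.q
  · rw [useful_eq_one hb hq] at he
    rw [← hF]
    exact ⟨he.1, (card_insert_le _ _).trans hq⟩
  · rw [useful_eq_empty hb hq] at he
    simp at he

lemma deg_F_le_two (hL : ValidLog p.policy L) (v : V) : deg (p.F L) v ≤ 2 :=
  (linForest_F hL).1.deg_le_two v

lemma card_A₂_le (hL : ValidLog p.policy L) : #(p.A₂ L) ≤ #(low (p.F L)) * (2 * p.d) := by
  have := seg_induction (a := p.s₁) (b := p.s₂) (U := p.policy)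
    (Q := fun L A => #A ≤ ∑ v ∈ low (p.F L), min (cnt p.R A v) (2 * p.d))
    (fun _ => by simp) ?_ hL
  · rw [F_take le_rfl] at this
    exact this.trans (sum_min_le _ _ _ _)
  · intro L e _ ha hb he ih
    rw [F_take le_rfl] at ih ⊢
    rw [mem_policy, useful_eq_two ha hb] at he
    exact card_insert_le_sum_min he.1 he.2.1 (fun h => he.2.2 (seg_subset_accepted h)) ih

lemma card_A₄_le (hL : ValidLog p.policy L) : #(p.A₄ L) ≤ #(hub (p.F L) (p.A₃ L)) * p.d := by
  have h1 := p.h₁₂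
  have h2 := p.h₂₃
  have := seg_induction (a := p.s₃) (b := p.s₄) (U := p.policy)
    (Q := fun L A => #A ≤ ∑ v ∈ hub (p.F L) (p.A₃ L), min (cnt (p.R \ p.X L) A v) p.d)
    (fun _ => by simp) ?_ hL
  · rw [F_take (h1.trans h2), A₃_take le_rfl, X_take h2] at this
    exact this.trans (sum_min_le _ _ _ _)
  · intro L e _ ha hb he ih
    rw [F_take (h1.trans h2), A₃_take le_rfl, X_take h2] at ih ⊢
    rw [mem_policy, useful_eq_four ha hb] at he
    exact card_insert_le_sum_min he.1 he.2.1 (fun h => he.2.2 (seg_subset_accepted h)) ih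

lemma X_subset_low : p.X L ⊆ low (p.F L) := (absorbs_core _ _ _ _).1

lemma A₃_spec (hL : ValidLog p.policy L) :
    #(p.A₃ L) ≤ #(p.X L) * (p.D + 1) ∧
    (∀ e ∈ p.A₃ L, ∃ v ∈ p.X L, ∃ w, e = s(v, w) ∧ ∀ y ∈ nbc (p.F L) w, 1 < deg (p.F L) y) ∧
    ∀ e ∈ p.A₃ L, ∀ e' ∈ p.A₃ L, ∀ w ∈ e, ∀ w' ∈ e', 1 < deg (p.F L) w → 1 < deg (p.F L) w' →
      (∃ y ∈ nbc (p.F L) w, y ∈ nbc (p.F L) w') → e = e' := by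
  have h1 := p.h₁₂
  have := seg_induction (a := p.s₂) (b := p.s₃) (U := p.policy)
    (Q := fun L A => #A ≤ ∑ v ∈ p.X L, min (cnt univ A v) (p.D + 1) ∧
      (∀ e ∈ A, ∃ v ∈ p.X L, ∃ w, e = s(v, w) ∧ ∀ y ∈ nbc (p.F L) w, 1 < deg (p.F L) y) ∧
      ∀ e ∈ A, ∀ e' ∈ A, ∀ w ∈ e, ∀ w' ∈ e', 1 < deg (p.F L) w → 1 < deg (p.F L) w' →
        (∃ y ∈ nbc (p.F L) w, y ∈ nbc (p.F L) w') → e = e')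
    (fun _ => by simp) ?_ hL
  · rw [F_take h1, X_take le_rfl] at this
    exact ⟨this.1.trans (sum_min_le _ _ _ _), this.2⟩
  · intro L e _ ha hb he ih
    rw [F_take h1, X_take le_rfl] at ih ⊢
    rw [mem_policy, useful_eq_three ha hb] at he
    obtain ⟨ih1, ih2, ih3⟩ := ih
    refine ⟨card_insert_le_sum_min he.1 he.2.1 (fun h => he.2.2 (seg_subset_accepted h)) ih1, ?_⟩
    obtain ⟨v, hv, w, -, rfl, -, hw⟩ := mem_coll.1 he.1
    have hvd : ¬ 1 < deg (p.F L) v := by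
      have := mem_low.1 (X_subset_low hv)
      omega
    have key : ∀ w₁ ∈ s(v, w), 1 < deg (p.F L) w₁ → w₁ = w := by
      intro w₁ h h'
      rcases Sym2.mem_iff.1 h with rfl | rfl
      · exact absurd h' hvd
      · rfl
    constructor
    · intro e he
      rcases mem_insert.1 he with rfl | he
      · exact ⟨v, hv, w, rfl, fun y hy => (hw y hy).1⟩
      · exact ih2 e he
    · intro e he e' he' w₁ hw₁ w₂ hw₂ hd₁ hd₂ hy
      rcases mem_insert.1 he with rfl | hc <;> rcases mem_insert.1 he' with rfl | hc'
      · rfl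
      · obtain rfl := key w₁ hw₁ hd₁
        obtain ⟨y, hy, hy'⟩ := hy
        exact absurd hy' ((hw y hy).2 e' hc' w₂ hw₂ hd₂)
      · obtain rfl := key w₂ hw₂ hd₂
        obtain ⟨y, hy, hy'⟩ := hy
        exact absurd hy ((hw y hy').2 e hc w₁ hw₁ hd₁)
      · exact ih3 e hc e' hc' w₁ hw₁ w₂ hw₂ hd₁ hd₂ hy

lemma card_hub_le (hL : ValidLog p.policy L) : #(hub (p.F L) (p.A₃ L)) ≤ 2 * #(p.A₃ L) := by
  rw [mul_comm]
  refine le_trans ?_ (card_biUnion_le_card_mul (p.A₃ L)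
    (fun e => univ.filter fun z => ∃ w ∈ e, 1 < deg (p.F L) w ∧ z ∈ nb (p.F L) w) 2 ?_)
  · refine card_le_card fun z hz => ?_
    obtain ⟨e, he, h⟩ := mem_hub.1 hz
    exact mem_biUnion.2 ⟨e, he, mem_filter.2 ⟨mem_univ _, h⟩⟩
  · intro e he
    obtain ⟨v, hv, w, rfl, -⟩ := (A₃_spec hL).2.1 e he
    refine le_trans (card_le_card (t := nb (p.F L) w) fun z hz => ?_)
      ((card_nb_le _ _).trans (deg_F_le_two hL w))
    obtain ⟨w', hw', hd, hzw⟩ := (mem_filter.1 hz).2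
    rcases Sym2.mem_iff.1 hw' with rfl | rfl
    · have := mem_low.1 (X_subset_low hv)
      omega
    · exact hzw

/-- The partners of `v` in the third phase both of whose neighbours have many edges. -/
noncomputable def good (p : Params V) (L : List (Option (Sym2 V))) (v : V) : Finset V := by
  classical
  exact univ.filter fun w => s(w, v) ∈ p.A₃ L ∧ w ≠ v ∧
    ∀ z ∈ nb (p.F L) w, p.d ≤ cnt (p.R \ p.X L) (p.A₄ L) z

/-- The neighbours of partners of `v` which still lack edges. -/
noncomputable def lacking (p : Params V) (L : List (Option (Sym2 V))) (v : V) : Finset V := by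
  classical
  exact univ.filter fun z => (∃ w, s(w, v) ∈ p.A₃ L ∧ w ≠ v ∧ z ∈ nb (p.F L) w) ∧
    cnt (p.R \ p.X L) (p.A₄ L) z < p.d

lemma mem_good {v w : V} : w ∈ p.good L v ↔ s(w, v) ∈ p.A₃ L ∧ w ≠ v ∧
    ∀ z ∈ nb (p.F L) w, p.d ≤ cnt (p.R \ p.X L) (p.A₄ L) z := by simp [good]

lemma mem_lacking {v z : V} : z ∈ p.lacking L v ↔
    (∃ w, s(w, v) ∈ p.A₃ L ∧ w ≠ v ∧ z ∈ nb (p.F L) w) ∧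
      cnt (p.R \ p.X L) (p.A₄ L) z < p.d := by simp [lacking]

lemma nbc_of_mem_A₃ (hL : ValidLog p.policy L) {v w : V} (hv : v ∈ p.X L)
    (he : s(v, w) ∈ p.A₃ L) : ∀ y ∈ nbc (p.F L) w, 1 < deg (p.F L) y := by
  obtain ⟨v', hv', w', h, hy⟩ := (A₃_spec hL).2.1 _ he
  rcases Sym2.eq_iff.1 h with ⟨rfl, rfl⟩ | ⟨rfl, rfl⟩
  · exact hy
  · have h1 := hy v (mem_nbc_self _ _)
    have := mem_low.1 (X_subset_low hv)
    omega

lemma A₃_disjoint (hL : ValidLog p.policy L) {v w v' w' : V} (hv : v ∈ p.X L) (hv' : v' ∈ p.X L)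
    (he : s(v, w) ∈ p.A₃ L) (he' : s(v', w') ∈ p.A₃ L)
    (hy : ∃ y ∈ nbc (p.F L) w, y ∈ nbc (p.F L) w') : v = v' ∧ w = w' := by
  have h1 := nbc_of_mem_A₃ hL hv he w (mem_nbc_self _ _)
  have h2 := nbc_of_mem_A₃ hL hv' he' w' (mem_nbc_self _ _)
  have h3 := (A₃_spec hL).2.2 _ he _ he' w (Sym2.mem_mk_right _ _) w' (Sym2.mem_mk_right _ _)
    h1 h2 hy
  rcases Sym2.eq_iff.1 h3 with h | ⟨rfl, rfl⟩
  · exact h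
  · have := mem_low.1 (X_subset_low hv)
    omega

lemma two_le_card_good (hL : ValidLog p.policy L) {v : V} (hv : v ∈ p.X L)
    (hA : p.D + 1 ≤ cnt univ (p.A₃ L) v) (hlack : #(p.lacking L v) < p.D) :
    2 ≤ #(p.good L v) := by
  classical
  set W := univ.filter fun w => s(w, v) ∈ p.A₃ L ∧ w ≠ v with hW
  have hsub : p.good L v ⊆ W := fun w hw => by
    rw [mem_good] at hw
    exact mem_filter.2 ⟨mem_univ _, hw.1, hw.2.1⟩
  have h1 : ∀ w ∈ W \ p.good L v, ∃ z, z ∈ nb (p.F L) w ∧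
      cnt (p.R \ p.X L) (p.A₄ L) z < p.d := by
    intro w hw
    rw [mem_sdiff, mem_good] at hw
    have := mem_filter.1 hw.1
    by_contra! h
    exact hw.2 ⟨this.2.1, this.2.2, h⟩
  choose! f hf using h1
  have h2 : #(W \ p.good L v) ≤ #(p.lacking L v) := by
    refine card_le_card_of_injOn f (fun w hw => ?_) fun w hw w' hw' h => ?_
    · have h3 := (mem_filter.1 (mem_sdiff.1 hw).1).2
      exact mem_lacking.2 ⟨⟨w, h3.1, h3.2, (hf w hw).1⟩, (hf w hw).2⟩
    · have h3 := (mem_filter.1 (mem_sdiff.1 hw).1).2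
      have h4 := (mem_filter.1 (mem_sdiff.1 hw').1).2
      rw [Sym2.eq_swap] at h3 h4
      exact (A₃_disjoint hL hv hv h3.1 h4.1 ⟨f w, mem_insert_of_mem (hf w hw).1,
        mem_insert_of_mem (h ▸ (hf w' hw').1)⟩).2
  have h3 : #W = cnt univ (p.A₃ L) v := rfl
  have h4 := card_sdiff_add_card_eq_card hsub
  omega

/-- If all phases succeed, a suitable set of path edges exists. -/
lemma exists_ready (hL : ValidLog p.policy L) (h₁ : #(p.F L) = p.q)
    (h₃ : ∀ v ∈ p.X L, p.D + 1 ≤ cnt univ (p.A₃ L) v)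
    (h₄ : ∀ v ∈ p.X L, #(p.lacking L v) < p.D) :
    ∃ F' R', Ready p.q p.d (accepted (L.take p.s₄)) F' R' := by
  have e1 := p.h₁₂
  have e2 := p.h₂₃
  have e3 := p.h₃₄
  set A := accepted (L.take p.s₄) with hA
  have hFA : p.F L ⊆ A := by rw [← F_take (e1.trans (e2.trans e3))]; exact seg_subset_accepted
  have hA₂ : p.A₂ L ⊆ A := by rw [← A₂_take (e2.trans e3)]; exact seg_subset_accepted
  have hA₃ : p.A₃ L ⊆ A := by rw [← A₃_take e3]; exact seg_subset_accepted
  have hA₄ : p.A₄ L ⊆ A := by rw [← A₄_take le_rfl]; exact seg_subset_accepted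
  obtain ⟨hlin, -⟩ := linForest_F hL
  have hR : ∀ e ∈ p.F L, ∀ v ∈ e, v ∉ p.R \ p.X L := fun e he v hv h => by
    have := hlin.mem he hv
    rw [mem_compl] at this
    exact this (mem_sdiff.1 h).1
  suffices h : ∃ F' ⊆ A, (∃ l, Complete l ∧ F' ⊆ pairSet l) ∧ #F' = #(p.F L) ∧
      (∀ e ∈ F', ∀ v ∈ e, v ∉ p.R \ p.X L) ∧
      ∀ x, deg F' x ≤ 1 → p.d ≤ cnt (p.R \ p.X L) A x by
    obtain ⟨F', h1, h2, h3, h4, h5⟩ := h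
    exact ⟨F', p.R \ p.X L, h1, h2, h3.trans h₁, h4, h5⟩
  refine exists_repair (F := p.F L) (A := A) (X := p.X L)
    (R := p.R \ p.X L) (g := fun x => p.d ≤ cnt (p.R \ p.X L) A x) (Good := p.good L)
    ?_ ?_ ?_ ?_ ?_ hR ?_ hFA hlin.exists_complete ?_
    fun v hv => two_le_card_good hL hv (h₃ v hv) (h₄ v hv)
  · intro v _ w hw
    rw [Sym2.eq_swap]
    exact hA₃ (mem_good.1 hw).1
  · intro v hv w hw
    exact nbc_of_mem_A₃ hL hv (by rw [Sym2.eq_swap]; exact (mem_good.1 hw).1)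
  · intro v _ w hw z hz
    exact ((mem_good.1 hw).2.2 z hz).trans (cnt_mono (Subset.refl _) hA₄ z)
  · intro v hv w hw v' hv' w' hw' hy
    refine A₃_disjoint hL hv hv' ?_ ?_ hy <;> rw [Sym2.eq_swap]
    exacts [(mem_good.1 hw).1, (mem_good.1 hw').1]
  · exact fun v hv => mem_low.1 (X_subset_low hv)
  · exact fun v hv h => (mem_sdiff.1 h).2 hv
  · intro x hx
    by_cases hxX : x ∈ p.X L
    · exact Or.inl hxX
    · refine Or.inr (le_trans ?_ (cnt_mono (Subset.refl _) hA₂ x))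
      exact (absorbs_core p.R p.d (low (p.F L)) (p.A₂ L)).2 x
        (mem_sdiff.2 ⟨mem_low.2 hx, hxX⟩)

end Params

end Policy

section Logs

variable {α : Type*} [DecidableEq α] {U : List (Option α) → Finset α} {K : ℕ}

lemma logOf_append_exists (h b : List α) (hd : K ∣ h.length) (hK : 0 < K) :
    ∃ L', logOf K U (h ++ b) = logOf K U h ++ L' := by
  obtain ⟨s, hs⟩ := hd
  refine ⟨(logOf K U (h ++ b)).drop s, ?_⟩
  have h1 : (logOf K U (h ++ b)).take s = logOf K U h := by
    rw [logOf, logOf_eq hK hs, runLog_take, runLog_append _ _ _ hs.ge]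
    rw [Nat.le_div_iff_mul_le hK, List.length_append, hs, mul_comm]
    omega
  rw [← h1, List.take_append_drop]

lemma accepted_logOf_subset (h : List α) : accepted (logOf K U h) ⊆ h.toFinset :=
  accepted_runLog_subset _ _

lemma card_accepted_le (s : ℕ) (L : List (Option α)) :
    #(accepted L) ≤ #(accepted (L.take s)) + acceptedSince s L := by
  conv_lhs => rw [← List.take_append_drop s L]
  rw [accepted_append]
  refine (card_union_le _ _).trans (Nat.add_le_add_left ?_ _)
  exact List.toFinset_card_le _

end Logs

section Graphs

variable {V : Type*} [DecidableEq V] [Fintype V]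

lemma HamList.mono {A A' : Finset (Sym2 V)} (h : HamList A) (hA : A ⊆ A') : HamList A' := by
  obtain ⟨l, a, b, h1, h2, h3, h4, h5⟩ := h
  exact ⟨l, a, b, h1, h2.trans hA, h3, h4, hA h5⟩

lemma cnt_insert_le (T : Finset V) (A : Finset (Sym2 V)) (e : Sym2 V) (v : V) :
    cnt T (insert e A) v ≤ cnt T A v + 1 := by
  have : T.filter (fun y => s(y, v) ∈ insert e A ∧ y ≠ v) ⊆
      T.filter (fun y => s(y, v) ∈ A ∧ y ≠ v) ∪ T.filter fun y => s(y, v) = e := by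
    intro y hy
    simp only [mem_filter, mem_union, mem_insert] at hy ⊢
    tauto
  refine (card_le_card this).trans ((card_union_le _ _).trans (Nat.add_le_add_left ?_ _))
  refine card_le_one.2 fun y hy z hz => ?_
  have := (mem_filter.1 hy).2.trans (mem_filter.1 hz).2.symm
  exact Sym2.congr_left.1 this

lemma cnt_insert_of_notMem (T : Finset V) (A : Finset (Sym2 V)) {e : Sym2 V} {v : V} (hv : v ∉ e) :
    cnt T (insert e A) v ≤ cnt T A v := by
  refine card_le_card fun y hy => ?_
  simp only [mem_filter, mem_insert] at hy ⊢
  refine ⟨hy.1, hy.2.1.resolve_left fun h => hv ?_, hy.2.2⟩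
  rw [← h]
  exact Sym2.mem_mk_right _ _

/-- In a graph of maximum degree two, each missing edge accounts for two missing degrees. -/
lemma card_low_add_le {F : Finset (Sym2 V)} (hF : ∀ e ∈ F, ¬ e.IsDiag) (hd : ∀ v, deg F v ≤ 2) :
    #(low F) + 2 * #F ≤ 2 * Fintype.card V := by
  have h1 : ∑ v, deg F v = ∑ e ∈ F, #(univ.filter fun v => v ∈ e) := by
    simp only [deg, card_eq_sum_ones, sum_filter]
    exact sum_comm
  have h2 : ∑ e ∈ F, #(univ.filter fun v => v ∈ e) = 2 * #F := by
    rw [mul_comm, ← smul_eq_mul, ← sum_const]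
    refine sum_congr rfl fun e he => ?_
    have h3 := hF e he
    induction e using Sym2.inductionOn with
    | hf a b =>
      have : (univ.filter fun v => v ∈ s(a, b)) = {a, b} := by ext; simp
      rw [this, card_pair fun h => h3 (Sym2.mk_isDiag_iff.2 h)]
  have h3 : #(low F) = ∑ v : V, if deg F v ≤ 1 then 1 else 0 := by
    rw [low, card_filter]
  rw [← h2, ← h1, h3, ← sum_add_distrib, mul_comm, ← smul_eq_mul]
  refine sum_le_card_nsmul _ _ _ fun v _ => ?_
  have := hd v
  split_ifs <;> omega

lemma card_nbc_le {F : Finset (Sym2 V)} (hd : ∀ v, deg F v ≤ 2) (v : V) : #(nbc F v) ≤ 3 :=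
  (card_insert_le _ _).trans (Nat.succ_le_succ ((card_nb_le _ _).trans (hd v)))

open Classical in
lemma card_not_fresh_le {F A : Finset (Sym2 V)} (hd : ∀ v, deg F v ≤ 2)
    (hA : ∀ e ∈ A, ∃ v w, deg F v ≤ 1 ∧ e = s(v, w)) :
    #(univ.filter fun w => ¬ Fresh F A w) ≤ (#(low F) + #A * 3) * 3 := by
  set B := low F ∪ A.biUnion fun e => univ.filter fun y => ∃ w ∈ e, 1 < deg F w ∧ y ∈ nbc F w
    with hB
  have h1 : (univ.filter fun w => ¬ Fresh F A w) ⊆ B.biUnion (nbc F) := by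
    intro w hw
    have := (mem_filter.1 hw).2
    unfold Fresh at this
    push Not at this
    obtain ⟨y, hy, h⟩ := this
    refine mem_biUnion.2 ⟨y, ?_, mem_nbc_comm.1 hy⟩
    by_cases h1 : 1 < deg F y
    · obtain ⟨e, he, w', hw', h2, h3⟩ := h h1
      exact mem_union_right _ (mem_biUnion.2 ⟨e, he, mem_filter.2 ⟨mem_univ _, w', hw', h2, h3⟩⟩)
    · exact mem_union_left _ (mem_low.2 (by omega))
  refine (card_le_card h1).trans ((card_biUnion_le_card_mul _ _ 3 fun v _ =>
    card_nbc_le hd v).trans (Nat.mul_le_mul_right _ ?_))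
  refine (card_union_le _ _).trans (Nat.add_le_add_left ?_ _)
  refine card_biUnion_le_card_mul _ _ 3 fun e he => ?_
  obtain ⟨v, w, hv, rfl⟩ := hA e he
  refine (card_le_card fun y hy => ?_).trans (card_nbc_le hd w)
  obtain ⟨w', hw', h2, h3⟩ := (mem_filter.1 hy).2
  rcases Sym2.mem_iff.1 hw' with rfl | rfl
  · omega
  · exact h3

lemma Ready.minVirt_le {q d : ℕ} {A F' : Finset (Sym2 V)} {R' : Finset V}
    (h : Ready q d A F' R') : minVirt F' A + q ≤ Fintype.card V - 1 := by
  obtain ⟨hFA, ⟨l, hl, hF⟩, hq, -⟩ := h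
  have h1 := KChoice.minVirt_le (A := A) hl hF
  have h2 := card_pairSet hl.1
  have h3 : l.length = Fintype.card V := by
    rw [← List.toFinset_card_of_nodup hl.1, ← card_univ]
    congr 1
    ext v
    simp [hl.2 v]
  have h4 : #(pairSet l \ A) + #F' ≤ #(pairSet l) := by
    have : #(pairSet l \ A) ≤ #(pairSet l \ F') :=
      card_le_card (sdiff_subset_sdiff (Subset.refl _) hFA)
    have := card_sdiff_add_card_eq_card hF
    omega
  have h5 : virt A l = #(pairSet l \ A) := rfl
  omega

namespace Params

variable {p : Params V} {L : List (Option (Sym2 V))}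

lemma not_isDiag_of_mem_accepted (hL : ValidLog p.policy L) : ∀ e ∈ accepted L, ¬ e.IsDiag := by
  induction hL with
  | nil => simp
  | skip _ ih => simpa using ih
  | accept hL he ih =>
    rw [mem_policy] at he
    intro e' h
    simp only [accepted_append, accepted_some, mem_union, mem_singleton] at h
    rcases h with h | rfl
    exacts [ih _ h, he.2.1]

lemma acceptedSince_zero (hL : ValidLog p.policy L) : acceptedSince 0 L = #(accepted L) := by
  induction hL with
  | nil => rfl
  | skip _ ih => simpa [acceptedSince_none] using ih
  | @accept L e hL he ih =>
    rw [mem_policy] at he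
    rw [acceptedSince_some (Nat.zero_le _), accepted_append, accepted_some,
      card_union_of_disjoint (by simpa using he.2.2), ih, card_singleton]

lemma card_F (hL : ValidLog p.policy L) (h : L.length ≤ p.s₁) : #(p.F L) = acceptedSince 0 L := by
  rw [acceptedSince_zero hL, F, seg_zero, List.take_of_length_le h]

lemma card_low_F_le (hL : ValidLog p.policy L) {r : ℕ} (hq : #(p.F L) + 2 * r = Fintype.card V) :
    #(low (p.F L)) ≤ 4 * r := by
  have := card_low_add_le (F := p.F L)
    (fun e he => not_isDiag_of_mem_accepted hL e (seg_subset_accepted he))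
    (deg_F_le_two hL)
  omega

lemma cnt_A₃_le (hL : ValidLog p.policy L) {v : V} (hv : v ∈ p.X L) :
    cnt univ (p.A₃ L) v ≤ p.D + 1 := by
  have h1 := p.h₁₂
  have := seg_induction (a := p.s₂) (b := p.s₃) (U := p.policy)
    (Q := fun L A => ∀ v ∈ p.X L, cnt univ A v ≤ p.D + 1)
    (fun _ v _ => by simp [cnt]) ?_ hL
  · rw [X_take le_rfl] at this
    exact this v hv
  · intro L e _ ha hb he ih v hv
    rw [X_take le_rfl] at ih hv
    rw [mem_policy, useful_eq_three ha hb] at he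
    obtain ⟨v', hv', w, -, rfl, hc, hw⟩ := mem_coll.1 he.1
    by_cases h : v = v'
    · subst h
      exact (cnt_insert_le _ _ _ _).trans hc
    · refine (cnt_insert_of_notMem _ _ fun h' => ?_).trans (ih v hv)
      rcases Sym2.mem_iff.1 h' with h' | rfl
      · exact h h'
      · have h2 := (hw v (mem_nbc_self _ _)).1
        have := mem_low.1 (X_subset_low hv)
        omega

lemma card_not_fresh_A₃_le (hL : ValidLog p.policy L) {r x : ℕ}
    (hq : #(p.F L) + 2 * r = Fintype.card V) (hx : #(p.X L) ≤ x) (T : Finset V)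
    (hT : ∀ w ∈ T, ¬ Fresh (p.F L) (p.A₃ L) w) : #T ≤ 12 * r + 9 * (x * (p.D + 1)) := by
  classical
  have h1 := card_not_fresh_le (A := p.A₃ L) (deg_F_le_two hL) fun e he => by
    obtain ⟨v, hv, w, rfl, -⟩ := (A₃_spec hL).2.1 e he
    exact ⟨v, w, mem_low.1 (X_subset_low hv), rfl⟩
  have h2 : #T ≤ #(univ.filter fun w => ¬ Fresh (p.F L) (p.A₃ L) w) :=
    card_le_card fun w hw => mem_filter.2 ⟨mem_univ _, hT w hw⟩
  have h3 := card_low_F_le hL hq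
  have h4 := (A₃_spec hL).1.trans (Nat.mul_le_mul_right (p.D + 1) hx)
  omega

lemma acceptedSince_le_minVirt (hL : ValidLog p.policy L) (h : p.s₄ ≤ L.length) :
    acceptedSince p.s₄ L ≤ minVirt (p.F' L) (accepted (L.take p.s₄)) + 1 ∧
    (¬ HamList (accepted L) → minVirt (p.F' L) (accepted L) + acceptedSince p.s₄ L ≤
      minVirt (p.F' L) (accepted (L.take p.s₄))) := by
  have base : ∀ L : List (Option (Sym2 V)), L.length = p.s₄ →
      acceptedSince p.s₄ L ≤ minVirt (p.F' L) (accepted (L.take p.s₄)) + 1 ∧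
      (¬ HamList (accepted L) → minVirt (p.F' L) (accepted L) + acceptedSince p.s₄ L ≤
        minVirt (p.F' L) (accepted (L.take p.s₄))) := by
    intro L h
    have h0 : acceptedSince p.s₄ L = 0 := by
      have := acceptedSince_le p.s₄ L
      rw [h, max_self] at this
      omega
    rw [h0, List.take_of_length_le h.le]
    exact ⟨Nat.zero_le _, fun _ => le_rfl⟩
  have hF' : ∀ (L : List (Option (Sym2 V))) o, p.s₄ ≤ L.length → p.F' (L ++ [o]) = p.F' L := by
    intro L o h
    rw [F', F', List.take_append_of_le_length h]
  induction hL with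
  | nil => exact base _ ((h.antisymm (Nat.zero_le _)).symm)
  | @skip L hL ih =>
    rcases h.eq_or_lt with h' | h'
    · exact base _ h'.symm
    · have h2 : p.s₄ ≤ L.length := by simpa using h'
      rw [hF' _ _ h2, acceptedSince_none h2, List.take_append_of_le_length h2, accepted_append,
        accepted_none, union_empty]
      exact ih h2
  | @accept L e hL he ih =>
    rcases h.eq_or_lt with h' | h'
    · exact base _ h'.symm
    · have h2 : p.s₄ ≤ L.length := by simpa using h'
      have h3 : accepted (L ++ [some e]) = insert e (accepted L) := by
        rw [accepted_append, accepted_some, union_comm, insert_eq]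
      rw [hF' _ _ h2, acceptedSince_some h2, List.take_append_of_le_length h2, h3]
      rw [mem_policy] at he
      have hH : ¬ HamList (accepted L) := fun hH => by
        rw [useful_eq_empty_of_hamList h2 hH] at he
        simp at he
      rw [useful_eq_five h2 hH] at he
      have h4 := (ih h2).2 hH
      refine ⟨by omega, fun h5 => ?_⟩
      have := he.1.resolve_left h5
      omega

lemma card_accepted_le_budget (hL : ValidLog p.policy L) {r x : ℕ}
    (hq : #(p.F L) + 2 * r = Fintype.card V) (hx : #(p.X L) ≤ x) :
    #(accepted (L.take p.s₄)) ≤ #(p.F L) + 8 * r * p.d + x * (p.D + 1) +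
      2 * (x * (p.D + 1)) * p.d := by
  rw [accepted_take_union_seg p.h₃₄, accepted_take_union_seg p.h₂₃, accepted_take_union_seg p.h₁₂]
  have h1 : #(accepted (L.take p.s₁)) = #(p.F L) := rfl
  have h2 : #(seg p.s₁ p.s₂ L) ≤ 4 * r * (2 * p.d) :=
    (card_A₂_le hL).trans (Nat.mul_le_mul_right _ (card_low_F_le hL hq))
  have h3 : #(seg p.s₂ p.s₃ L) ≤ x * (p.D + 1) :=
    (A₃_spec hL).1.trans (Nat.mul_le_mul_right (p.D + 1) hx)
  have h4 : #(seg p.s₃ p.s₄ L) ≤ 2 * (x * (p.D + 1)) * p.d :=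
    (card_A₄_le hL).trans (Nat.mul_le_mul_right _ ((card_hub_le hL).trans
      (Nat.mul_le_mul_left _ h3)))
  refine (card_union_le _ _).trans (Nat.add_le_add ((card_union_le _ _).trans
    (Nat.add_le_add ((card_union_le _ _).trans (Nat.add_le_add h1.le ?_)) h3)) h4)
  refine h2.trans (le_of_eq ?_)
  ring

lemma policy_subset_edges {n : ℕ} (p : Params (Fin n)) (L : List (Option (Sym2 (Fin n)))) :
    p.policy L ⊆ edges n := fun _ he => mem_edges.2 (mem_policy.1 he).2.1

end Params

end Graphs

section Cond

variable {n : ℕ}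

/-- The revealed edges are sparse, and the log satisfies `Q` once `t₀` rounds are over. -/
def Cond (K Δ m κ : ℕ) (U : List (Option (Sym2 (Fin n))) → Finset (Sym2 (Fin n))) (t₀ : ℕ)
    (Q : List (Option (Sym2 (Fin n))) → Prop) (h : List (Sym2 (Fin n))) : Prop :=
  Sparse Δ m κ h.toFinset ∧ (K * t₀ ≤ h.length → Q (logOf K U h))

variable {K Δ m κ : ℕ} {p : Params (Fin n)} {Q : List (Option (Sym2 (Fin n))) → Prop} {t₀ t₁ : ℕ}

lemma Cond.left (hK : 0 < K)
    (hQ : ∀ L L', t₀ ≤ L.length → Q (L ++ L') → Q L) (h b : List (Sym2 (Fin n)))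
    (hc : Cond K Δ m κ p.policy t₀ Q (h ++ b)) (hd : K ∣ h.length) :
    Cond K Δ m κ p.policy t₀ Q h := by
  refine ⟨hc.1.mono (by rw [List.toFinset_append]; exact subset_union_left), fun hl => ?_⟩
  obtain ⟨L', hL'⟩ := logOf_append_exists (K := K) (U := p.policy) h b hd hK
  obtain ⟨s, hs⟩ := hd
  refine hQ _ L' ?_ ?_
  · rw [length_logOf hK hs]
    rw [hs] at hl
    exact Nat.le_of_mul_le_mul_left hl hK
  · rw [← hL']
    exact hc.2 (hl.trans (by simp))

open Classical in
/-- A version of `Ex_collect_le` for whole runs of the strategy. -/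
lemma Ex_cond_le_exp (hK : 0 < K) {c : List (Option (Sym2 (Fin n))) → ℝ} {cap θ ζ u : ℝ}
    (hθ : 0 ≤ θ) (hζ : 0 ≤ ζ) (hζu : ζ ≤ u) (ht : t₀ ≤ t₁) (hN : K * t₁ ≤ #(edges n))
    (hc : ∀ L, 0 ≤ c L) (hQ : ∀ L L', t₀ ≤ L.length → Q (L ++ L') → Q L)
    (hmono : ∀ L o, t₀ ≤ L.length → c L ≤ c (L ++ [o]))
    (hstep : ∀ L (H : Finset (Sym2 (Fin n))), ValidLog p.policy L → t₀ ≤ L.length →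
      L.length < t₁ → Q L → Sparse Δ m κ H → (#(p.useful L) : ℝ) ≤ u ∧
        ∃ Z : Finset (Sym2 (Fin n)), ζ ≤ #(Z \ H) ∧
          ∀ e ∈ Z, e ∈ p.useful L ∧ ¬ e.IsDiag ∧ (e ∉ accepted L → c L + 1 ≤ c (L ++ [some e])))
    (hcap : ∀ L, ValidLog p.policy L → L.length = t₁ → Q L → c L ≤ cap) :
    Ex (edges n) (K * t₁) (fun l => if Cond K Δ m κ p.policy t₀ Q l then 1 else 0) [] ≤
      Real.exp (θ * cap - (1 - Real.exp (-θ)) * (K * ζ / (#(edges n) + K * u)) * (t₁ - t₀)) := by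
  have hsum : K * t₁ = K * t₀ + K * (t₁ - t₀) := by rw [← Nat.mul_add]; congr 1; omega
  rw [hsum]
  refine Ex_le_of_forall_prefix _ _ (le_trans (by omega) hN) fun h hh hl => ?_
  refine (Ex_collect_le hK hθ hζ hζu hN (U := p.policy) (c := c) (cap := cap)
    (fun h b _ hP hd => Cond.left hK hQ h b hP hd) ?_ ?_ (t₁ - t₀) h t₀ hh hl le_rfl
    (by omega)).trans ?_
  · intro h s hh hl hs hs1 hP
    have hlen := length_logOf (U := p.policy) hK hl
    have hv := validLog_logOf (K := K) (U := p.policy) h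
    obtain ⟨h1, Z, h2, h3⟩ := hstep (logOf K p.policy h) h.toFinset hv (by omega) (by omega)
      (hP.2 (by rw [hl]; exact Nat.mul_le_mul_left _ hs)) hP.1
    have hacc : ∀ e ∈ Z \ h.toFinset, e ∉ accepted (logOf K p.policy h) := fun e he h' =>
      (mem_sdiff.1 he).2 (accepted_logOf_subset h h')
    refine ⟨Z \ h.toFinset, fun e he => ?_, p.policy_subset_edges _, ?_, ?_, fun e he => ?_,
      fun e _ => hmono _ _ (by omega), hmono _ _ (by omega)⟩
    · have := h3 e (mem_sdiff.1 he).1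
      exact Params.mem_policy.2 ⟨this.1, this.2.1, hacc e he⟩
    · rwa [Finset.sdiff_idem]
    · refine le_trans ?_ h1
      exact_mod_cast card_le_card fun e he => (Params.mem_policy.1 (mem_sdiff.1 he).1).1
    · exact (h3 e (mem_sdiff.1 he).1).2.2 (hacc e he)
  · intro h hh hl hP
    exact hcap _ (validLog_logOf h) (length_logOf hK hl)
      (hP.2 (by rw [hl]; exact Nat.mul_le_mul_left _ ht))
  · rw [sub_eq_add_neg (θ * cap), Real.exp_add]
    have h1 := one_sub_exp_mul_nonneg (K := K) (N := #(edges n)) hθ hζ hζu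
    have hc' := hc (logOf K p.policy h)
    refine mul_le_mul (Real.exp_le_exp.2 (mul_le_mul_of_nonneg_left (by linarith) hθ)) ?_
      (pow_nonneg h1 _) (Real.exp_pos _).le
    refine (pow_le_pow_left₀ h1 (Real.one_sub_le_exp_neg _) _).trans (le_of_eq ?_)
    rw [← Real.exp_nat_mul, Nat.cast_sub ht]
    congr 1
    ring

open Classical in
/-- A version of `Ex_progress_le` for whole runs of the strategy. -/
lemma Ex_cond_le_div (hK : 0 < K) {J : ℕ} {z : ℕ → ℝ} (hJ : t₀ + J < t₁)
    (hN : K * t₁ ≤ #(edges n)) (hz : ∀ i < J, 0 < z i)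
    (hQ : ∀ L L', t₀ ≤ L.length → Q (L ++ L') → Q L)
    (hstep : ∀ L (H : Finset (Sym2 (Fin n))), ValidLog p.policy L → t₀ ≤ L.length →
      L.length < t₁ → Q L → Sparse Δ m κ H → accepted L ⊆ H → #H ≤ K * t₁ →
        acceptedSince t₀ L < J ∧ ∃ Z : Finset (Sym2 (Fin n)),
          z (acceptedSince t₀ L) ≤ #(Z \ H) ∧ ∀ e ∈ Z \ H, e ∈ p.useful L ∧ ¬ e.IsDiag)
    (hend : ∀ L, ValidLog p.policy L → L.length = t₁ → Q L → acceptedSince t₀ L ≤ J) :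
    Ex (edges n) (K * t₁) (fun l => if Cond K Δ m κ p.policy t₀ Q l then 1 else 0) [] ≤
      (∑ i ∈ range J, #(edges n) / (K * z i)) / (t₁ - t₀ - J) := by
  have hsum : K * t₁ = K * t₀ + K * (t₁ - t₀) := by rw [← Nat.mul_add]; congr 1; omega
  have ht : t₀ ≤ t₁ := by omega
  rw [hsum]
  refine Ex_le_of_forall_prefix _ _ (le_trans (by omega) hN) fun h hh hl => ?_
  refine (Ex_progress_le hK hJ hN (U := p.policy) (z := z)
    (fun h b _ hP hd => Cond.left hK hQ h b hP hd) hz ?_ ?_ (t₁ - t₀) h t₀ hh hl le_rfl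
    (by omega)).trans ?_
  · intro h s hh hl hs hs1 hP
    have hlen := length_logOf (U := p.policy) hK hl
    obtain ⟨h1, Z, h2, h3⟩ := hstep (logOf K p.policy h) h.toFinset (validLog_logOf h) (by omega)
      (by omega) (hP.2 (by rw [hl]; exact Nat.mul_le_mul_left _ hs)) hP.1 (accepted_logOf_subset h)
      (by rw [hh.card, hl]; exact Nat.mul_le_mul_left _ hs1.le)
    refine ⟨h1, p.policy_subset_edges _, h2.trans ?_⟩
    refine Nat.cast_le.2 (card_le_card fun e he => ?_)
    have h4 := h3 e he
    rw [mem_sdiff] at he ⊢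
    exact ⟨Params.mem_policy.2 ⟨h4.1, h4.2, fun h' => he.2 (accepted_logOf_subset h h')⟩, he.2⟩
  · intro h hh hl hP
    exact hend _ (validLog_logOf h) (length_logOf hK hl)
      (hP.2 (by rw [hl]; exact Nat.mul_le_mul_left _ ht))
  · have hD : (0 : ℝ) < t₁ - t₀ - J := by
      have : ((t₀ + J : ℕ) : ℝ) < t₁ := by exact_mod_cast hJ
      push_cast at this; linarith
    refine div_le_div_of_nonneg_right ?_ hD.le
    have h1 : ∑ i ∈ Ico (acceptedSince t₀ (logOf K p.policy h)) J, (#(edges n) : ℝ) / (K * z i) ≤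
        ∑ i ∈ range J, #(edges n) / (K * z i) := by
      refine sum_le_sum_of_subset_of_nonneg (fun i hi => mem_range.2 (mem_Ico.1 hi).2) ?_
      intro i hi _
      have := hz i (mem_range.1 hi)
      positivity
    have h2 : (0 : ℝ) ≤ acceptedSince t₀ (logOf K p.policy h) := Nat.cast_nonneg _
    linarith

end Cond

namespace Params

section Append

variable {V : Type*} [DecidableEq V] [Fintype V] {p : Params V} {L : List (Option (Sym2 V))}
  (L' : List (Option (Sym2 V)))

lemma F_append (h : p.s₁ ≤ L.length) : p.F (L ++ L') = p.F L := seg_append_of_le h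

lemma A₃_append (h : p.s₃ ≤ L.length) : p.A₃ (L ++ L') = p.A₃ L := seg_append_of_le h

lemma X_append (h : p.s₂ ≤ L.length) : p.X (L ++ L') = p.X L := by
  rw [X, X, F_append L' (p.h₁₂.trans h), A₂, A₂, seg_append_of_le h]

end Append

section Phases

open Classical

variable {n K Δ m κ r : ℕ} {p : Params (Fin n)}

/-- The first phase produces all the required path edges. -/
lemma Ex_paths_fail_le (hK : 0 < K) (hN : K * p.s₁ ≤ #(edges n)) (hR : #p.R = r)
    (hq : p.q + 2 * r = n) (hs : p.q < p.s₁) (hr : 2 ≤ r)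
    (hM : 4 * (K * p.s₁) + 2 * r ≤ r ^ 2) :
    Ex (edges n) (K * p.s₁) (fun l => if Cond K Δ m κ p.policy 0
      (fun L => #(p.F L) < p.q) l then 1 else 0) [] ≤
      4 * #(edges n) / (K * r * (p.s₁ - p.q)) := by
  have hw : #p.Rᶜ = p.q + r := by
    rw [card_compl, Fintype.card_fin, hR]; omega
  refine (Ex_cond_le_div (J := p.q) (z := fun i => ((p.q + r - i : ℕ) : ℝ) ^ 2 / 4) hK
    (by simpa using hs) hN (fun i hi => ?_) ?_ ?_ ?_).trans ?_
  · have : 0 < p.q + r - i := by omega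
    positivity
  · intro L L' _ h
    exact (card_le_card seg_subset_append).trans_lt h
  · intro L H hL _ hs₁ hF _ hacc hH
    have hF' := card_F hL hs₁.le
    have hlin := (linForest_F hL).1
    obtain ⟨J, hJ, hJe⟩ := hlin.exists_extensions
    refine ⟨by omega, J, ?_, fun e he => ?_⟩
    · rw [← hF']
      have h1 : #J ≤ #(J \ H) + #H := by
        have := card_le_card (subset_union_left (s₁ := J) (s₂ := H))
        rw [← sdiff_union_self_eq_union] at this
        exact this.trans (card_union_le _ _)
      rw [hw] at hJ
      obtain ⟨s, hs⟩ : ∃ s, p.q + r - #(p.F L) = r + s :=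
        ⟨p.q - #(p.F L), by omega⟩
      rw [hs] at hJ ⊢
      have h2 : (r + s) ^ 2 ≤ 4 * #(J \ H) := by
        obtain ⟨r', rfl⟩ : ∃ r', r = r' + 2 := ⟨r - 2, by omega⟩
        have : r' + 2 + s - 1 = r' + 1 + s := by omega
        rw [this] at hJ
        nlinarith
      rw [div_le_iff₀ (by norm_num)]
      have : (((r + s) ^ 2 : ℕ) : ℝ) ≤ ((4 * #(J \ H) : ℕ) : ℝ) := by exact_mod_cast h2
      push_cast at this ⊢
      linarith
    · have := hJe e (mem_sdiff.1 he).1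
      exact ⟨(useful_eq_one hs₁ hF).2 this.2.2.2, this.1⟩
  · intro L hL hl hF
    have := card_F hL hl.le
    omega
  · have hD : (0 : ℝ) < p.s₁ - p.q := by
      have : (p.q : ℝ) < p.s₁ := by exact_mod_cast hs
      linarith
    have hr0 : (0 : ℝ) < r := by exact_mod_cast (by omega : 0 < r)
    have hK0 : (0 : ℝ) < K := by exact_mod_cast hK
    have key : ∀ q : ℕ, ∑ i ∈ range q, (1 : ℝ) / ((q + r - i : ℕ) : ℝ) ^ 2 ≤
        1 / r - 1 / ((q + r : ℕ) : ℝ) := by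
      intro q
      induction q with
      | zero => simp
      | succ q ih =>
        rw [sum_range_succ']
        have h1 : ∀ i, q + 1 + r - (i + 1) = q + r - i := fun i => by omega
        simp only [h1]
        refine (add_le_add_left ih _).trans ?_
        have h2 : (0 : ℝ) < ((q + r : ℕ) : ℝ) := by exact_mod_cast (by omega : 0 < q + r)
        have h3 : ((q + 1 + r - 0 : ℕ) : ℝ) = ((q + r : ℕ) : ℝ) + 1 := by
          rw [Nat.sub_zero]; push_cast; ring
        have h4 : ((q + 1 + r : ℕ) : ℝ) = ((q + r : ℕ) : ℝ) + 1 := by push_cast; ring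
        rw [h3, h4]
        set a := ((q + r : ℕ) : ℝ)
        have : 1 / (a + 1) ^ 2 ≤ 1 / a - 1 / (a + 1) := by
          rw [div_sub_div _ _ h2.ne' (by positivity),
            div_le_div_iff₀ (by positivity) (by positivity)]
          nlinarith
        linarith
    have h5 : ∑ i ∈ range p.q, (#(edges n) : ℝ) / (K * (((p.q + r - i : ℕ) : ℝ) ^ 2 / 4)) =
        4 * #(edges n) / K * ∑ i ∈ range p.q, (1 : ℝ) / ((p.q + r - i : ℕ) : ℝ) ^ 2 := by
      rw [mul_sum]
      refine sum_congr rfl fun i hi => ?_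
      have : 0 < p.q + r - i := by have := mem_range.1 hi; omega
      have : (0 : ℝ) < ((p.q + r - i : ℕ) : ℝ) := by exact_mod_cast this
      field_simp
    rw [h5, Nat.cast_zero, sub_zero, div_le_iff₀ hD]
    have h6 : 4 * (#(edges n) : ℝ) / (K * r * (p.s₁ - p.q)) * (p.s₁ - p.q) =
        4 * #(edges n) / K * (1 / r) := by field_simp
    rw [h6]
    refine mul_le_mul_of_nonneg_left ((key p.q).trans ?_) (by positivity)
    have : (0 : ℝ) ≤ 1 / ((p.q + r : ℕ) : ℝ) := by positivity
    linarith

/-- A path end obtains many edges to the reserved set in the second phase. -/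
lemma Ex_reserve_fail_le (hK : 0 < K) (hN : K * p.s₂ ≤ #(edges n)) (hR : #p.R = r)
    (hq : p.q + 2 * r = n) {θ : ℝ} (hθ : 0 ≤ θ) (hΔ : Δ + 1 ≤ r) (v : Fin n) :
    Ex (edges n) (K * p.s₂) (fun l => if Cond K Δ m κ p.policy p.s₁
      (fun L => #(p.F L) = p.q ∧ v ∈ low (p.F L) ∧ cnt p.R (p.A₂ L) v < 2 * p.d) l then 1 else 0)
        [] ≤
      Real.exp (θ * (2 * p.d) - (1 - Real.exp (-θ)) *
        (K * (r - 1 - Δ) / (#(edges n) + K * (4 * r * r))) * (p.s₂ - p.s₁)) := by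
  have hΔ' : (Δ : ℝ) + 1 ≤ r := by exact_mod_cast hΔ
  have hr : (1 : ℝ) ≤ r := by
    have : (0 : ℝ) ≤ Δ := Nat.cast_nonneg _
    linarith
  refine Ex_cond_le_exp hK (c := fun L => (cnt p.R (p.A₂ L) v : ℝ)) hθ (by linarith)
    (by have : (0 : ℝ) ≤ Δ := Nat.cast_nonneg _
        nlinarith) p.h₁₂ hN (fun _ => Nat.cast_nonneg _) ?_ ?_ ?_ ?_
  · intro L L' hl ⟨h1, h2, h3⟩
    rw [F_append L' hl] at h1 h2
    exact ⟨h1, h2, (cnt_mono (Subset.refl _) seg_subset_append v).trans_lt h3⟩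
  · exact fun L o _ => Nat.cast_le.2 (cnt_mono (Subset.refl _) seg_subset_append v)
  · intro L H hL ha hb ⟨h1, h2, h3⟩ hH
    rw [useful_eq_two ha hb]
    constructor
    · have h4 := card_coll_le (low (p.F L)) p.R (2 * p.d) (fun _ => True) (p.A₂ L)
      have h5 := card_low_F_le hL (r := r) (by rw [h1, hq, Fintype.card_fin])
      rw [hR] at h4
      exact_mod_cast h4.trans (Nat.mul_le_mul_right r h5)
    · refine ⟨(p.R.erase v).image fun y => s(v, y), ?_, fun e he => ?_⟩
      · have := card_star_sdiff (hH.degree_le v) p.R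
        rw [hR] at this
        have : (r : ℝ) ≤ ((#(((p.R.erase v).image fun y => s(v, y)) \ H) + 1 + Δ : ℕ) : ℝ) := by
          exact_mod_cast this
        push_cast at this
        linarith
      · obtain ⟨y, hy, rfl⟩ := mem_image.1 he
        rw [mem_erase] at hy
        refine ⟨mem_coll.2 ⟨v, h2, y, hy.2, rfl, h3, trivial⟩,
          fun h => hy.1 (Sym2.mk_isDiag_iff.1 h).symm, fun h => ?_⟩
        have h4 : p.A₂ (L ++ [some s(v, y)]) = insert s(v, y) (p.A₂ L) := seg_append_some _ ha hb
        rw [h4]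
        exact_mod_cast cnt_lt_cnt_insert hy.2 (fun h' => h (seg_subset_accepted h')) hy.1
  · intro L _ _ ⟨_, _, h⟩
    exact_mod_cast h.le

/-- An exceptional vertex obtains many partners in the third phase. -/
lemma Ex_partners_fail_le (hK : 0 < K) (hN : K * p.s₃ ≤ #(edges n))
    (hq : p.q + 2 * r = n) {θ : ℝ} (hθ : 0 ≤ θ) {x : ℕ} (hx : 1 ≤ x)
    (hΔ : 12 * r + 9 * (x * (p.D + 1)) + 1 + Δ ≤ n) (v : Fin n) :
    Ex (edges n) (K * p.s₃) (fun l => if Cond K Δ m κ p.policy p.s₂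
      (fun L => #(p.F L) = p.q ∧ #(p.X L) ≤ x ∧ v ∈ p.X L ∧ cnt univ (p.A₃ L) v < p.D + 1) l
        then 1 else 0) [] ≤
      Real.exp (θ * (p.D + 1) - (1 - Real.exp (-θ)) *
        (K * (n - (12 * r + 9 * (x * (p.D + 1)) + 1 + Δ)) / (#(edges n) + K * (x * n))) *
          (p.s₃ - p.s₂)) := by
  have hΔ' : 12 * (r : ℝ) + 9 * (x * (p.D + 1)) + 1 + Δ ≤ n := by exact_mod_cast hΔ
  have hx' : (1 : ℝ) ≤ x := by exact_mod_cast hx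
  refine Ex_cond_le_exp hK (c := fun L => (cnt univ (p.A₃ L) v : ℝ)) hθ (by linarith)
    ?_ p.h₂₃ hN (fun _ => Nat.cast_nonneg _) ?_ ?_ ?_ ?_
  · have h1 : (0 : ℝ) ≤ 12 * (r : ℝ) + 9 * (x * (p.D + 1)) + 1 + Δ := by positivity
    have h2 : (1 : ℝ) * n ≤ x * n := mul_le_mul_of_nonneg_right hx' (Nat.cast_nonneg _)
    linarith
  · intro L L' hl ⟨h1, h2, h3, h4⟩
    rw [F_append L' (p.h₁₂.trans hl)] at h1
    rw [X_append L' hl] at h2 h3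
    exact ⟨h1, h2, h3, (cnt_mono (Subset.refl _) seg_subset_append v).trans_lt h4⟩
  · exact fun L o _ => Nat.cast_le.2 (cnt_mono (Subset.refl _) seg_subset_append v)
  · intro L H hL ha hb ⟨h1, h2, h3, h4⟩ hH
    rw [useful_eq_three ha hb]
    constructor
    · have h5 := card_coll_le (p.X L) univ (p.D + 1) (Fresh (p.F L) (p.A₃ L)) (p.A₃ L)
      rw [card_univ, Fintype.card_fin] at h5
      exact_mod_cast h5.trans (Nat.mul_le_mul_right n h2)
    · set T := univ.filter (Fresh (p.F L) (p.A₃ L)) with hT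
      refine ⟨(T.erase v).image fun y => s(v, y), ?_, fun e he => ?_⟩
      · have h5 := card_star_sdiff (hH.degree_le v) T
        have h6 := card_not_fresh_A₃_le hL (r := r) (by rw [h1, hq, Fintype.card_fin]) h2 Tᶜ
          fun w hw => by simpa [hT] using hw
        rw [card_compl, Fintype.card_fin] at h6
        have : n ≤ #(((T.erase v).image fun y => s(v, y)) \ H) +
            (12 * r + 9 * (x * (p.D + 1)) + 1 + Δ) := by omega
        have : (n : ℝ) ≤ ((#(((T.erase v).image fun y => s(v, y)) \ H) +
            (12 * r + 9 * (x * (p.D + 1)) + 1 + Δ) : ℕ) : ℝ) := by exact_mod_cast this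
        push_cast at this
        linarith
      · obtain ⟨y, hy, rfl⟩ := mem_image.1 he
        rw [mem_erase, hT, mem_filter] at hy
        refine ⟨mem_coll.2 ⟨v, h3, y, mem_univ _, rfl, h4, hy.2.2⟩,
          fun h => hy.1 (Sym2.mk_isDiag_iff.1 h).symm, fun h => ?_⟩
        have h5 : p.A₃ (L ++ [some s(v, y)]) = insert s(v, y) (p.A₃ L) := seg_append_some _ ha hb
        rw [h5]
        exact_mod_cast cnt_lt_cnt_insert (mem_univ y) (fun h' => h (seg_subset_accepted h')) hy.1
  · intro L _ _ ⟨_, _, _, h⟩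
    exact_mod_cast h.le

/-- The neighbours of partners of `v`. -/
noncomputable def around (p : Params (Fin n)) (L : List (Option (Sym2 (Fin n)))) (v : Fin n) :
    Finset (Fin n) :=
  (univ.filter fun w => s(w, v) ∈ p.A₃ L ∧ w ≠ v).biUnion (nb (p.F L))

lemma mem_around {L : List (Option (Sym2 (Fin n)))} {v z : Fin n} :
    z ∈ p.around L v ↔ ∃ w, s(w, v) ∈ p.A₃ L ∧ w ≠ v ∧ z ∈ nb (p.F L) w := by
  simp [around, and_assoc]

lemma card_around_le {L : List (Option (Sym2 (Fin n)))} (hL : ValidLog p.policy L) {v : Fin n}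
    (hv : v ∈ p.X L) : #(p.around L v) ≤ (p.D + 1) * 2 := by
  refine (card_biUnion_le_card_mul _ _ 2 fun w _ =>
    (card_nb_le _ _).trans (deg_F_le_two hL w)).trans (Nat.mul_le_mul_right _ ?_)
  exact cnt_A₃_le hL hv

/-- The neighbours of most partners of an exceptional vertex obtain many edges to the reserved set
in the fourth phase. -/
lemma Ex_repair_fail_le (hK : 0 < K) (hN : K * p.s₄ ≤ #(edges n)) (hR : #p.R = r)
    {θ : ℝ} (hθ : 0 ≤ θ) {x : ℕ} (hΔ : x + Δ ≤ r) (hx : 1 ≤ x) (v : Fin n) :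
    Ex (edges n) (K * p.s₄) (fun l => if Cond K Δ m κ p.policy p.s₃
      (fun L => #(p.X L) ≤ x ∧ v ∈ p.X L ∧ p.D ≤ #(p.lacking L v)) l
        then 1 else 0) [] ≤
      Real.exp (θ * (2 * (p.D + 1) * p.d) - (1 - Real.exp (-θ)) *
        (K * (p.D * (r - x - Δ)) / (#(edges n) + K * (2 * (x * (p.D + 1)) * r))) *
          (p.s₄ - p.s₃)) := by
  have hΔ' : (x : ℝ) + Δ ≤ r := by exact_mod_cast hΔ
  have hx' : (1 : ℝ) ≤ x := by exact_mod_cast hx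
  have h23 := p.h₂₃
  have hdef : ∀ L o, p.s₃ ≤ L.length → p.around (L ++ [o]) v = p.around L v ∧
      p.X (L ++ [o]) = p.X L := by
    intro L o h
    rw [around, around, F_append _ (p.h₁₂.trans (p.h₂₃.trans h)), A₃_append _ h,
      X_append _ (p.h₂₃.trans h)]
    exact ⟨rfl, rfl⟩
  refine Ex_cond_le_exp hK (c := fun L => ((∑ z ∈ p.around L v,
    min (cnt (p.R \ p.X L) (p.A₄ L) z) p.d : ℕ) : ℝ)) hθ
    (mul_nonneg (Nat.cast_nonneg _) (by linarith))
    ?_ p.h₃₄ hN (fun _ => Nat.cast_nonneg _) ?_ ?_ ?_ ?_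
  · have hD : (0 : ℝ) ≤ p.D := Nat.cast_nonneg _
    have h1 : (0 : ℝ) ≤ Δ := Nat.cast_nonneg _
    calc (p.D : ℝ) * (r - x - Δ) ≤ (p.D + 1) * r := by
          refine mul_le_mul ?_ ?_ ?_ ?_ <;> linarith
      _ = 1 * ((p.D + 1) * r) := by ring
      _ ≤ (2 * x) * ((p.D + 1) * r) := by
          refine mul_le_mul_of_nonneg_right (by linarith) (by positivity)
      _ = _ := by ring
  · intro L L' hl ⟨h1, h2, h3⟩
    rw [X_append L' (p.h₂₃.trans hl)] at h1 h2
    refine ⟨h1, h2, h3.trans (card_le_card fun z hz => ?_)⟩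
    rw [mem_lacking] at hz ⊢
    rw [F_append L' (p.h₁₂.trans (p.h₂₃.trans hl)), A₃_append L' hl,
      X_append L' (p.h₂₃.trans hl)] at hz
    exact ⟨hz.1, (cnt_mono (Subset.refl _) seg_subset_append z).trans_lt hz.2⟩
  · intro L o hl
    simp only [(hdef L o hl).1, (hdef L o hl).2]
    refine Nat.cast_le.2 (sum_le_sum fun z _ => ?_)
    exact min_le_min_right _ (cnt_mono (Subset.refl _) seg_subset_append z)
  · intro L H hL ha hb ⟨h2, h3, h4⟩ hH
    have hXR : #p.R ≤ #(p.R \ p.X L) + x := by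
      have := card_le_card (subset_union_left (s₁ := p.R) (s₂ := p.X L))
      rw [← sdiff_union_self_eq_union] at this
      exact this.trans ((card_union_le _ _).trans (Nat.add_le_add_left h2 _))
    rw [useful_eq_four ha hb]
    constructor
    · have h5 := card_coll_le (hub (p.F L) (p.A₃ L)) (p.R \ p.X L) p.d (fun _ => True) (p.A₄ L)
      have h6 := (card_hub_le hL).trans (Nat.mul_le_mul_left 2
        ((A₃_spec hL).1.trans (Nat.mul_le_mul_right _ h2)))
      have h7 : #(p.R \ p.X L) ≤ r := hR ▸ card_le_card sdiff_subset
      exact_mod_cast h5.trans (Nat.mul_le_mul h6 h7)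
    · have hnot : ∀ z ∈ p.lacking L v, z ∉ p.R \ p.X L := by
        intro z hz hz'
        obtain ⟨⟨w, -, -, hw⟩, -⟩ := mem_lacking.1 hz
        have := (linForest_F hL).1.mem (mem_nb.1 hw) (Sym2.mem_mk_right _ _)
        exact (mem_compl.1 this) (mem_sdiff.1 hz').1
      refine ⟨(p.lacking L v ×ˢ (p.R \ p.X L)).image fun y => s(y.1, y.2), ?_, fun e he => ?_⟩
      · have h5 := card_bipartite_sdiff hH.degree_le (p.lacking L v) (p.R \ p.X L) hnot
        set a := #(((p.lacking L v ×ˢ (p.R \ p.X L)).image fun y => s(y.1, y.2)) \ H)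
        set b := #(p.lacking L v)
        have h6 : ((b * #(p.R \ p.X L) : ℕ) : ℝ) ≤ ((a + b * Δ : ℕ) : ℝ) := by exact_mod_cast h5
        have h7 : (r : ℝ) ≤ ((#(p.R \ p.X L) + x : ℕ) : ℝ) := by rw [hR] at hXR; exact_mod_cast hXR
        have h8 : (p.D : ℝ) ≤ b := by exact_mod_cast h4
        push_cast at h6 h7
        have h9 : (b : ℝ) * (r - x - Δ) ≤ b * (#(p.R \ p.X L) - Δ) :=
          mul_le_mul_of_nonneg_left (by linarith) (Nat.cast_nonneg _)
        have h10 : (p.D : ℝ) * (r - x - Δ) ≤ b * (r - x - Δ) :=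
          mul_le_mul_of_nonneg_right h8 (by linarith)
        linarith
      · obtain ⟨⟨z, y⟩, hy, rfl⟩ := mem_image.1 he
        rw [mem_product] at hy
        obtain ⟨hz, hy⟩ := hy
        simp only at hz hy ⊢
        have hne : y ≠ z := fun h => hnot z hz (h ▸ hy)
        obtain ⟨⟨w, hw, hwv, hzw⟩, hcz⟩ := mem_lacking.1 hz
        refine ⟨mem_coll.2 ⟨z, mem_hub.2 ⟨_, hw, w, Sym2.mem_mk_left _ _, ?_, hzw⟩, y, hy, rfl,
          hcz, trivial⟩, fun h => hne (Sym2.mk_isDiag_iff.1 h).symm, fun h => ?_⟩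
        · rw [Sym2.eq_swap] at hw
          exact nbc_of_mem_A₃ hL h3 hw w (mem_nbc_self _ _)
        · have h5 : p.A₄ (L ++ [some s(z, y)]) = insert s(z, y) (p.A₄ L) :=
            seg_append_some _ ha hb
          rw [(hdef L _ ha).1, (hdef L _ ha).2, h5]
          have h6 : ∑ z' ∈ p.around L v, min (cnt (p.R \ p.X L) (p.A₄ L) z') p.d <
              ∑ z' ∈ p.around L v,
                min (cnt (p.R \ p.X L) (insert s(z, y) (p.A₄ L)) z') p.d := by
            refine sum_lt_sum (fun z' _ => min_le_min_right _ (cnt_mono (Subset.refl _)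
              (subset_insert _ _) z')) ⟨z, mem_around.2 ⟨w, hw, hwv, hzw⟩, ?_⟩
            have := cnt_lt_cnt_insert (A := p.A₄ L) hy (fun h' => h (seg_subset_accepted h')) hne
            omega
          exact_mod_cast h6
  · intro L hL _ ⟨_, h, _⟩
    have h1 : ∑ z ∈ p.around L v, min (cnt (p.R \ p.X L) (p.A₄ L) z) p.d ≤
        #(p.around L v) * p.d := by
      rw [← smul_eq_mul]
      exact sum_le_card_nsmul _ _ _ fun _ _ => min_le_right _ _
    have h2 := h1.trans (Nat.mul_le_mul_right _ (card_around_le hL h))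
    have h3 : ((∑ z ∈ p.around L v, min (cnt (p.R \ p.X L) (p.A₄ L) z) p.d : ℕ) : ℝ) ≤
        (((p.D + 1) * 2 * p.d : ℕ) : ℝ) := by exact_mod_cast h2
    push_cast at h3 ⊢
    linarith

/-- The last phase produces a Hamilton cycle. -/
lemma Ex_close_fail_le (hK : 0 < K) {s₅ : ℕ} (hN : K * s₅ ≤ #(edges n)) (hr : 1 ≤ r)
    (hq : p.q + 2 * r = n) (hs : p.s₄ + 2 * r < s₅) (hd : 6 * κ < p.d) (hm : 0 < m)
    (hM : 36 * (K * s₅) ≤ m ^ 2) :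
    Ex (edges n) (K * s₅) (fun l => if Cond K Δ m κ p.policy p.s₄
      (fun L => (∃ F' R', Ready p.q p.d (accepted (L.take p.s₄)) F' R') ∧ ¬ HamList (accepted L)) l
        then 1 else 0) [] ≤
      72 * r * #(edges n) / (K * m ^ 2 * (s₅ - p.s₄ - 2 * r)) := by
  have hK0 : (0 : ℝ) < K := by exact_mod_cast hK
  have hm0 : (0 : ℝ) < m := by exact_mod_cast hm
  refine (Ex_cond_le_div (J := 2 * r) (z := fun i => (m : ℝ) ^ 2 / 36) hK hs hN
    (fun i _ => by positivity) ?_ ?_ ?_).trans (le_of_eq ?_)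
  · intro L L' hl ⟨h1, h2⟩
    rw [List.take_append_of_le_length hl] at h1
    exact ⟨h1, fun h => h2 (h.mono (by rw [accepted_append]; exact subset_union_left))⟩
  · intro L H hL ha hb ⟨h1, h2⟩ hH hacc hHc
    obtain ⟨R', hready⟩ := exists_ready_repaired h1
    have h3 := hready.minVirt_le
    rw [Fintype.card_fin] at h3
    have h4 := (acceptedSince_le_minVirt hL ha).2 h2
    have hF' : p.F' L = repaired p.q p.d (accepted (L.take p.s₄)) := rfl
    rw [← hF'] at h3 hready
    refine ⟨by omega, univ.filter fun e => e ∈ p.useful L ∧ ¬ e.IsDiag, ?_, fun e he =>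
      (mem_filter.1 (mem_sdiff.1 he).1).2⟩
    obtain ⟨l₀, hl₀, hFl⟩ := hready.2.1
    have hsub : accepted (L.take p.s₄) ⊆ accepted L := accepted_take_subset
    set J := univ.filter fun e => e ∈ p.useful L ∧ ¬ e.IsDiag with hJ
    have h5 := sq_le_card_boosters (m := m) hd
      (fun Y hY => by convert (hH.mono hacc).span_le Y hY) hready.2.2.2.1
      (hready.1.trans hsub)
      (fun x hx => (hready.2.2.2.2 x hx).trans (cnt_mono (Subset.refl _) hsub x)) hl₀ hFl
      (by rw [Fintype.card_fin]; omega) h2 J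
      (fun e he _ h => mem_filter.2 ⟨mem_univ _, (useful_eq_five ha h2).2 h, he⟩)
    have h6 : #J ≤ #(J \ H) + #H := by
      have := card_le_card (subset_union_left (s₁ := J) (s₂ := H))
      rw [← sdiff_union_self_eq_union] at this
      exact this.trans (card_union_le _ _)
    have h7 : m ^ 2 ≤ 36 * #(J \ H) := by omega
    rw [div_le_iff₀ (by norm_num)]
    have : ((m ^ 2 : ℕ) : ℝ) ≤ ((36 * #(J \ H) : ℕ) : ℝ) := by exact_mod_cast h7
    push_cast at this
    linarith
  · intro L hL hl ⟨h1, h2⟩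
    obtain ⟨R', hready⟩ := exists_ready_repaired h1
    have h3 := hready.minVirt_le
    rw [Fintype.card_fin] at h3
    have h4 := (acceptedSince_le_minVirt hL (by omega)).2 h2
    have hF' : p.F' L = repaired p.q p.d (accepted (L.take p.s₄)) := rfl
    rw [← hF'] at h3
    omega
  · have hD : (0 : ℝ) < s₅ - p.s₄ - 2 * r := by
      have : ((p.s₄ + 2 * r : ℕ) : ℝ) < s₅ := by exact_mod_cast hs
      push_cast at this; linarith
    rw [sum_const, card_range, nsmul_eq_mul]
    push_cast
    field_simp
    ring

end Phases

end Params

section Success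

variable {n K Δ m κ r x : ℕ} {p : Params (Fin n)}

open Params

open Classical in
/-- If no phase fails, then there is a Hamilton cycle and few edges have been accepted. -/
lemma hamList_and_card_le {L : List (Option (Sym2 (Fin n)))} (hL : ValidLog p.policy L)
    (hr : 1 ≤ r) (hq : p.q + 2 * r = n) (hs : p.s₄ ≤ L.length) (hd : 2 * κ < p.d) (hx : x ≤ m)
    (hS : Sparse Δ m κ (accepted L)) (c₁ : ¬ #(p.F (L.take p.s₁)) < p.q)
    (c₂ : 2 * #(univ.filter fun v => #(p.F (L.take p.s₂)) = p.q ∧ v ∈ low (p.F (L.take p.s₂)) ∧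
      cnt p.R (p.A₂ (L.take p.s₂)) v < 2 * p.d) ≤ x)
    (c₃ : ∀ v, ¬ (#(p.F (L.take p.s₃)) = p.q ∧ #(p.X (L.take p.s₃)) ≤ x ∧
      v ∈ p.X (L.take p.s₃) ∧ cnt univ (p.A₃ (L.take p.s₃)) v < p.D + 1))
    (c₄ : ∀ v, ¬ (#(p.X (L.take p.s₄)) ≤ x ∧ v ∈ p.X (L.take p.s₄) ∧
      p.D ≤ #(p.lacking (L.take p.s₄) v)))
    (c₅ : ¬ ((∃ F' R', Ready p.q p.d (accepted (L.take p.s₄)) F' R') ∧ ¬ HamList (accepted L))) :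
    HamList (accepted L) ∧ #(accepted L) ≤
      p.q + 8 * r * p.d + x * (p.D + 1) + 2 * (x * (p.D + 1)) * p.d + 2 * r := by
  have h12 := p.h₁₂
  have h23 := p.h₂₃
  have h34 := p.h₃₄
  rw [F_take le_rfl] at c₁
  have hF : #(p.F L) = p.q := le_antisymm (linForest_F hL).2 (not_lt.1 c₁)
  simp only [F_take h12, A₂_take le_rfl, hF, true_and] at c₂
  simp only [F_take (h12.trans h23), X_take h23, A₃_take le_rfl, hF, true_and] at c₃
  have hX : #(p.X L) ≤ x := by
    rw [X]
    have hb : 2 * #((low (p.F L)).filter fun v => cnt p.R (p.A₂ L) v < 2 * p.d) ≤ x := by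
      refine le_trans (Nat.mul_le_mul_left _ (card_le_card fun v hv => ?_)) c₂
      exact mem_filter.2 ⟨mem_univ _, mem_filter.1 hv⟩
    refine (card_core_le_two_mul hd (fun Y hY => ?_) (hb.trans hx)).trans hb
    have := (hS.mono (seg_subset_accepted (a := p.s₁) (b := p.s₂))).span_le Y hY
    convert this using 3
    rfl
  have hlack : ∀ v, p.lacking (L.take p.s₄) v = p.lacking L v := by
    intro v
    ext z
    rw [mem_lacking, mem_lacking, F_take (h12.trans (h23.trans h34)), X_take (h23.trans h34),
      A₃_take h34, A₄_take le_rfl]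
  simp only [X_take (h23.trans h34), hlack, hX, true_and] at c₃ c₄
  have hready := exists_ready hL hF (fun v hv => not_lt.1 fun h => c₃ v ⟨hv, h⟩)
    (fun v hv => not_le.1 fun h => c₄ v ⟨hv, h⟩)
  refine ⟨by_contra fun h => c₅ ⟨hready, h⟩, ?_⟩
  have h1 := card_accepted_le_budget hL (r := r) (by rw [hF, hq, Fintype.card_fin]) hX
  have h2 := card_accepted_le p.s₄ L
  have h3 := (acceptedSince_le_minVirt hL hs).1
  obtain ⟨R', hR'⟩ := exists_ready_repaired hready
  have h4 := hR'.minVirt_le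
  have hF' : p.F' L = repaired p.q p.d (accepted (L.take p.s₄)) := rfl
  rw [← hF', Fintype.card_fin] at h4
  rw [hF] at h1
  omega

lemma logOf_take (hK : 0 < K) {U : List (Option (Sym2 (Fin n))) → Finset (Sym2 (Fin n))}
    {l : List (Sym2 (Fin n))} {s t : ℕ} (hl : l.length = K * t) (hs : s ≤ t) :
    (logOf K U l).take s = logOf K U (l.take (K * s)) := by
  have h := Nat.mul_le_mul_left K hs
  have := logOf_append_take (U := U) hK (h := l.take (K * s)) (b := l.drop (K * s)) (s := s)
    (t := t - s) (by simp [hl, h]) (by simp [hl, Nat.mul_sub])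
  rwa [List.take_append_drop] at this

lemma Ex_comp_take_le {S : Finset (Sym2 (Fin n))} {f : List (Sym2 (Fin n)) → ℝ} {a c : ℕ}
    (h : a ≤ c) (hc : c ≤ #S) : Ex S c (fun l => f (l.take a)) [] ≤ Ex S a f [] := by
  obtain ⟨b, rfl⟩ := Nat.exists_eq_add_of_le h
  exact Ex_take_le a b hc

open Classical in
/-- A lower bound for the success probability of the strategy. -/
lemma one_sub_le_pr_success (hK : 0 < K) {s₅ : ℕ} (hN : K * s₅ ≤ #(edges n)) (h45 : p.s₄ ≤ s₅)
    (hr : 1 ≤ r) (hq : p.q + 2 * r = n) (hd : 2 * κ < p.d) (hx : x ≤ m) (hx1 : 1 ≤ x)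
    {δ₀ δ₁ δ₂ δ₃ δ₄ δ₅ : ℝ}
    (H₀ : Ex (edges n) (K * s₅) (fun l => if Sparse Δ m κ l.toFinset then 0 else 1) [] ≤ δ₀)
    (H₁ : Ex (edges n) (K * p.s₁) (fun l => if Cond K Δ m κ p.policy 0
      (fun L => #(p.F L) < p.q) l then 1 else 0) [] ≤ δ₁)
    (H₂ : ∀ v, Ex (edges n) (K * p.s₂) (fun l => if Cond K Δ m κ p.policy p.s₁
      (fun L => #(p.F L) = p.q ∧ v ∈ low (p.F L) ∧ cnt p.R (p.A₂ L) v < 2 * p.d) l then 1 else 0)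
        [] ≤ δ₂)
    (H₃ : ∀ v, Ex (edges n) (K * p.s₃) (fun l => if Cond K Δ m κ p.policy p.s₂
      (fun L => #(p.F L) = p.q ∧ #(p.X L) ≤ x ∧ v ∈ p.X L ∧ cnt univ (p.A₃ L) v < p.D + 1) l
        then 1 else 0) [] ≤ δ₃)
    (H₄ : ∀ v, Ex (edges n) (K * p.s₄) (fun l => if Cond K Δ m κ p.policy p.s₃
      (fun L => #(p.X L) ≤ x ∧ v ∈ p.X L ∧ p.D ≤ #(p.lacking L v)) l then 1 else 0) [] ≤ δ₄)
    (H₅ : Ex (edges n) (K * s₅) (fun l => if Cond K Δ m κ p.policy p.s₄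
      (fun L => (∃ F' R', Ready p.q p.d (accepted (L.take p.s₄)) F' R') ∧ ¬ HamList (accepted L)) l
        then 1 else 0) [] ≤ δ₅) :
    1 - (δ₀ + δ₁ + 2 * n / x * δ₂ + n * δ₃ + n * δ₄ + δ₅) ≤
      pr n (fun σ => HamList (selected n K (policyAlg n K p.policy) σ s₅) ∧
        #(selected n K (policyAlg n K p.policy) σ s₅) ≤
          p.q + 8 * r * p.d + x * (p.D + 1) + 2 * (x * (p.D + 1)) * p.d + 2 * r) := by
  have h12 := p.h₁₂
  have h23 := p.h₂₃
  have h34 := p.h₃₄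
  have hx0 : (0 : ℝ) < x := by exact_mod_cast hx1
  set f₁ : List (Sym2 (Fin n)) → ℝ := fun l => if Cond K Δ m κ p.policy 0
      (fun L => #(p.F L) < p.q) l then 1 else 0 with hf₁
  set f₂ : Fin n → List (Sym2 (Fin n)) → ℝ := fun v l => if Cond K Δ m κ p.policy p.s₁
      (fun L => #(p.F L) = p.q ∧ v ∈ low (p.F L) ∧ cnt p.R (p.A₂ L) v < 2 * p.d) l then 1 else 0
    with hf₂
  set f₃ : Fin n → List (Sym2 (Fin n)) → ℝ := fun v l => if Cond K Δ m κ p.policy p.s₂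
      (fun L => #(p.F L) = p.q ∧ #(p.X L) ≤ x ∧ v ∈ p.X L ∧ cnt univ (p.A₃ L) v < p.D + 1) l
        then 1 else 0 with hf₃
  set f₄ : Fin n → List (Sym2 (Fin n)) → ℝ := fun v l => if Cond K Δ m κ p.policy p.s₃
      (fun L => #(p.X L) ≤ x ∧ v ∈ p.X L ∧ p.D ≤ #(p.lacking L v)) l then 1 else 0 with hf₄
  set f₅ : List (Sym2 (Fin n)) → ℝ := fun l => if Cond K Δ m κ p.policy p.s₄
      (fun L => (∃ F' R', Ready p.q p.d (accepted (L.take p.s₄)) F' R') ∧ ¬ HamList (accepted L)) l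
        then 1 else 0 with hf₅
  set f₀ : List (Sym2 (Fin n)) → ℝ := fun l => if Sparse Δ m κ l.toFinset then 0 else 1 with hf₀
  have p₀ : ∀ l, 0 ≤ f₀ l := fun l => by simp only [hf₀]; split_ifs <;> norm_num
  have p₁ : ∀ l, 0 ≤ f₁ l := fun l => by simp only [hf₁]; split_ifs <;> norm_num
  have p₂ : ∀ v l, 0 ≤ f₂ v l := fun v l => by simp only [hf₂]; split_ifs <;> norm_num
  have p₃ : ∀ v l, 0 ≤ f₃ v l := fun v l => by simp only [hf₃]; split_ifs <;> norm_num
  have p₄ : ∀ v l, 0 ≤ f₄ v l := fun v l => by simp only [hf₄]; split_ifs <;> norm_num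
  have p₅ : ∀ l, 0 ≤ f₅ l := fun l => by simp only [hf₅]; split_ifs <;> norm_num
  have q₂ : ∀ l, 0 ≤ ∑ v, f₂ v l := fun l => sum_nonneg fun v _ => p₂ v l
  have q₃ : ∀ l, 0 ≤ ∑ v, f₃ v l := fun l => sum_nonneg fun v _ => p₃ v l
  have q₄ : ∀ l, 0 ≤ ∑ v, f₄ v l := fun l => sum_nonneg fun v _ => p₄ v l
  set g : List (Sym2 (Fin n)) → ℝ := fun l => f₀ l + f₁ (l.take (K * p.s₁)) +
    2 / x * ∑ v, f₂ v (l.take (K * p.s₂)) + ∑ v, f₃ v (l.take (K * p.s₃)) +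
    ∑ v, f₄ v (l.take (K * p.s₄)) + f₅ l with hg
  have q₂' : ∀ l, 0 ≤ 2 / (x : ℝ) * ∑ v, f₂ v l := fun l => mul_nonneg (by positivity) (q₂ l)
  refine le_trans ?_ (one_sub_le_pr (m := K * s₅) (hN.trans_eq (card_edges n)) _ g
    (fun l => by have := p₀ l; have := p₅ l; have := p₁ (l.take (K * p.s₁))
                 have := q₂' (l.take (K * p.s₂)); have := q₃ (l.take (K * p.s₃))
                 have := q₄ (l.take (K * p.s₄)); simp only [hg]; linarith) ?_)
  · have e : Ex (edges n) (K * s₅) g [] ≤ δ₀ + δ₁ + 2 * n / x * δ₂ + n * δ₃ + n * δ₄ + δ₅ := by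
      simp only [hg, Ex_add_apply, Ex_const_mul, Ex_sum]
      have m₁ := Nat.mul_le_mul_left K (h12.trans (h23.trans (h34.trans h45)))
      have m₂ := Nat.mul_le_mul_left K (h23.trans (h34.trans h45))
      have m₃ := Nat.mul_le_mul_left K (h34.trans h45)
      have m₄ := Nat.mul_le_mul_left K h45
      have b₁ := (Ex_comp_take_le (f := f₁) m₁ hN).trans H₁
      have sum_le : ∀ (f : Fin n → List (Sym2 (Fin n)) → ℝ) (a : ℕ) (δ : ℝ), a ≤ K * s₅ →
          (∀ v, Ex (edges n) a (f v) [] ≤ δ) →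
          ∑ v, Ex (edges n) (K * s₅) (fun l => f v (l.take a)) [] ≤ n * δ := by
        intro f a δ ha hf
        refine (sum_le_card_nsmul univ _ δ fun v _ =>
          (Ex_comp_take_le (f := f v) ha hN).trans (hf v)).trans_eq ?_
        rw [card_univ, Fintype.card_fin, nsmul_eq_mul]
      have b₂ := mul_le_mul_of_nonneg_left (sum_le f₂ _ δ₂ m₂ H₂)
        (by positivity : (0 : ℝ) ≤ 2 / x)
      have b₃ := sum_le f₃ _ δ₃ m₃ H₃
      have b₄ := sum_le f₄ _ δ₄ m₄ H₄
      have : 2 / (x : ℝ) * (n * δ₂) = 2 * n / x * δ₂ := by ring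
      linarith
    linarith
  · intro σ hσ
    set l := (revealList σ).take (K * s₅) with hl
    have hlen : l.length = K * s₅ := by
      rw [hl, List.length_take, length_revealList, ← card_edges]
      exact min_eq_left hN
    rw [selected_policyAlg hK _ _ hN, ← hl] at hσ
    set L := logOf K p.policy l with hL
    have hLen : L.length = s₅ := length_logOf hK hlen
    by_contra hlt
    simp only [hg, not_le] at hlt
    have a₀ := p₀ l
    have a₁ := p₁ (l.take (K * p.s₁))
    have a₂ := q₂' (l.take (K * p.s₂))
    have a₃ := q₃ (l.take (K * p.s₃))
    have a₄ := q₄ (l.take (K * p.s₄))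
    have a₅ := p₅ l
    have hS : Sparse Δ m κ l.toFinset := by
      by_contra h
      have : f₀ l = 1 := by simp only [hf₀, if_neg h]
      linarith
    have hSt : ∀ k, Sparse Δ m κ (l.take k).toFinset := fun k =>
      hS.mono (fun e he => List.mem_toFinset.2 (List.mem_of_mem_take (List.mem_toFinset.1 he)))
    have t₁ : L.take p.s₁ = logOf K p.policy (l.take (K * p.s₁)) :=
      logOf_take hK hlen (h12.trans (h23.trans (h34.trans h45)))
    have t₂ : L.take p.s₂ = logOf K p.policy (l.take (K * p.s₂)) :=
      logOf_take hK hlen (h23.trans (h34.trans h45))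
    have t₃ : L.take p.s₃ = logOf K p.policy (l.take (K * p.s₃)) :=
      logOf_take hK hlen (h34.trans h45)
    have t₄ : L.take p.s₄ = logOf K p.policy (l.take (K * p.s₄)) := logOf_take hK hlen h45
    refine hσ (hamList_and_card_le (validLog_logOf l) hr hq (by rw [hLen]; exact h45) hd hx
      (hS.mono (accepted_logOf_subset _)) (fun h => ?_) ?_ (fun v h => ?_) (fun v h => ?_)
      (fun h => ?_))
    · have : f₁ (l.take (K * p.s₁)) = 1 := by
        simp only [hf₁]
        exact if_pos ⟨hSt _, fun _ => t₁ ▸ h⟩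
      linarith
    · by_contra h
      rw [not_le] at h
      have h1 : (#(univ.filter fun v => #(p.F (L.take p.s₂)) = p.q ∧
          v ∈ low (p.F (L.take p.s₂)) ∧ cnt p.R (p.A₂ (L.take p.s₂)) v < 2 * p.d) : ℝ) ≤
          ∑ v, f₂ v (l.take (K * p.s₂)) := by
        rw [card_filter, Nat.cast_sum]
        refine sum_le_sum fun v _ => ?_
        split_ifs with hv
        · have : f₂ v (l.take (K * p.s₂)) = 1 := by
            simp only [hf₂]
            exact if_pos ⟨hSt _, fun _ => t₂ ▸ hv⟩
          rw [this, Nat.cast_one]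
        · rw [Nat.cast_zero]
          exact p₂ _ _
      have h2 : (x : ℝ) ≤ 2 * #(univ.filter fun v => #(p.F (L.take p.s₂)) = p.q ∧
          v ∈ low (p.F (L.take p.s₂)) ∧ cnt p.R (p.A₂ (L.take p.s₂)) v < 2 * p.d) := by
        exact_mod_cast h.le
      have h3 : 1 ≤ 2 / (x : ℝ) * ∑ v, f₂ v (l.take (K * p.s₂)) := by
        rw [div_mul_eq_mul_div, le_div_iff₀ hx0]
        linarith
      linarith
    · have h1 : f₃ v (l.take (K * p.s₃)) = 1 := by
        simp only [hf₃]
        exact if_pos ⟨hSt _, fun _ => t₃ ▸ h⟩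
      have h2 := single_le_sum (f := fun v => f₃ v (l.take (K * p.s₃))) (fun v _ => p₃ v _)
        (mem_univ v)
      linarith
    · have h1 : f₄ v (l.take (K * p.s₄)) = 1 := by
        simp only [hf₄]
        exact if_pos ⟨hSt _, fun _ => t₄ ▸ h⟩
      have h2 := single_le_sum (f := fun v => f₄ v (l.take (K * p.s₄))) (fun v _ => p₄ v _)
        (mem_univ v)
      linarith
    · have : f₅ l = 1 := by
        simp only [hf₅]
        exact if_pos ⟨hS, fun _ => h⟩
      linarith

end Success

open Real


lemma card_edges_eq_choose (n : ℕ) : #(edges n) = n.choose 2 := by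
  rw [card_edges, Sym2.card_subtype_not_diag, Fintype.card_fin]

lemma card_edges_le (n : ℕ) : (#(edges n) : ℝ) ≤ n ^ 2 / 2 := by
  rw [card_edges_eq_choose, Nat.cast_choose_two]
  have : (0 : ℝ) ≤ n := Nat.cast_nonneg n
  nlinarith

lemma le_card_edges {n : ℕ} (hn : 2 ≤ n) : (n : ℝ) ^ 2 / 4 ≤ #(edges n) := by
  rw [card_edges_eq_choose, Nat.cast_choose_two]
  have : (2 : ℝ) ≤ n := by exact_mod_cast hn
  nlinarith

/-- The growth conditions under which the parameters of the strategy are chosen. -/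
structure Regime (C : ℝ) (n K Y : ℕ) : Prop where
  one_le_C : 1 ≤ C
  one_le_K : 1 ≤ K
  K_le : (K : ℝ) ≤ C * log n
  pow_le_log : (Y : ℝ) ^ 20 ≤ log n
  log_le_pow : log n ≤ 2 ^ 20 * (Y : ℝ) ^ 20
  one_le_loglog : 1 ≤ log (log n)
  loglog_le : 2 ^ 40 * C * log (log n) ^ 2 ≤ Y
  pow_le : 2 ^ 100 * C * (Y : ℝ) ^ 200 ≤ n
  pow_le_exp : 4 * (Y : ℝ) ^ 61 ≤ exp Y
  le_log : 2 ^ 30 * C ≤ log Y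

/-- The number of rounds used as slack in each phase. -/
noncomputable def slack (n K : ℕ) : ℕ := ⌈n * log n / (K * log (log n))⌉₊

namespace Regime

variable {C : ℝ} {n K Y : ℕ}

lemma Y_ge (h : Regime C n K Y) : 2 ^ 40 * C ≤ Y := by
  have h1 := h.one_le_C
  have h2 := h.one_le_loglog
  refine le_trans ?_ h.loglog_le
  have : 1 ≤ log (log n) ^ 2 := one_le_pow₀ h2
  nlinarith

lemma loglog_mul_le (h : Regime C n K Y) : 2 ^ 40 * C * log (log n) ≤ Y := by
  have h1 := h.one_le_C
  have h2 := h.one_le_loglog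
  refine le_trans ?_ h.loglog_le
  have : log (log n) ≤ log (log n) ^ 2 := by nlinarith
  exact mul_le_mul_of_nonneg_left this (by positivity)

lemma Y_ge' (h : Regime C n K Y) : (2 : ℝ) ^ 40 ≤ Y := by
  have h1 := h.one_le_C
  have := h.Y_ge
  linarith

lemma one_le_Y (h : Regime C n K Y) : (1 : ℝ) ≤ Y := le_trans (by norm_num) h.Y_ge'

lemma Y_pos (h : Regime C n K Y) : 0 < Y := by
  have := h.one_le_Y
  exact_mod_cast (by linarith : (0 : ℝ) < Y)

/-- Powers of `Y` are negligible compared to `n`. -/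
lemma mul_pow_le_n (h : Regime C n K Y) {a : ℕ} (ha : a ≤ 200) : 2 ^ 100 * C * (Y : ℝ) ^ a ≤ n := by
  have h1 := h.one_le_C
  exact (mul_le_mul_of_nonneg_left (pow_le_pow_right₀ h.one_le_Y ha) (by positivity)).trans
    h.pow_le

lemma n_ge (h : Regime C n K Y) : (2 : ℝ) ^ 100 ≤ n := by
  have := h.mul_pow_le_n (a := 0) (by norm_num)
  have := h.one_le_C
  simp only [pow_zero, mul_one] at *
  linarith

lemma n_pos (h : Regime C n K Y) : (0 : ℝ) < n := lt_of_lt_of_le (by norm_num) h.n_ge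

lemma two_le_n (h : Regime C n K Y) : 2 ≤ n := by
  have : (2 : ℝ) ≤ n := le_trans (by norm_num) h.n_ge
  exact_mod_cast this

lemma log_pos (h : Regime C n K Y) : 0 < log n :=
  lt_of_lt_of_le (pow_pos (by have := h.one_le_Y; linarith) _) h.pow_le_log

lemma K_pos (h : Regime C n K Y) : (0 : ℝ) < K := by
  have := h.one_le_K
  exact_mod_cast this

lemma C_mul_log_le (h : Regime C n K Y) {a : ℕ} (ha : a ≤ 180) :
    2 ^ 80 * (C * log n) * (Y : ℝ) ^ a ≤ n := by
  have h1 := h.one_le_C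
  have h2 : C * log n ≤ C * (2 ^ 20 * (Y : ℝ) ^ 20) :=
    mul_le_mul_of_nonneg_left h.log_le_pow (by linarith)
  have h3 := h.mul_pow_le_n (a := 20 + a) (by omega)
  have h4 : 0 ≤ (Y : ℝ) ^ a := by positivity
  calc 2 ^ 80 * (C * log n) * (Y : ℝ) ^ a
      ≤ 2 ^ 80 * (C * (2 ^ 20 * (Y : ℝ) ^ 20)) * (Y : ℝ) ^ a := by gcongr
    _ = 2 ^ 100 * C * (Y : ℝ) ^ (20 + a) := by rw [pow_add]; ring
    _ ≤ n := h3

/-- The parameter `n / Y ^ a`, rounded down, as a real number. -/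
lemma div_bounds (h : Regime C n K Y) {a : ℕ} (ha : a ≤ 200) :
    ((n / Y ^ a : ℕ) : ℝ) ≤ n / (Y : ℝ) ^ a ∧ (n : ℝ) / (2 * (Y : ℝ) ^ a) ≤ (n / Y ^ a : ℕ) := by
  have hY : (0 : ℝ) < (Y : ℝ) ^ a := pow_pos (by have := h.one_le_Y; linarith) _
  constructor
  · have := Nat.cast_div_le (α := ℝ) (m := n) (n := Y ^ a)
    rwa [Nat.cast_pow] at this
  · have h1 : n < (n / Y ^ a + 1) * Y ^ a :=
      Nat.lt_mul_of_div_lt (Nat.lt_succ_self _) (pow_pos h.Y_pos a)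
    have h2 : (n : ℝ) < ((n / Y ^ a : ℕ) + 1) * (Y : ℝ) ^ a := by exact_mod_cast h1
    have h3 := h.mul_pow_le_n ha
    have h4 := h.one_le_C
    rw [div_le_iff₀ (by positivity)]
    nlinarith

lemma le_slack (h : Regime C n K Y) : n * log n / log (log n) ≤ K * (slack n K : ℝ) := by
  have h1 := h.K_pos
  have h2 := h.one_le_loglog
  have := Nat.le_ceil (n * log n / (K * log (log n)))
  rw [div_le_iff₀ (by positivity)] at this
  rw [div_le_iff₀ (by positivity), slack]
  linarith

lemma slack_le (h : Regime C n K Y) :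
    K * (slack n K : ℝ) ≤ n * log n / log (log n) + K := by
  have h1 := h.K_pos
  have h2 := h.one_le_loglog
  have h3 := h.log_pos
  have := (Nat.ceil_lt_add_one (by positivity : 0 ≤ n * log n / (K * log (log n)))).le
  have h4 : (K : ℝ) * (n * log n / (K * log (log n)) + 1) = n * log n / log (log n) + K := by
    field_simp
  rw [← h4]
  exact mul_le_mul_of_nonneg_left this h1.le

end Regime

/-- The number of rounds of the whole strategy. -/
noncomputable def horizon (n K Y : ℕ) : ℕ :=
  n + slack n K + slack n K + (⌈n * log n / (2 * K)⌉₊ + 5 * slack n K) + slack n K +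
    (2 * (n / Y ^ 11) + 1 + slack n K)

/-- The parameters of the strategy. -/
noncomputable def params (n K Y : ℕ) : Params (Fin n) where
  R := univ.filter fun v => v.val < n / Y ^ 11
  q := n - 2 * (n / Y ^ 11)
  d := 16 * Y ^ 8
  D := Y ^ 18
  s₁ := n + slack n K
  s₂ := n + slack n K + slack n K
  s₃ := n + slack n K + slack n K + (⌈n * log n / (2 * K)⌉₊ + 5 * slack n K)
  s₄ := n + slack n K + slack n K + (⌈n * log n / (2 * K)⌉₊ + 5 * slack n K) + slack n K
  h₁₂ := Nat.le_add_right _ _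
  h₂₃ := Nat.le_add_right _ _
  h₃₄ := Nat.le_add_right _ _

lemma card_R_params (n K Y : ℕ) : #(params n K Y).R = n / Y ^ 11 := by
  rw [params, Fin.card_filter_val_lt]
  exact min_eq_right (Nat.div_le_self _ _)

namespace Regime

variable {C : ℝ} {n K Y : ℕ}

lemma div_le_div_Y (h : Regime C n K Y) {a : ℕ} (ha : 1 ≤ a) (ha' : a ≤ 200) :
    ((n / Y ^ a : ℕ) : ℝ) ≤ n / Y := by
  refine (h.div_bounds ha').1.trans ?_
  have hY := h.one_le_Y
  have h0 : (0 : ℝ) < Y := by linarith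
  have : (Y : ℝ) ≤ (Y : ℝ) ^ a := le_self_pow₀ hY (by omega)
  have := h.n_pos
  gcongr

lemma div_Y_le (h : Regime C n K Y) : (n : ℝ) / Y ≤ n / (2 ^ 40 * log (log n)) := by
  have h1 := h.one_le_C
  have h2 := h.one_le_loglog
  have h3 := h.loglog_mul_le
  have := h.n_pos
  have : 2 ^ 40 * log (log n) ≤ Y := by nlinarith
  gcongr

lemma const_le (h : Regime C n K Y) : (2 : ℝ) ^ 60 ≤ n / Y := by
  have h0 : (0 : ℝ) < Y := by have := h.one_le_Y; linarith
  rw [le_div_iff₀ h0]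
  have h1 := h.mul_pow_le_n (a := 1) (by norm_num)
  have h2 := h.one_le_C
  rw [pow_one] at h1
  nlinarith

lemma horizon_le (h : Regime C n K Y) : (horizon n K Y : ℝ) ≤
    (1 + 250 / log (log n)) * (1 + log n / (2 * K)) * n := by
  have hK := h.K_pos
  have hl := h.one_le_loglog
  have hx := h.log_pos
  have hn := h.n_pos
  have h1 := (Nat.ceil_lt_add_one (by positivity : 0 ≤ n * log n / (2 * K))).le
  have h2 := (Nat.ceil_lt_add_one (by positivity : 0 ≤ n * log n / (K * log (log n)))).le
  have h3 := h.div_le_div_Y (a := 11) (by norm_num) (by norm_num)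
  have h4 := h.div_Y_le
  have h5 := h.const_le
  rw [horizon]
  change (slack n K : ℝ) ≤ _ at h2
  push_cast
  set a := (n : ℝ) / (2 ^ 40 * log (log n)) with ha
  have e : (1 + 250 / log (log n)) * (1 + log n / (2 * K)) * n =
      n + n * log n / (2 * K) + 250 * 2 ^ 40 * a + 125 * (n * log n / (K * log (log n))) := by
    rw [ha]; field_simp; ring
  rw [e]
  have : 0 ≤ n * log n / (K * log (log n)) := by positivity
  have : ((n / Y ^ 11 : ℕ) : ℝ) ≤ a := h3.trans h4
  have : 2 ^ 60 ≤ a := h5.trans h4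
  linarith

lemma K_mul_horizon_le (h : Regime C n K Y) :
    (K : ℝ) * horizon n K Y ≤ 16 * (C * log n) * n := by
  have hK := h.K_pos
  have hl := h.one_le_loglog
  have hx := h.log_pos
  have hn := h.n_pos
  have hC := h.one_le_C
  have h1 := mul_le_mul_of_nonneg_left
    (Nat.ceil_lt_add_one (by positivity : 0 ≤ n * log n / (2 * K))).le hK.le
  have h2 := h.slack_le
  have h3 := h.div_le_div_Y (a := 11) (by norm_num) (by norm_num)
  have h4 : (n : ℝ) / Y ≤ n / 8 := by
    have := h.Y_ge'
    have : (8 : ℝ) ≤ Y := by linarith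
    gcongr
  have h5 := h.n_ge
  have h6 := h.K_le
  have e1 : (K : ℝ) * (n * log n / (2 * K) + 1) = n * log n / 2 + K := by field_simp
  rw [e1] at h1
  have h7 : n * log n / log (log n) ≤ n * log n := div_le_self (by positivity) hl
  have h8 : n * log n ≤ C * log n * n := by
    have : 1 * (log n * n) ≤ C * (log n * n) := mul_le_mul_of_nonneg_right hC (by positivity)
    linarith
  have h9 : (K : ℝ) * (n + 2 * (n / Y ^ 11 : ℕ) + 11) ≤ C * log n * (2 * n) := by
    refine mul_le_mul h6 (by linarith) (by positivity) (by positivity)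
  have e2 : (K : ℝ) * horizon n K Y = K * (n + 2 * (n / Y ^ 11 : ℕ) + 11) + 9 * (K * slack n K) +
      K * ⌈n * log n / (2 * K)⌉₊ - 10 * K := by
    rw [horizon]; push_cast; ring
  rw [e2]
  have : 0 ≤ n * log n := by positivity
  linarith

lemma K_mul_horizon_le_card (h : Regime C n K Y) :
    2 * ((K : ℝ) * horizon n K Y) ≤ #(edges n) := by
  have h1 := h.K_mul_horizon_le
  have h2 := le_card_edges h.two_le_n
  have h3 := h.C_mul_log_le (a := 0) (by norm_num)
  have h4 := h.n_pos
  rw [pow_zero, mul_one] at h3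
  have : 2 ^ 80 * (C * log n) * n ≤ (n : ℝ) ^ 2 := by
    rw [sq]; exact mul_le_mul_of_nonneg_right h3 h4.le
  have : 0 < C * log n * n := mul_pos (mul_pos (by have := h.one_le_C; linarith) h.log_pos) h4
  linarith

lemma K_mul_horizon_le_sq (h : Regime C n K Y) {a : ℕ} (ha : a ≤ 80) :
    (2 ^ 20 * ((K : ℝ) * horizon n K Y)) ≤ ((n / Y ^ a : ℕ) : ℝ) ^ 2 := by
  have h1 := h.K_mul_horizon_le
  have h2 := (h.div_bounds (a := a) (by omega)).2
  have h3 := h.C_mul_log_le (a := 2 * a) (by omega)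
  have h4 := h.n_pos
  have hY : (0 : ℝ) < (Y : ℝ) ^ a := pow_pos (by have := h.one_le_Y; linarith) _
  have h5 : (n / (2 * (Y : ℝ) ^ a)) ^ 2 ≤ ((n / Y ^ a : ℕ) : ℝ) ^ 2 := by gcongr
  refine le_trans ?_ h5
  rw [div_pow, le_div_iff₀ (by positivity), mul_pow, ← pow_mul, mul_comm a 2]
  have h6 : 2 ^ 80 * (C * log n) * (Y : ℝ) ^ (2 * a) * n ≤ (n : ℝ) ^ 2 := by
    rw [sq]; exact mul_le_mul_of_nonneg_right h3 h4.le
  have h7 : 0 < (Y : ℝ) ^ (2 * a) := by rw [pow_mul']; positivity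
  have h8 := mul_le_mul_of_nonneg_right h1 h7.le
  have : 0 < C * log n * n := mul_pos (mul_pos (by have := h.one_le_C; linarith) h.log_pos) h4
  have : 0 < C * log n * n * (Y : ℝ) ^ (2 * a) := by positivity
  linarith

lemma budget (h : Regime C n K Y) :
    (((params n K Y).q + 8 * (n / Y ^ 11) * (params n K Y).d +
      n / Y ^ 60 * ((params n K Y).D + 1) +
      2 * (n / Y ^ 60 * ((params n K Y).D + 1)) * (params n K Y).d + 2 * (n / Y ^ 11) : ℕ) : ℝ) ≤
      (1 + 11 / log (log n)) * n := by
  have hn := h.n_pos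
  have hY := h.one_le_Y
  have hY0 : (0 : ℝ) < Y := by linarith
  have hl := h.one_le_loglog
  have h1 := (h.div_bounds (a := 11) (by norm_num)).1
  have h2 := (h.div_bounds (a := 60) (by norm_num)).1
  have h3 := h.div_Y_le
  have h4 : 2 * (n / Y ^ 11) ≤ n := by
    have := h.div_le_div_Y (a := 11) (by norm_num) (by norm_num)
    have h8 : (n : ℝ) / Y ≤ n / 2 := by
      have := h.Y_ge'
      have : (2 : ℝ) ≤ Y := by linarith
      gcongr
    have : (2 : ℝ) * (n / Y ^ 11 : ℕ) ≤ n := by linarith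
    exact_mod_cast this
  have key : ∀ a b : ℕ, b + 1 ≤ a → (n : ℝ) / (Y : ℝ) ^ a * (Y : ℝ) ^ b ≤ n / Y := by
    intro a b hab
    rw [div_mul_eq_mul_div, div_le_div_iff₀ (by positivity) hY0, mul_assoc, ← pow_succ]
    exact mul_le_mul_of_nonneg_left (pow_le_pow_right₀ hY hab) hn.le
  have k1 := key 11 8 (by norm_num)
  have k2 := key 60 18 (by norm_num)
  have k3 := key 60 26 (by norm_num)
  have k4 : (1 : ℝ) ≤ (Y : ℝ) ^ 18 := one_le_pow₀ hY
  have h5 : 8 * ((n / Y ^ 11 : ℕ) : ℝ) * (16 * (Y : ℝ) ^ 8) ≤ 128 * (n / Y) := by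
    have := mul_le_mul_of_nonneg_right h1 (by positivity : (0 : ℝ) ≤ (Y : ℝ) ^ 8)
    linarith
  have h6 : ((n / Y ^ 60 : ℕ) : ℝ) * ((Y : ℝ) ^ 18 + 1) ≤ 2 * (n / Y) := by
    have : ((n / Y ^ 60 : ℕ) : ℝ) * ((Y : ℝ) ^ 18 + 1) ≤
      n / (Y : ℝ) ^ 60 * (2 * (Y : ℝ) ^ 18) := by
      gcongr
      linarith
    linarith
  have h7 : 2 * (((n / Y ^ 60 : ℕ) : ℝ) * ((Y : ℝ) ^ 18 + 1)) * (16 * (Y : ℝ) ^ 8) ≤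
      64 * (n / Y) := by
    have : ((n / Y ^ 60 : ℕ) : ℝ) * ((Y : ℝ) ^ 18 + 1) ≤
      n / (Y : ℝ) ^ 60 * (2 * (Y : ℝ) ^ 18) := by
      gcongr
      linarith
    have := mul_le_mul_of_nonneg_right this (by positivity : (0 : ℝ) ≤ (Y : ℝ) ^ 8)
    have e : n / (Y : ℝ) ^ 60 * (2 * (Y : ℝ) ^ 18) * (Y : ℝ) ^ 8 =
        2 * (n / (Y : ℝ) ^ 60 * (Y : ℝ) ^ 26) := by ring
    linarith
  simp only [params]
  push_cast [Nat.cast_sub h4]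
  have e : (1 + 11 / log (log n)) * n = n + 11 * 2 ^ 40 * (n / (2 ^ 40 * log (log n))) := by
    field_simp
  rw [e]
  have : (0 : ℝ) ≤ n / (2 ^ 40 * log (log n)) := by positivity
  linarith

end Regime

lemma choose_le_exp {n y : ℕ} (hn : 0 < n) (hy : 0 < y) :
    (n.choose y : ℝ) ≤ exp (y * (1 + log (n / y))) := by
  have hn0 : (0 : ℝ) < n := by exact_mod_cast hn
  have hy0 : (0 : ℝ) < y := by exact_mod_cast hy
  have hf : (0 : ℝ) < (y.factorial : ℝ) := by exact_mod_cast y.factorial_pos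
  have h1 := pow_div_factorial_le_exp (y : ℝ) hy0.le y
  rw [div_le_iff₀ hf] at h1
  have e : exp (y * (1 + log (n / y))) = exp y * (n / y : ℝ) ^ y := by
    rw [mul_add, mul_one, exp_add, exp_nat_mul (log _), exp_log (by positivity)]
  rw [e, div_pow, ← mul_div_assoc, le_div_iff₀ (by positivity)]
  have h2 : (n.choose y : ℝ) * y.factorial ≤ (n : ℝ) ^ y := by
    rw [← le_div_iff₀ hf]; exact Nat.choose_le_pow_div y n
  calc (n.choose y : ℝ) * (y : ℝ) ^ y ≤ n.choose y * (exp y * y.factorial) := by gcongr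
    _ = exp y * (n.choose y * y.factorial) := by ring
    _ ≤ exp y * (n : ℝ) ^ y := by gcongr

namespace Regime

variable {C : ℝ} {n K Y : ℕ}

lemma exp_neg_le (h : Regime C n K Y) : exp (-(Y : ℝ)) ≤ 1 / Y := by
  have h0 : (0 : ℝ) < Y := by have := h.one_le_Y; linarith
  rw [exp_neg, ← one_div]
  have := add_one_le_exp (Y : ℝ)
  exact one_div_le_one_div_of_le h0 (by linarith)

lemma exp_log_n (h : Regime C n K Y) : exp (log n) = n := exp_log h.n_pos

lemma horizon_lt (h : Regime C n K Y) : K * horizon n K Y < #(edges n) := by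
  have h1 := h.K_mul_horizon_le_card
  have h2 := le_card_edges h.two_le_n
  have h3 := h.n_pos
  have h4 : (0 : ℝ) < (n : ℝ) ^ 2 := by positivity
  have : ((K * horizon n K Y : ℕ) : ℝ) < #(edges n) := by push_cast; linarith
  exact_mod_cast this

lemma odds_le (h : Regime C n K Y) : ((K * horizon n K Y : ℕ) : ℝ) /
    (#(edges n) - (K * horizon n K Y : ℕ)) ≤ 128 * (C * log n) / n := by
  have h1 := h.K_mul_horizon_le_card
  have h2 := le_card_edges h.two_le_n
  have h3 := h.n_pos
  have h4 := h.K_mul_horizon_le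
  have h5 : 0 < C * log n := mul_pos (by have := h.one_le_C; linarith) h.log_pos
  have h6 : (0 : ℝ) < (n : ℝ) ^ 2 := by positivity
  push_cast
  rw [div_le_div_iff₀ (by linarith) h3]
  have h7 : 128 * (C * log n) * ((n : ℝ) ^ 2 / 8) ≤
      128 * (C * log n) * (#(edges n) - K * horizon n K Y) :=
    mul_le_mul_of_nonneg_left (by linarith) (by positivity)
  refine le_trans ?_ h7
  have := mul_le_mul_of_nonneg_right h4 h3.le
  linarith

lemma C_log_le (h : Regime C n K Y) : C * log n ≤ 2 ^ 20 * C * (Y : ℝ) ^ 20 := by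
  have h1 := h.one_le_C
  have := mul_le_mul_of_nonneg_left h.log_le_pow (by linarith : 0 ≤ C)
  linarith

lemma degree_error_le (h : Regime C n K Y) :
    n * (((2 : ℝ) ^ (Y ^ 21))⁻¹ * exp (n * (K * horizon n K Y : ℕ) /
      (#(edges n) - (K * horizon n K Y : ℕ)))) ≤ 1 / Y := by
  have hC := h.one_le_C
  have hY := h.one_le_Y
  have hn := h.n_pos
  refine le_trans ?_ h.exp_neg_le
  have h1 : exp (n * (K * horizon n K Y : ℕ) / (#(edges n) - (K * horizon n K Y : ℕ))) ≤
      exp (128 * (C * log n)) := by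
    rw [exp_le_exp, mul_div_assoc]
    refine (mul_le_mul_of_nonneg_left h.odds_le hn.le).trans_eq ?_
    field_simp
  have h2 : ((2 : ℝ) ^ (Y ^ 21))⁻¹ ≤ exp (-((Y : ℝ) ^ 21 / 2)) := by
    rw [exp_neg]
    refine inv_anti₀ (exp_pos _) ?_
    have : exp (1 / 2) ≤ 2 := by
      have h1 := exp_bound_div_one_sub_of_interval (x := 1 / 2) (by norm_num) (by norm_num)
      norm_num at h1 ⊢
      exact h1
    calc exp ((Y : ℝ) ^ 21 / 2) = exp (1 / 2) ^ (Y ^ 21) := by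
          rw [← exp_nat_mul]; congr 1; push_cast; ring
      _ ≤ 2 ^ (Y ^ 21) := by gcongr
  calc _ ≤ exp (log n) * (exp (-((Y : ℝ) ^ 21 / 2)) * exp (128 * (C * log n))) := by
        rw [h.exp_log_n]; gcongr
    _ = exp (log n - (Y : ℝ) ^ 21 / 2 + 128 * (C * log n)) := by
        rw [← exp_add, ← exp_add]; congr 1; ring
    _ ≤ exp (-(Y : ℝ)) := by
        rw [exp_le_exp]
        have h3 := h.C_log_le
        have h4 : log n ≤ C * log n := by have := h.log_pos; nlinarith
        have h5 : (2 ^ 40 * C) * (Y : ℝ) ^ 20 ≤ Y * (Y : ℝ) ^ 20 :=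
          mul_le_mul_of_nonneg_right h.Y_ge (by positivity)
        have h6 : (Y : ℝ) ^ 21 = Y * (Y : ℝ) ^ 20 := by ring
        have h7 : (Y : ℝ) ≤ (Y : ℝ) ^ 20 := le_self_pow₀ hY (by norm_num)
        have h8 : (Y : ℝ) ^ 20 ≤ C * (Y : ℝ) ^ 20 := le_mul_of_one_le_left (by positivity) hC
        linarith

lemma one_le_base (h : Regime C n K Y) {y : ℕ} (hy : 1 ≤ y) (hy' : y ≤ n / Y ^ 15) :
    15 * log Y ≤ log (n / y) := by
  have hY : (0 : ℝ) < Y := by have := h.one_le_Y; linarith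
  have hy0 : (0 : ℝ) < y := by exact_mod_cast hy
  have h1 : (y : ℝ) ≤ n / (Y : ℝ) ^ 15 :=
    (Nat.cast_le.2 hy').trans (h.div_bounds (a := 15) (by norm_num)).1
  have h2 : (Y : ℝ) ^ 15 ≤ n / y := by
    rw [le_div_iff₀ (by positivity)] at h1 ⊢
    linarith
  have := log_le_log (by positivity) h2
  rwa [log_pow] at this

lemma span_error_le (h : Regime C n K Y) {y : ℕ} (hy : 1 ≤ y) (hy' : y ≤ n / Y ^ 15) :
    n.choose y * ((exp (log (n / y) / 5) ^ (Y ^ 8 * y))⁻¹ *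
        exp ((exp (log (n / y) / 5) - 1) * y ^ 2 * (K * horizon n K Y : ℕ) /
          (#(edges n) - (K * horizon n K Y : ℕ)))) ≤ exp (-(Y : ℝ)) ^ y := by
  have hC := h.one_le_C
  have hY := h.one_le_Y
  have hY0 : (0 : ℝ) < Y := by linarith
  have hn := h.n_pos
  have hg := h.le_log
  have hy0 : (0 : ℝ) < y := by exact_mod_cast hy
  have hl := h.one_le_base hy hy'
  set g := log (Y : ℝ) with hgd
  set ℓ := log ((n : ℝ) / y) with hℓ
  have e1 : (exp (ℓ / 5) ^ (Y ^ 8 * y))⁻¹ = exp (-(y * ((Y : ℝ) ^ 8 * ℓ / 5))) := by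
    rw [← exp_nat_mul, ← exp_neg]; congr 1; push_cast; ring
  have h2 : (exp (ℓ / 5) - 1) * y ^ 2 * (K * horizon n K Y : ℕ) /
      (#(edges n) - (K * horizon n K Y : ℕ)) ≤ y * (2 ^ 27 * C * (Y : ℝ) ^ 8) := by
    have hyn : (y : ℝ) / n = exp (-ℓ) := by
      rw [exp_neg, hℓ, exp_log (by positivity), inv_div]
    have h3 : exp (-(4 * ℓ / 5)) * (Y : ℝ) ^ 12 ≤ 1 := by
      have : (Y : ℝ) ^ 12 = exp (12 * g) := by
        rw [hgd, show (12 : ℝ) * log Y = (12 : ℕ) * log Y by norm_num, exp_nat_mul, exp_log hY0]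
      rw [this, ← exp_add, ← exp_zero, exp_le_exp]
      linarith
    have h4 : 0 ≤ 128 * (C * log n) / n := by have := h.log_pos; positivity
    calc _ = (exp (ℓ / 5) - 1) * y ^ 2 * ((K * horizon n K Y : ℕ) /
          (#(edges n) - (K * horizon n K Y : ℕ))) := by rw [mul_div_assoc]
      _ ≤ exp (ℓ / 5) * y ^ 2 * (128 * (C * log n) / n) := by
        refine mul_le_mul (by gcongr; linarith) h.odds_le (div_nonneg (Nat.cast_nonneg _) ?_)
          (by positivity)
        exact sub_nonneg.2 (Nat.cast_le.2 h.horizon_lt.le)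
      _ = y * (128 * (C * log n)) * (exp (ℓ / 5) * (y / n)) := by ring
      _ = y * (128 * (C * log n)) * exp (-(4 * ℓ / 5)) := by
        rw [hyn, ← exp_add]; congr 2; ring
      _ ≤ y * (128 * (2 ^ 20 * C * (Y : ℝ) ^ 20)) * exp (-(4 * ℓ / 5)) := by
        have := h.C_log_le; gcongr
      _ = y * (2 ^ 27 * C * (Y : ℝ) ^ 8) * (exp (-(4 * ℓ / 5)) * (Y : ℝ) ^ 12) := by ring
      _ ≤ y * (2 ^ 27 * C * (Y : ℝ) ^ 8) * 1 := by gcongr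
      _ = _ := mul_one _
  have hn' : 0 < n := by have := h.two_le_n; omega
  rw [e1, ← exp_nat_mul]
  calc _ ≤ exp (y * (1 + ℓ)) * (exp (-(y * ((Y : ℝ) ^ 8 * ℓ / 5))) *
        exp (y * (2 ^ 27 * C * (Y : ℝ) ^ 8))) := by
        have := choose_le_exp hn' hy
        gcongr
    _ = exp (y * (1 + ℓ - (Y : ℝ) ^ 8 * ℓ / 5 + 2 ^ 27 * C * (Y : ℝ) ^ 8)) := by
        rw [← exp_add, ← exp_add]; congr 1; ring
    _ ≤ exp (y * -Y) := by
        rw [exp_le_exp]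
        refine mul_le_mul_of_nonneg_left ?_ hy0.le
        have h5 : (Y : ℝ) ≤ (Y : ℝ) ^ 8 := le_self_pow₀ hY (by norm_num)
        have h6 := h.Y_ge'
        set k := (Y : ℝ) ^ 8
        have hg1 : 0 < g := by linarith
        have h7 : 15 * g * (k / 5 - 1) ≤ ℓ * (k / 5 - 1) :=
          mul_le_mul_of_nonneg_right hl (by linarith)
        have h8 : 15 * g ≤ g * k := by nlinarith
        have h9 : 2 ^ 30 * C * k ≤ g * k := mul_le_mul_of_nonneg_right hg (by linarith)
        have h10 : k ≤ C * k := le_mul_of_one_le_left (by linarith) hC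
        linarith

open Classical in
lemma Ex_not_sparse_le (h : Regime C n K Y) :
    Ex (edges n) (K * horizon n K Y)
      (fun l => if Sparse (Y ^ 21) (n / Y ^ 15) (Y ^ 8) l.toFinset then 0 else 1) [] ≤ 3 / Y := by
  have hY := h.one_le_Y
  have hY0 : (0 : ℝ) < Y := by linarith
  refine (KChoice.Ex_not_sparse_le h.horizon_lt (fun y => exp (log (n / y) / 5)) ?_).trans ?_
  · intro y hy hy'
    have h1 := h.one_le_base hy hy'
    have h2 : 0 ≤ log (Y : ℝ) := log_nonneg hY
    exact one_le_exp (by linarith)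
  · have h1 := h.exp_neg_le
    have h2 : exp (-(Y : ℝ)) ≤ 1 / 2 := by
      refine h1.trans (one_div_le_one_div_of_le (by norm_num) ?_)
      have := h.Y_ge'; linarith
    have h3 := geom_sum_Ico_le_of_lt_one (m := 1) (n := n / Y ^ 15 + 1) (exp_pos (-(Y : ℝ))).le
      (by linarith)
    have h4 : exp (-(Y : ℝ)) ^ 1 / (1 - exp (-(Y : ℝ))) ≤ 2 * (1 / Y) := by
      rw [pow_one, div_le_iff₀ (by linarith)]
      have : 0 < exp (-(Y : ℝ)) := exp_pos _
      have : (0 : ℝ) < 1 / Y := by positivity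
      nlinarith
    have h5 := sum_le_sum fun y (hy : y ∈ Icc 1 (n / Y ^ 15)) =>
      h.span_error_le (mem_Icc.1 hy).1 (mem_Icc.1 hy).2
    have e : Icc 1 (n / Y ^ 15) = Ico 1 (n / Y ^ 15 + 1) := by
      ext y; simp
    have h6 := h.degree_error_le
    refine (add_le_add h6 (h5.trans ?_)).trans (le_of_eq ?_ : 1 / (Y : ℝ) + 2 * (1 / Y) ≤ 3 / Y)
    · rw [e]; exact h3.trans h4
    · ring

end Regime

namespace Regime

variable {C : ℝ} {n K Y : ℕ}

lemma pow_le_div (h : Regime C n K Y) {a b : ℕ} (hab : a + b ≤ 200) :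
    2 ^ 99 * (Y : ℝ) ^ b ≤ (n / Y ^ a : ℕ) := by
  have hY := h.one_le_Y
  have h1 := h.mul_pow_le_n hab
  have h2 := h.one_le_C
  have h3 : (1 : ℝ) * (2 ^ 100 * (Y : ℝ) ^ (a + b)) ≤ C * (2 ^ 100 * (Y : ℝ) ^ (a + b)) :=
    mul_le_mul_of_nonneg_right h2 (by positivity)
  refine le_trans ?_ (h.div_bounds (a := a) (by omega)).2
  rw [le_div_iff₀ (by positivity)]
  rw [pow_add] at h1 h3
  linarith

lemma two_mul_div_le (h : Regime C n K Y) : 2 * (n / Y ^ 11) ≤ n := by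
  have h1 := h.div_le_div_Y (a := 11) (by norm_num) (by norm_num)
  have h2 : (n : ℝ) / Y ≤ n / 2 := by
    have := h.Y_ge'
    have : (2 : ℝ) ≤ Y := by linarith
    gcongr
  have : (2 : ℝ) * (n / Y ^ 11 : ℕ) ≤ n := by linarith
  exact_mod_cast this

lemma q_add (h : Regime C n K Y) : (params n K Y).q + 2 * (n / Y ^ 11) = n :=
  Nat.sub_add_cancel h.two_mul_div_le

lemma K_mul_le_card (h : Regime C n K Y) {s : ℕ} (hs : s ≤ horizon n K Y) :
    K * s ≤ #(edges n) :=
  (Nat.mul_le_mul_left K hs).trans h.horizon_lt.le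

lemma C_log_le_pow (h : Regime C n K Y) : C * log n ≤ (Y : ℝ) ^ 21 / 2 ^ 20 := by
  have h3 := h.C_log_le
  have h5 : (2 ^ 40 * C) * (Y : ℝ) ^ 20 ≤ Y * (Y : ℝ) ^ 20 :=
    mul_le_mul_of_nonneg_right h.Y_ge (by positivity)
  have h6 : (Y : ℝ) ^ 21 = Y * (Y : ℝ) ^ 20 := by ring
  linarith

lemma K_le_pow (h : Regime C n K Y) : (K : ℝ) ≤ (Y : ℝ) ^ 21 / 2 ^ 20 :=
  h.K_le.trans h.C_log_le_pow

lemma sq_loglog_le (h : Regime C n K Y) : 2 ^ 40 * log (log n) ^ 2 ≤ Y := by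
  have h1 := h.one_le_C
  have h2 := h.loglog_le
  have : 1 * (2 ^ 40 * log (log n) ^ 2) ≤ C * (2 ^ 40 * log (log n) ^ 2) :=
    mul_le_mul_of_nonneg_right h1 (by positivity)
  linarith

lemma exp_neg_loglog (h : Regime C n K Y) : exp (-log (log n)) ≤ 1 / Y := by
  have h0 : (0 : ℝ) < Y := by have := h.one_le_Y; linarith
  rw [exp_neg, exp_log h.log_pos, ← one_div]
  refine one_div_le_one_div_of_le h0 (le_trans ?_ h.pow_le_log)
  exact le_self_pow₀ h.one_le_Y (by norm_num)

lemma half_le (h : Regime C n K Y) : 1 / 2 ≤ 1 - exp (-log (log n)) := by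
  have h1 := h.exp_neg_loglog
  have h2 : 1 / (Y : ℝ) ≤ 1 / 2 := by
    refine one_div_le_one_div_of_le (by norm_num) ?_
    have := h.Y_ge'; linarith
  linarith

/-- The rate of progress in a phase of minimal length. -/
lemma rate_ge (h : Regime C n K Y) {b : ℕ} {A B : ℝ}
    (hA : (Y : ℝ) ^ b * (n / (4 * (Y : ℝ) ^ 11)) ≤ A)
    (hB0 : 0 < B) (hB : B ≤ n ^ 2) :
    2 ^ 37 * log (log n) * (Y : ℝ) ^ (b + 8) ≤
      (1 - exp (-log (log n))) * (K * A / B) * slack n K := by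
  have hY0 : (0 : ℝ) < Y := by have := h.one_le_Y; linarith
  have hn := h.n_pos
  have hl := h.one_le_loglog
  have h1 := h.half_le
  have h2 := h.le_slack
  have h3 := h.sq_loglog_le
  have h4 := h.pow_le_log
  have hx := h.log_pos
  set l := log (log n)
  have hA0 : 0 ≤ A := le_trans (by positivity) hA
  have h5 : (Y : ℝ) ^ b * (n / (4 * (Y : ℝ) ^ 11)) * (n * log n / l) / n ^ 2 ≤
      K * A / B * slack n K := by
    calc _ ≤ A * (K * slack n K) / B := by gcongr
      _ = _ := by ring
  have e : (Y : ℝ) ^ b * (n / (4 * (Y : ℝ) ^ 11)) * (n * log n / l) / n ^ 2 =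
      (Y : ℝ) ^ b * log n / (4 * (Y : ℝ) ^ 11 * l) := by
    field_simp
  rw [e] at h5
  have h6 : 2 * (2 ^ 37 * l * (Y : ℝ) ^ (b + 8)) ≤
      (Y : ℝ) ^ b * log n / (4 * (Y : ℝ) ^ 11 * l) := by
    rw [le_div_iff₀ (by positivity)]
    calc 2 * (2 ^ 37 * l * (Y : ℝ) ^ (b + 8)) * (4 * (Y : ℝ) ^ 11 * l)
        = (2 ^ 40 * l ^ 2) * ((Y : ℝ) ^ b * (Y : ℝ) ^ 19) := by ring
      _ ≤ Y * ((Y : ℝ) ^ b * (Y : ℝ) ^ 19) := by gcongr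
      _ = (Y : ℝ) ^ b * (Y : ℝ) ^ 20 := by ring
      _ ≤ _ := by gcongr
  have h7 : 0 ≤ K * A / B * slack n K := by positivity
  calc _ ≤ 1 / 2 * (K * A / B * slack n K) := by linarith
    _ ≤ (1 - exp (-l)) * (K * A / B * slack n K) := mul_le_mul_of_nonneg_right h1 h7
    _ = _ := by ring

lemma loglog_mul_pow_le (h : Regime C n K Y) :
    log (log n) * (Y : ℝ) ^ 19 ≤ 1 / log (log n) * log n := by
  have hl := h.one_le_loglog
  have h3 := h.sq_loglog_le
  have h4 := h.pow_le_log
  rw [one_div_mul_eq_div, le_div_iff₀ (by linarith)]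
  calc log (log n) * (Y : ℝ) ^ 19 * log (log n) = log (log n) ^ 2 * (Y : ℝ) ^ 19 := by ring
    _ ≤ Y * (Y : ℝ) ^ 19 := by
        gcongr
        have := sq_nonneg (log (log n))
        linarith
    _ = (Y : ℝ) ^ 20 := by ring
    _ ≤ log n := h4

lemma n_mul_exp_le (h : Regime C n K Y) {a b : ℝ} (hab : log n + a ≤ b) :
    n * exp a ≤ exp b := by
  calc n * exp a = exp (log n + a) := by rw [exp_add, h.exp_log_n]
    _ ≤ _ := exp_le_exp.2 hab

lemma mul_div_pow_le (h : Regime C n K Y) {a b : ℕ} (hab : b + 1 ≤ a) (ha : a ≤ 200) :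
    ((n / Y ^ a : ℕ) : ℝ) * (Y : ℝ) ^ b ≤ n / Y := by
  have hY := h.one_le_Y
  have hY0 : (0 : ℝ) < Y := by linarith
  have h1 := mul_le_mul_of_nonneg_right (h.div_bounds ha).1 (pow_nonneg hY0.le b)
  refine h1.trans ?_
  rw [div_mul_eq_mul_div, div_le_div_iff₀ (by positivity) hY0, mul_assoc, ← pow_succ]
  exact mul_le_mul_of_nonneg_left (pow_le_pow_right₀ hY hab) h.n_pos.le

lemma K_mul_sq_le (h : Regime C n K Y) :
    (K : ℝ) * ((n / Y ^ 11 : ℕ) : ℝ) ^ 2 ≤ (n : ℝ) ^ 2 / 2 ^ 20 := by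
  have hY := h.one_le_Y
  have hY0 : (0 : ℝ) < Y := by linarith
  have h1 := (h.div_bounds (a := 11) (by norm_num)).1
  have hn := h.n_pos
  calc (K : ℝ) * ((n / Y ^ 11 : ℕ) : ℝ) ^ 2 ≤ (Y : ℝ) ^ 21 / 2 ^ 20 * (n / (Y : ℝ) ^ 11) ^ 2 := by
        gcongr; exact h.K_le_pow
    _ = (n : ℝ) ^ 2 / 2 ^ 20 / Y := by field_simp
    _ ≤ (n : ℝ) ^ 2 / 2 ^ 20 := div_le_self (by positivity) hY

lemma K_mul_div_le (h : Regime C n K Y) :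
    (K : ℝ) * (((n / Y ^ 60 : ℕ) : ℝ) * (2 * (Y : ℝ) ^ 18)) ≤ (n : ℝ) / Y / 2 ^ 10 := by
  have hY := h.one_le_Y
  have hY0 : (0 : ℝ) < Y := by linarith
  have h1 := h.mul_div_pow_le (a := 60) (b := 39) (by norm_num) (by norm_num)
  have hn := h.n_pos
  calc (K : ℝ) * (((n / Y ^ 60 : ℕ) : ℝ) * (2 * (Y : ℝ) ^ 18)) ≤
      (Y : ℝ) ^ 21 / 2 ^ 20 * (((n / Y ^ 60 : ℕ) : ℝ) * (2 * (Y : ℝ) ^ 18)) := by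
        gcongr; exact h.K_le_pow
    _ = (((n / Y ^ 60 : ℕ) : ℝ) * (Y : ℝ) ^ 39) / 2 ^ 19 := by ring
    _ ≤ (n : ℝ) / Y / 2 ^ 19 := by gcongr
    _ ≤ (n : ℝ) / Y / 2 ^ 10 := by gcongr <;> norm_num

lemma K_mul_div_mul_div_le (h : Regime C n K Y) :
    (K : ℝ) * (2 * (((n / Y ^ 60 : ℕ) : ℝ) * ((Y : ℝ) ^ 18 + 1)) * (n / Y ^ 11 : ℕ)) ≤
      (n : ℝ) ^ 2 / 2 := by
  have hY := h.one_le_Y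
  have hY0 : (0 : ℝ) < Y := by linarith
  have hn := h.n_pos
  have h1 := h.K_mul_div_le
  have h2 := h.div_le_div_Y (a := 11) (by norm_num) (by norm_num)
  have h3 : (n : ℝ) / Y ≤ n := div_le_self hn.le hY
  have h4 : (Y : ℝ) ^ 18 + 1 ≤ 2 * (Y : ℝ) ^ 18 := by
    have : (1 : ℝ) ≤ (Y : ℝ) ^ 18 := one_le_pow₀ hY
    linarith
  calc _ ≤ (K : ℝ) * (2 * (((n / Y ^ 60 : ℕ) : ℝ) * (2 * (Y : ℝ) ^ 18)) * (n / Y ^ 11 : ℕ)) := by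
        gcongr
    _ = 2 * ((K : ℝ) * (((n / Y ^ 60 : ℕ) : ℝ) * (2 * (Y : ℝ) ^ 18))) * (n / Y ^ 11 : ℕ) := by ring
    _ ≤ 2 * (n / Y / 2 ^ 10) * (n / Y) := by gcongr
    _ ≤ 2 * (n / 2 ^ 10) * n := by gcongr
    _ ≤ _ := by nlinarith

open Classical in
lemma Ex_paths_fail_le (h : Regime C n K Y) :
    Ex (edges n) (K * (params n K Y).s₁)
      (fun l => if Cond K (Y ^ 21) (n / Y ^ 15) (Y ^ 8) (params n K Y).policy 0
        (fun L => #((params n K Y).F L) < (params n K Y).q) l then 1 else 0) [] ≤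
      4 * log (log n) / Y := by
  have hY := h.one_le_Y
  have hY0 : (0 : ℝ) < Y := by linarith
  have hn := h.n_pos
  have hl := h.one_le_loglog
  have hx := h.log_pos
  have hK := h.K_pos
  have hs := h.le_slack
  have hr := h.pow_le_div (a := 11) (b := 0) (by norm_num)
  have hr2 := (h.div_bounds (a := 11) (by norm_num)).2
  have hsq := h.K_mul_horizon_le_sq (a := 11) (by norm_num)
  have hle : (params n K Y).s₁ ≤ horizon n K Y := by simp only [params, horizon]; omega
  have hslack : (0 : ℝ) < slack n K := by
    have : 0 < K * (slack n K : ℝ) := lt_of_lt_of_le (by positivity) hs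
    exact pos_of_mul_pos_right this hK.le
  have hslack' : 0 < slack n K := by exact_mod_cast hslack
  rw [pow_zero, mul_one] at hr
  refine (Params.Ex_paths_fail_le h.one_le_K (h.K_mul_le_card hle) (card_R_params n K Y) h.q_add
    ?_ ?_ ?_).trans ?_
  · have : (params n K Y).q ≤ n := Nat.sub_le _ _
    have : (params n K Y).s₁ = n + slack n K := rfl
    omega
  · have : (2 : ℝ) ≤ (n / Y ^ 11 : ℕ) := le_trans (by norm_num) hr
    exact_mod_cast this
  · have h1 : (K : ℝ) * (params n K Y).s₁ ≤ K * horizon n K Y := by gcongr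
    have h2 : ((4 * (K * (params n K Y).s₁) + 2 * (n / Y ^ 11) : ℕ) : ℝ) ≤
        (((n / Y ^ 11) ^ 2 : ℕ) : ℝ) := by
      push_cast
      have : 0 ≤ (K : ℝ) * (params n K Y).s₁ := by positivity
      nlinarith
    exact_mod_cast h2
  · have hq : ((params n K Y).q : ℝ) ≤ n := Nat.cast_le.2 (Nat.sub_le _ _)
    have hs1 : ((params n K Y).s₁ : ℝ) = n + slack n K := by simp [params]
    have h1 := card_edges_le n
    have h2 : n * log n / log (log n) * (n / (2 * (Y : ℝ) ^ 11)) ≤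
        K * (n / Y ^ 11 : ℕ) * ((params n K Y).s₁ - (params n K Y).q) := by
      calc _ ≤ K * (slack n K : ℝ) * (n / Y ^ 11 : ℕ) := by gcongr
        _ = K * (n / Y ^ 11 : ℕ) * slack n K := by ring
        _ ≤ _ := by gcongr; linarith
    have h3 : 0 < n * log n / log (log n) * (n / (2 * (Y : ℝ) ^ 11)) := by positivity
    calc _ ≤ 4 * (n ^ 2 / 2) / (n * log n / log (log n) * (n / (2 * (Y : ℝ) ^ 11))) := by
          gcongr
      _ = 4 * log (log n) * (Y : ℝ) ^ 11 / log n := by field_simp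
      _ ≤ 4 * log (log n) * (Y : ℝ) ^ 11 / (Y : ℝ) ^ 20 := by
          have := h.pow_le_log
          gcongr
      _ = 4 * log (log n) / (Y : ℝ) ^ 9 := by field_simp
      _ ≤ 4 * log (log n) / Y := by
          have : (Y : ℝ) ≤ (Y : ℝ) ^ 9 := le_self_pow₀ hY (by norm_num)
          gcongr

open Classical in
lemma Ex_reserve_fail_le (h : Regime C n K Y) (v : Fin n) :
    Ex (edges n) (K * (params n K Y).s₂)
      (fun l => if Cond K (Y ^ 21) (n / Y ^ 15) (Y ^ 8) (params n K Y).policy (params n K Y).s₁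
        (fun L => #((params n K Y).F L) = (params n K Y).q ∧ v ∈ low ((params n K Y).F L) ∧
          cnt (params n K Y).R ((params n K Y).A₂ L) v < 2 * (params n K Y).d) l then 1 else 0) [] ≤
      exp (-Y) := by
  have hY := h.one_le_Y
  have hY0 : (0 : ℝ) < Y := by linarith
  have hn := h.n_pos
  have hl := h.one_le_loglog
  have hle : (params n K Y).s₂ ≤ horizon n K Y := by simp only [params, horizon]; omega
  have hr := h.pow_le_div (a := 11) (b := 21) (by norm_num)
  have hr2 := (h.div_bounds (a := 11) (by norm_num)).2
  have h21 : (1 : ℝ) ≤ (Y : ℝ) ^ 21 := one_le_pow₀ hY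
  refine (Params.Ex_reserve_fail_le h.one_le_K (h.K_mul_le_card hle) (card_R_params n K Y) h.q_add
    (θ := log (log n)) (by linarith) ?_ v).trans ?_
  · have : ((Y ^ 21 + 1 : ℕ) : ℝ) ≤ (n / Y ^ 11 : ℕ) := by
      push_cast; linarith
    exact_mod_cast this
  · have hs : ((params n K Y).s₂ : ℝ) - (params n K Y).s₁ = slack n K := by simp [params]
    have hd : ((params n K Y).d : ℝ) = 16 * (Y : ℝ) ^ 8 := by simp [params]
    have h1 := h.K_mul_sq_le
    have h2 := card_edges_le n
    have h3 := le_card_edges h.two_le_n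
    have h4 : (0 : ℝ) < (n : ℝ) ^ 2 := by positivity
    have h5 := h.rate_ge (b := 0) (A := (n / Y ^ 11 : ℕ) - 1 - (Y ^ 21 : ℕ))
      (B := #(edges n) + K * (4 * (n / Y ^ 11 : ℕ) * (n / Y ^ 11 : ℕ))) ?_ ?_ ?_
    · rw [hs, hd, exp_le_exp]
      have h6 : (Y : ℝ) ≤ (Y : ℝ) ^ 8 := le_self_pow₀ hY (by norm_num)
      have h7 : 1 * (Y : ℝ) ^ 8 ≤ log (log n) * (Y : ℝ) ^ 8 := by gcongr
      rw [zero_add] at h5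
      linarith
    · have : (n : ℝ) / (4 * (Y : ℝ) ^ 11) = n / (2 * (Y : ℝ) ^ 11) / 2 := by ring
      rw [pow_zero, one_mul, this]
      push_cast
      linarith
    · have : (0 : ℝ) ≤ K * (4 * (n / Y ^ 11 : ℕ) * (n / Y ^ 11 : ℕ)) := by positivity
      linarith
    · linarith

open Classical in
lemma Ex_partners_fail_le (h : Regime C n K Y) (v : Fin n) :
    n * Ex (edges n) (K * (params n K Y).s₃)
      (fun l => if Cond K (Y ^ 21) (n / Y ^ 15) (Y ^ 8) (params n K Y).policy (params n K Y).s₂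
        (fun L => #((params n K Y).F L) = (params n K Y).q ∧ #((params n K Y).X L) ≤ n / Y ^ 60 ∧
          v ∈ (params n K Y).X L ∧
          cnt univ ((params n K Y).A₃ L) v < (params n K Y).D + 1) l then 1 else 0) [] ≤
      exp (-Y) := by
  have hY := h.one_le_Y
  have hY0 : (0 : ℝ) < Y := by linarith
  have hn := h.n_pos
  have hK := h.K_pos
  have hx := h.log_pos
  have hl := h.one_le_loglog
  have hle : (params n K Y).s₃ ≤ horizon n K Y := by simp only [params, horizon]; omega
  have hx1 := h.pow_le_div (a := 60) (b := 0) (by norm_num)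
  have hD : ((params n K Y).D : ℝ) = (Y : ℝ) ^ 18 := by simp [params]
  have h18 : (1 : ℝ) ≤ (Y : ℝ) ^ 18 := one_le_pow₀ hY
  have hW : 12 * ((n / Y ^ 11 : ℕ) : ℝ) + 9 * ((n / Y ^ 60 : ℕ) * ((Y : ℝ) ^ 18 + 1)) + 1 +
      (Y : ℝ) ^ 21 ≤ 32 * (n / Y) := by
    have h1 := h.div_le_div_Y (a := 11) (by norm_num) (by norm_num)
    have h2 := h.mul_div_pow_le (a := 60) (b := 18) (by norm_num) (by norm_num)
    have h3 : ((n / Y ^ 60 : ℕ) : ℝ) ≤ (n / Y ^ 60 : ℕ) * (Y : ℝ) ^ 18 :=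
      le_mul_of_one_le_right (Nat.cast_nonneg _) h18
    have h4 := h.pow_le_div (a := 1) (b := 21) (by norm_num)
    have h5 := h.div_le_div_Y (a := 1) (by norm_num) (by norm_num)
    have h6 : (1 : ℝ) ≤ (Y : ℝ) ^ 21 := one_le_pow₀ hY
    linarith
  have hη : (1 : ℝ) / Y ≤ 1 / (2 ^ 40 * log (log n)) := by
    have h1 := h.one_le_C
    have := h.loglog_mul_le
    have : 2 ^ 40 * log (log n) ≤ Y := by nlinarith
    gcongr
  have hη' : (1 : ℝ) / Y ≤ 1 / 2 ^ 40 := one_div_le_one_div_of_le (by norm_num) h.Y_ge'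
  have hnY : (n : ℝ) / Y = n * (1 / Y) := by ring
  set η := (1 : ℝ) / Y with hηd
  have hη0 : 0 < η := by positivity
  have hx1' : 1 ≤ n / Y ^ 60 := by
    have : (1 : ℝ) ≤ (n / Y ^ 60 : ℕ) := le_trans (by norm_num) hx1
    exact_mod_cast this
  have hW' : 12 * (n / Y ^ 11) + 9 * (n / Y ^ 60 * ((params n K Y).D + 1)) + 1 + Y ^ 21 ≤ n := by
    have : 12 * ((n / Y ^ 11 : ℕ) : ℝ) + 9 * ((n / Y ^ 60 : ℕ) * ((params n K Y).D + 1)) + 1 +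
        (Y : ℝ) ^ 21 ≤ n := by
      rw [hD]
      refine hW.trans ?_
      rw [hnY]
      nlinarith
    exact_mod_cast this
  have hb := Params.Ex_partners_fail_le (p := params n K Y) (κ := Y ^ 8) (Δ := Y ^ 21)
    (m := n / Y ^ 15) h.one_le_K (h.K_mul_le_card hle) h.q_add
    (θ := log (log n)) (by linarith) hx1' hW' v
  · refine (mul_le_mul_of_nonneg_left hb hn.le).trans ?_
    have hs : ((params n K Y).s₃ : ℝ) - (params n K Y).s₂ =
      ⌈n * log n / (2 * K)⌉₊ + 5 * slack n K := by simp [params]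
    have h1 : n * log n / 2 * (1 + 10 * (1 / log (log n))) ≤
        K * ((params n K Y).s₃ - (params n K Y).s₂) := by
      have h1 := h.le_slack
      have h2 := mul_le_mul_of_nonneg_left (Nat.le_ceil (n * log n / (2 * K))) hK.le
      have e1 : (K : ℝ) * (n * log n / (2 * K)) = n * log n / 2 := by field_simp
      have e2 : n * log n / 2 * (1 + 10 * (1 / log (log n))) =
        n * log n / 2 + 5 * (n * log n / log (log n)) := by ring
      rw [hs, e2]
      linarith
    set e := 1 / log (log n) with he
    have he0 : 0 < e := by positivity
    have he1 : e ≤ 1 := by rw [he, div_le_one (by linarith)]; exact hl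
    have hηe : η ≤ e / 2 ^ 40 := by
      rw [he]; refine hη.trans (le_of_eq ?_); field_simp
    have h2 : (#(edges n) : ℝ) + K * ((n / Y ^ 60 : ℕ) * n) ≤ n ^ 2 / 2 * (1 + η) := by
      have h1 := card_edges_le n
      have h2 := mul_le_mul_of_nonneg_right h.K_mul_div_le hn.le
      have h3 : (K : ℝ) * (n / Y ^ 60 : ℕ) * n * 1 ≤ K * (n / Y ^ 60 : ℕ) * n * (Y : ℝ) ^ 18 := by
        gcongr
      rw [hnY] at h2
      have : 0 < (n : ℝ) ^ 2 * η := by positivity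
      linarith
    have h3 : n * (1 - 32 * η) ≤ n - (12 * ((n / Y ^ 11 : ℕ) : ℝ) +
        9 * ((n / Y ^ 60 : ℕ) * ((params n K Y).D + 1)) + 1 + (Y ^ 21 : ℕ)) := by
      push_cast
      rw [hD]
      rw [hnY] at hW
      linarith
    have h4 : log n * (1 + 9 * e) ≤ (1 - exp (-log (log n))) *
        (K * (n - (12 * ((n / Y ^ 11 : ℕ) : ℝ) +
          9 * ((n / Y ^ 60 : ℕ) * ((params n K Y).D + 1)) + 1 + (Y ^ 21 : ℕ))) /
        (#(edges n) + K * ((n / Y ^ 60 : ℕ) * n))) *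
          ((params n K Y).s₃ - (params n K Y).s₂) := by
      have h5 : (1 - η) ≤ 1 - exp (-log (log n)) := by linarith [h.exp_neg_loglog]
      have hN : 0 < (#(edges n) : ℝ) + K * ((n / Y ^ 60 : ℕ) * n) := by
        have h1 := le_card_edges h.two_le_n
        have : (0 : ℝ) < (n : ℝ) ^ 2 := by positivity
        have : (0 : ℝ) ≤ K * ((n / Y ^ 60 : ℕ) * n) := by positivity
        linarith
      set W := n - (12 * ((n / Y ^ 11 : ℕ) : ℝ) +
        9 * ((n / Y ^ 60 : ℕ) * ((params n K Y).D + 1)) + 1 + (Y ^ 21 : ℕ))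
      set S := ((params n K Y).s₃ : ℝ) - (params n K Y).s₂
      set B := (#(edges n) : ℝ) + K * ((n / Y ^ 60 : ℕ) * n)
      have hpoly : (1 + 9 * e) * (1 + η) ≤ (1 - η) * ((1 - 32 * η) * (1 + 10 * e)) := by
        nlinarith [mul_nonneg hη0.le he0.le, mul_nonneg hη0.le hη0.le,
          mul_nonneg (mul_nonneg hη0.le hη0.le) he0.le]
      have h6 : 0 ≤ 1 - 32 * η := by linarith
      have hW0 : 0 ≤ W := le_trans (by positivity) h3
      have hp : 0 ≤ n * (1 - 32 * η) := by positivity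
      have e3 : (1 - exp (-log (log n))) * (K * W / B) * S =
        (1 - exp (-log (log n))) * (W * (K * S)) / B := by ring
      rw [e3, le_div_iff₀ hN]
      calc log n * (1 + 9 * e) * B ≤ log n * (1 + 9 * e) * (n ^ 2 / 2 * (1 + η)) := by gcongr
        _ = n ^ 2 / 2 * log n * ((1 + 9 * e) * (1 + η)) := by ring
        _ ≤ n ^ 2 / 2 * log n * ((1 - η) * ((1 - 32 * η) * (1 + 10 * e))) := by gcongr
        _ = (1 - η) * (n * (1 - 32 * η) * (n * log n / 2 * (1 + 10 * e))) := by ring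
        _ ≤ _ := by
          refine mul_le_mul h5 (mul_le_mul h3 h1 (by positivity) hW0) (by positivity) (by linarith)
    have h5 : log (log n) * (Y : ℝ) ^ 19 ≤ e * log n := h.loglog_mul_pow_le
    have h6 : (Y : ℝ) ^ 18 ≤ (Y : ℝ) ^ 19 := pow_le_pow_right₀ hY (by norm_num)
    have h7 : log (log n) * ((params n K Y).D + 1) ≤ 2 * (log (log n) * (Y : ℝ) ^ 19) := by
      rw [hD]
      calc log (log n) * ((Y : ℝ) ^ 18 + 1) ≤ log (log n) * (2 * (Y : ℝ) ^ 19) := by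
            gcongr
            linarith
        _ = _ := by ring
    have h8 : (Y : ℝ) ≤ log (log n) * (Y : ℝ) ^ 19 := by
      have h9 : (Y : ℝ) ≤ (Y : ℝ) ^ 19 := le_self_pow₀ hY (by norm_num)
      have h10 : 1 * (Y : ℝ) ^ 19 ≤ log (log n) * (Y : ℝ) ^ 19 := by gcongr
      linarith
    refine h.n_mul_exp_le ?_
    linarith

open Classical in
lemma Ex_repair_fail_le (h : Regime C n K Y) (v : Fin n) :
    n * Ex (edges n) (K * (params n K Y).s₄)
      (fun l => if Cond K (Y ^ 21) (n / Y ^ 15) (Y ^ 8) (params n K Y).policy (params n K Y).s₃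
        (fun L => #((params n K Y).X L) ≤ n / Y ^ 60 ∧ v ∈ (params n K Y).X L ∧
          (params n K Y).D ≤ #((params n K Y).lacking L v)) l then 1 else 0) [] ≤
      exp (-Y) := by
  have hY := h.one_le_Y
  have hY0 : (0 : ℝ) < Y := by linarith
  have hn := h.n_pos
  have hl := h.one_le_loglog
  have hle : (params n K Y).s₄ ≤ horizon n K Y := by simp only [params, horizon]; omega
  have hx1 := h.pow_le_div (a := 60) (b := 0) (by norm_num)
  have hr := h.pow_le_div (a := 11) (b := 21) (by norm_num)
  have hr2 := (h.div_bounds (a := 11) (by norm_num)).2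
  have hxr : 8 * ((n / Y ^ 60 : ℕ) : ℝ) ≤ n / (Y : ℝ) ^ 11 := by
    have h1 := (h.div_bounds (a := 60) (by norm_num)).1
    have h2 : (n : ℝ) / (Y : ℝ) ^ 60 ≤ n / ((Y : ℝ) ^ 11 * 8) := by
      have h3 : (8 : ℝ) ≤ (Y : ℝ) ^ 49 :=
        le_trans (by linarith [h.Y_ge']) (le_self_pow₀ hY (by norm_num))
      have h4 : (Y : ℝ) ^ 11 * 8 ≤ (Y : ℝ) ^ 60 := by
        calc (Y : ℝ) ^ 11 * 8 ≤ (Y : ℝ) ^ 11 * (Y : ℝ) ^ 49 := by gcongr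
          _ = _ := by ring
      gcongr
    have h3 : (n : ℝ) / ((Y : ℝ) ^ 11 * 8) = n / (Y : ℝ) ^ 11 / 8 := by field_simp
    linarith
  have hx1' : 1 ≤ n / Y ^ 60 := by
    have : (1 : ℝ) ≤ (n / Y ^ 60 : ℕ) := le_trans (by norm_num) hx1
    exact_mod_cast this
  have h11 : (n : ℝ) / (2 * (Y : ℝ) ^ 11) = n / (Y : ℝ) ^ 11 / 2 := by field_simp
  have h11' : (n : ℝ) / (4 * (Y : ℝ) ^ 11) = n / (Y : ℝ) ^ 11 / 4 := by field_simp
  have hΔ : 8 * (Y : ℝ) ^ 21 ≤ (n / Y ^ 11 : ℕ) := by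
    have : 0 ≤ (Y : ℝ) ^ 21 := by positivity
    linarith
  have hxΔ : n / Y ^ 60 + Y ^ 21 ≤ n / Y ^ 11 := by
    have : ((n / Y ^ 60 : ℕ) : ℝ) + (Y : ℝ) ^ 21 ≤ (n / Y ^ 11 : ℕ) := by
      rw [h11] at hr2
      linarith
    exact_mod_cast this
  have hb := Params.Ex_repair_fail_le (p := params n K Y) (κ := Y ^ 8) (Δ := Y ^ 21)
    (m := n / Y ^ 15) h.one_le_K (h.K_mul_le_card hle) (card_R_params n K Y)
    (θ := log (log n)) (by linarith) hxΔ hx1' v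
  refine (mul_le_mul_of_nonneg_left hb hn.le).trans (h.n_mul_exp_le ?_)
  have hD : ((params n K Y).D : ℝ) = (Y : ℝ) ^ 18 := by simp [params]
  have hd : ((params n K Y).d : ℝ) = 16 * (Y : ℝ) ^ 8 := by simp [params]
  have hs : ((params n K Y).s₄ : ℝ) - (params n K Y).s₃ = slack n K := by simp [params]
  have h1 := h.K_mul_div_mul_div_le
  have h2 := card_edges_le n
  have h3 := le_card_edges h.two_le_n
  have h4 : (0 : ℝ) < (n : ℝ) ^ 2 := by positivity
  rw [hD, hd, hs]
  suffices hrate : 2 ^ 37 * log (log n) * (Y : ℝ) ^ (18 + 8) ≤ (1 - exp (-log (log n))) *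
      (K * ((Y : ℝ) ^ 18 * ((n / Y ^ 11 : ℕ) - (n / Y ^ 60 : ℕ) - (Y ^ 21 : ℕ))) /
        (#(edges n) + K * (2 * ((n / Y ^ 60 : ℕ) * ((Y : ℝ) ^ 18 + 1)) * (n / Y ^ 11 : ℕ)))) *
        slack n K by
    have e1 : (Y : ℝ) ^ (18 + 8) = (Y : ℝ) ^ 18 * (Y : ℝ) ^ 8 := pow_add _ _ _
    have h5 : (Y : ℝ) ≤ (Y : ℝ) ^ (18 + 8) := le_self_pow₀ hY (by norm_num)
    have h6 : (Y : ℝ) ^ 20 ≤ (Y : ℝ) ^ (18 + 8) := pow_le_pow_right₀ hY (by norm_num)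
    have h7 := h.log_le_pow
    have h8 : 1 * (Y : ℝ) ^ (18 + 8) ≤ log (log n) * (Y : ℝ) ^ (18 + 8) := by gcongr
    have h9 : (1 : ℝ) * (log (log n) * (Y : ℝ) ^ 8) ≤
        (Y : ℝ) ^ 18 * (log (log n) * (Y : ℝ) ^ 8) := by
      gcongr
      exact one_le_pow₀ hY
    have e2 : log (log n) * (2 * ((Y : ℝ) ^ 18 + 1) * (16 * (Y : ℝ) ^ 8)) =
      32 * (log (log n) * (Y : ℝ) ^ (18 + 8)) + 32 * (log (log n) * (Y : ℝ) ^ 8) := by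
      rw [e1]; ring
    have e3 : (Y : ℝ) ^ 18 * (log (log n) * (Y : ℝ) ^ 8) = log (log n) * (Y : ℝ) ^ (18 + 8) := by
      rw [e1]; ring
    linarith
  refine h.rate_ge (b := 18) ?_ ?_ ?_
  · refine mul_le_mul_of_nonneg_left ?_ (by positivity)
    rw [h11] at hr2
    push_cast
    linarith
  · have : (0 : ℝ) ≤ K * (2 * ((n / Y ^ 60 : ℕ) * ((Y : ℝ) ^ 18 + 1)) * (n / Y ^ 11 : ℕ)) := by
      positivity
    linarith
  · linarith

open Classical in
lemma Ex_close_fail_le (h : Regime C n K Y) :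
    Ex (edges n) (K * horizon n K Y)
      (fun l => if Cond K (Y ^ 21) (n / Y ^ 15) (Y ^ 8) (params n K Y).policy (params n K Y).s₄
        (fun L => (∃ F' R', Ready (params n K Y).q (params n K Y).d
          (accepted (L.take (params n K Y).s₄)) F' R') ∧ ¬ HamList (accepted L)) l
        then 1 else 0) [] ≤
      144 * log (log n) / Y := by
  have hY := h.one_le_Y
  have hY0 : (0 : ℝ) < Y := by linarith
  have hn := h.n_pos
  have hl := h.one_le_loglog
  have hx := h.log_pos
  have hK := h.K_pos
  have hs := h.le_slack
  have hr := h.pow_le_div (a := 11) (b := 0) (by norm_num)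
  have hm := h.pow_le_div (a := 15) (b := 0) (by norm_num)
  have hm2 := (h.div_bounds (a := 15) (by norm_num)).2
  have hr2 := (h.div_bounds (a := 11) (by norm_num)).1
  have hsq := h.K_mul_horizon_le_sq (a := 15) (by norm_num)
  rw [pow_zero, mul_one] at hr hm
  have he : horizon n K Y = (params n K Y).s₄ + (2 * (n / Y ^ 11) + 1 + slack n K) := rfl
  refine (Params.Ex_close_fail_le h.one_le_K (h.K_mul_le_card le_rfl) (r := n / Y ^ 11)
    ?_ h.q_add ?_ ?_ ?_ ?_).trans ?_
  · have : (1 : ℝ) ≤ (n / Y ^ 11 : ℕ) := le_trans (by norm_num) hr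
    exact_mod_cast this
  · omega
  · have : (params n K Y).d = 16 * Y ^ 8 := rfl
    have := pow_pos h.Y_pos 8
    omega
  · have : (0 : ℝ) < (n / Y ^ 15 : ℕ) := lt_of_lt_of_le (by norm_num) hm
    exact_mod_cast this
  · have : 36 * ((K : ℝ) * horizon n K Y) ≤ ((n / Y ^ 15 : ℕ) : ℝ) ^ 2 := by
      have : 0 ≤ (K : ℝ) * horizon n K Y := by positivity
      linarith
    exact_mod_cast this
  · have h1 := card_edges_le n
    have h2 : n * log n / log (log n) * (n / (2 * (Y : ℝ) ^ 15)) ^ 2 ≤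
        K * ((n / Y ^ 15 : ℕ) : ℝ) ^ 2 *
          (horizon n K Y - (params n K Y).s₄ - 2 * (n / Y ^ 11 : ℕ)) := by
      calc _ ≤ K * (slack n K : ℝ) * ((n / Y ^ 15 : ℕ) : ℝ) ^ 2 := by gcongr
        _ = K * ((n / Y ^ 15 : ℕ) : ℝ) ^ 2 * slack n K := by ring
        _ ≤ _ := by gcongr; rw [he]; push_cast; linarith
    calc _ ≤ 72 * (n / (Y : ℝ) ^ 11) * (n ^ 2 / 2) /
          (n * log n / log (log n) * (n / (2 * (Y : ℝ) ^ 15)) ^ 2) := by gcongr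
      _ = 144 * log (log n) * (Y : ℝ) ^ 19 / log n := by field_simp; norm_num
      _ ≤ 144 * log (log n) * (Y : ℝ) ^ 19 / (Y : ℝ) ^ 20 := by
          have := h.pow_le_log
          gcongr
      _ = 144 * log (log n) / Y := by field_simp

end Regime

lemma pr_mono {n : ℕ} {P Q : Omega n → Prop} (h : ∀ σ, P σ → Q σ) : pr n P ≤ pr n Q := by
  rw [pr, pr]
  gcongr
  exact Nat.card_le_card_of_injective (fun σ : {σ // P σ} => (⟨σ.1, h _ σ.2⟩ : {σ // Q σ}))
    fun a b hab => Subtype.ext (congrArg (fun σ : {σ // Q σ} => σ.1) hab)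

namespace Regime

variable {C : ℝ} {n K Y : ℕ}

open Classical in
lemma one_sub_le_pr (h : Regime C n K Y) :
    1 - 154 * log (log n) / Y ≤
      pr n (fun σ =>
        HamList (selected n K (policyAlg n K (params n K Y).policy) σ (horizon n K Y)) ∧
        #(selected n K (policyAlg n K (params n K Y).policy) σ (horizon n K Y)) ≤
          (params n K Y).q + 8 * (n / Y ^ 11) * (params n K Y).d +
            n / Y ^ 60 * ((params n K Y).D + 1) +
            2 * (n / Y ^ 60 * ((params n K Y).D + 1)) * (params n K Y).d + 2 * (n / Y ^ 11)) := by
  have hY := h.one_le_Y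
  have hY0 : (0 : ℝ) < Y := by linarith
  have hn := h.n_pos
  have hl := h.one_le_loglog
  have hr := h.pow_le_div (a := 11) (b := 0) (by norm_num)
  have hx := h.pow_le_div (a := 60) (b := 0) (by norm_num)
  have hx2 := (h.div_bounds (a := 60) (by norm_num)).2
  rw [pow_zero, mul_one] at hr hx
  have hr1 : 1 ≤ n / Y ^ 11 := by
    have : (1 : ℝ) ≤ (n / Y ^ 11 : ℕ) := le_trans (by norm_num) hr
    exact_mod_cast this
  have hx1 : 1 ≤ n / Y ^ 60 := by
    have : (1 : ℝ) ≤ (n / Y ^ 60 : ℕ) := le_trans (by norm_num) hx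
    exact_mod_cast this
  have hxm : n / Y ^ 60 ≤ n / Y ^ 15 :=
    Nat.div_le_div_left (Nat.pow_le_pow_right h.Y_pos (by norm_num)) (pow_pos h.Y_pos _)
  have hd : 2 * Y ^ 8 < (params n K Y).d := by
    have : (params n K Y).d = 16 * Y ^ 8 := rfl
    have := pow_pos h.Y_pos 8
    omega
  have h45 : (params n K Y).s₄ ≤ horizon n K Y := by simp only [params, horizon]; omega
  have key := one_sub_le_pr_success h.one_le_K h.horizon_lt.le h45 hr1 h.q_add hd hxm hx1
    h.Ex_not_sparse_le h.Ex_paths_fail_le h.Ex_reserve_fail_le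
    (fun v => (le_div_iff₀' hn).2 (h.Ex_partners_fail_le v))
    (fun v => (le_div_iff₀' hn).2 (h.Ex_repair_fail_le v)) h.Ex_close_fail_le
  refine le_trans ?_ key
  have e := h.exp_neg_le
  have hx0 : (0 : ℝ) < (n / Y ^ 60 : ℕ) := by exact_mod_cast hx1
  have h2 : 2 * (n : ℝ) / (n / Y ^ 60 : ℕ) * exp (-Y) ≤ 1 / Y := by
    calc 2 * (n : ℝ) / (n / Y ^ 60 : ℕ) * exp (-Y) ≤
        2 * (n : ℝ) / (n / (2 * (Y : ℝ) ^ 60)) * exp (-Y) := by gcongr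
      _ = 4 * (Y : ℝ) ^ 60 / exp Y := by rw [exp_neg]; field_simp; norm_num
      _ ≤ 1 / Y := by
          rw [div_le_div_iff₀ (exp_pos _) hY0]
          have := h.pow_le_exp
          linarith
  have h3 : n * (exp (-Y) / n) = exp (-(Y : ℝ)) := by field_simp
  have h4 : 1 / (Y : ℝ) ≤ log (log n) / Y := by gcongr
  rw [h3]
  have e1 : 154 * log (log n) / Y = 154 * (log (log n) / Y) := by ring
  have e2 : 3 / (Y : ℝ) = 3 * (1 / Y) := by ring
  have e3 : 4 * log (log n) / Y = 4 * (log (log n) / Y) := by ring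
  have e4 : 144 * log (log n) / Y = 144 * (log (log n) / Y) := by ring
  rw [e1, e2, e3, e4]
  linarith

lemma one_sub_le_pr_isHamiltonian (h : Regime C n K Y) :
    1 - 154 / log (log n) ≤ pr n (fun σ =>
      ∃ t ≤ ⌈(1 + 250 / log (log n)) * (1 + log n / (2 * K)) * n⌉₊,
        (Bgraph n K (policyAlg n K (params n K Y).policy) σ t).IsHamiltonian ∧
        ((selected n K (policyAlg n K (params n K Y).policy) σ t).card : ℝ) ≤
          (1 + 11 / log (log n)) * n) := by
  have hY : (0 : ℝ) < Y := by have := h.one_le_Y; linarith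
  have hl := h.one_le_loglog
  have h1 : 154 * log (log n) / Y ≤ 154 / log (log n) := by
    rw [div_le_div_iff₀ hY (by linarith)]
    have := h.sq_loglog_le
    have := sq_nonneg (log (log n))
    linarith
  refine le_trans (by linarith) (h.one_sub_le_pr.trans (pr_mono fun σ hσ => ?_))
  refine ⟨horizon n K Y, ?_, HamList.isHamiltonian hσ.1 ?_, ?_⟩
  · exact_mod_cast h.horizon_le.trans (Nat.le_ceil _)
  · have : (3 : ℝ) ≤ n := le_trans (by norm_num) h.n_ge
    rw [Fintype.card_fin]
    exact_mod_cast this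
  · exact le_trans (by exact_mod_cast hσ.2) h.budget

end Regime

open Filter in
lemma eventually_mul_pow_le_exp (c : ℝ) (k : ℕ) : ∀ᶠ z : ℝ in atTop, c * z ^ k ≤ exp z := by
  have h := ((isLittleO_pow_exp_atTop (n := k)).const_mul_left c).bound one_pos
  filter_upwards [h] with z hz
  rw [norm_eq_abs, norm_eq_abs, one_mul, abs_exp] at hz
  exact (le_abs_self _).trans hz

open Filter in
lemma eventually_mul_log_sq_le (c : ℝ) : ∀ᶠ z : ℝ in atTop, c * log z ^ 2 ≤ z := by
  have h := ((isLittleO_pow_log_id_atTop (n := 2)).const_mul_left c).bound one_pos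
  filter_upwards [h, eventually_ge_atTop 0] with z hz hz0
  rw [norm_eq_abs, norm_eq_abs, one_mul, id, abs_of_nonneg hz0] at hz
  exact (le_abs_self _).trans hz

/-- The scale from which all parameters of the strategy are derived. -/
noncomputable def scale (n : ℕ) : ℕ := ⌊log n ^ (1 / 20 : ℝ)⌋₊

open Filter in
lemma eventually_regime {C : ℝ} (hC : 1 ≤ C) {K : ℕ → ℕ} (hK : ∀ n, 1 ≤ K n)
    (hKC : ∀ᶠ n : ℕ in atTop, (K n : ℝ) ≤ C * log n) :
    ∀ᶠ n : ℕ in atTop, Regime C n (K n) (scale n) := by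
  have hlog : Tendsto (fun n : ℕ => log n) atTop atTop :=
    tendsto_log_atTop.comp tendsto_natCast_atTop_atTop
  have hz : Tendsto (fun n : ℕ => log n ^ (1 / 20 : ℝ)) atTop atTop :=
    (tendsto_rpow_atTop (by norm_num)).comp hlog
  have hY : Tendsto (fun n : ℕ => (scale n : ℝ)) atTop atTop :=
    tendsto_natCast_atTop_atTop.comp (tendsto_nat_floor_atTop.comp hz)
  filter_upwards [hKC, hlog.eventually_ge_atTop 1,
    (tendsto_log_atTop.comp hlog).eventually_ge_atTop 1,
    hz.eventually_ge_atTop 2, hz.eventually (eventually_mul_log_sq_le (2 ^ 40 * C * 800)),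
    hz.eventually (eventually_mul_pow_le_exp (2 ^ 100 * C) 200),
    hY.eventually (eventually_mul_pow_le_exp 4 61),
    (tendsto_log_atTop.comp hY).eventually_ge_atTop (2 ^ 30 * C), eventually_gt_atTop 0]
    with n h1 h2 h3 h4 h5 h6 h7 h8 h9
  have hn : (0 : ℝ) < n := by exact_mod_cast h9
  have hz20 : (log n ^ (1 / 20 : ℝ)) ^ 20 = log n := by
    rw [← rpow_natCast, ← rpow_mul (by linarith)]
    norm_num
  have hfl : (scale n : ℝ) ≤ log n ^ (1 / 20 : ℝ) := Nat.floor_le (by linarith)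
  have hfl' : log n ^ (1 / 20 : ℝ) < scale n + 1 := Nat.lt_floor_add_one _
  set z := log n ^ (1 / 20 : ℝ) with hzd
  have hll : log (log n) = 20 * log z := by rw [← hz20, log_pow]; norm_num
  have hY0 : (0 : ℝ) ≤ scale n := Nat.cast_nonneg _
  refine ⟨hC, hK n, h1, ?_, ?_, h3, ?_, ?_, h7, h8⟩
  · rw [← hz20]; gcongr
  · rw [← hz20, ← mul_pow]
    gcongr
    linarith
  · rw [hll]
    linarith
  · calc 2 ^ 100 * C * (scale n : ℝ) ^ 200 ≤ 2 ^ 100 * C * z ^ 200 := by gcongr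
      _ ≤ exp z := h6
      _ ≤ exp (log n) := by
          rw [exp_le_exp, ← hz20]
          exact le_self_pow₀ (by linarith) (by norm_num)
      _ = n := exp_log hn

end KChoice

open KChoice Filter

/-- If `1 ≤ K n = O(log n)`, then there is an online algorithm for the
`K`-choice process which w.h.p., within the first
`⌈(1 + 250/log log n)·(1 + log n/(2 K n))·n⌉` rounds, produces a Hamiltonian graph
with at most `(1 + 11/log log n)·n` edges. -/
theorem hamiltonian_in_K_choice_process
    (K : ℕ → ℕ) (hK1 : ∀ n, 1 ≤ K n)
    (hKO : ∃ C : ℝ, ∀ᶠ n : ℕ in atTop, (K n : ℝ) ≤ C * Real.log n) :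
    ∃ A : (n : ℕ) → Alg n,
      Tendsto
        (fun n : ℕ =>
          pr n (fun σ =>
            ∃ t ≤ ⌈(1 + 250 / Real.log (Real.log n)) *
                    (1 + Real.log n / (2 * K n)) * n⌉₊,
              (Bgraph n (K n) (A n) σ t).IsHamiltonian ∧
              ((selected n (K n) (A n) σ t).card : ℝ) ≤
                (1 + 11 / Real.log (Real.log n)) * n))
        atTop (nhds 1) := by
  obtain ⟨C, hC⟩ := hKO
  refine ⟨fun n => policyAlg n (K n) (params n (K n) (scale n)).policy, ?_⟩
  have hlog : Tendsto (fun n : ℕ => Real.log n) atTop atTop :=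
    Real.tendsto_log_atTop.comp tendsto_natCast_atTop_atTop
  have hC' : ∀ᶠ n : ℕ in atTop, (K n : ℝ) ≤ max C 1 * Real.log n := by
    filter_upwards [hC, hlog.eventually_ge_atTop 0] with n h1 h2
    exact h1.trans (mul_le_mul_of_nonneg_right (le_max_left _ _) h2)
  have hlim : Tendsto (fun n : ℕ => 1 - 154 / Real.log (Real.log n)) atTop (nhds 1) := by
    have := (tendsto_const_nhds (x := (154 : ℝ))).div_atTop (Real.tendsto_log_atTop.comp hlog)
    simpa using this.const_sub 1
  refine tendsto_of_tendsto_of_tendsto_of_le_of_le' hlim tendsto_const_nhds ?_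
    (Eventually.of_forall fun n => pr_le_one _)
  filter_upwards [eventually_regime (le_max_right C 1) hK1 hC'] with n h
  exact h.one_sub_le_pr_isHamiltonian
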